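/- (Malgrange's division theorem.) Let U ⊆ ℝ^n be open, p,q ≥ 1, and Φ_1,…,Φ_q : U → ℝ^p real-analytic maps. Let f : U → ℝ^p be C^∞. Then there exist g_1,…,g_q ∈ C^∞(U) with f = Σ_{j=1}^q g_j·Φ_j on U if and only if for every a ∈ U there exist formal power series G_{1,a},…,G_{q,a} ∈ ℝ[[x_1,…,x_n]] such that T_a f = Σ_{j=1}^q G_{j,a}·T_a Φ_j (the scalar series G_{j,a} multiplying each component of T_a Φ_j). -/

import Mathlib

namespace QDC

/-- `M` is a sequence defining a quasianalytic Denjoy–Carleman class: positive,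
logarithmically convex, with `sup_k (M_{k+1}/M_k)^{1/k} < ∞` and
`Σ_k M_k/((k+1) M_{k+1}) = ∞`. -/
def IsDCSeq (M : ℕ → ℝ) : Prop :=
  (∀ k, 0 < M k) ∧
  (∀ k, M (k + 1) / M k ≤ M (k + 2) / M (k + 1)) ∧
  (∃ C : ℝ, ∀ k : ℕ, 1 ≤ k → (M (k + 1) / M k) ^ ((1 : ℝ) / k) ≤ C) ∧
  ¬ Summable (fun k => M k / ((k + 1) * M (k + 1)))

variable {σ : Type*} [Fintype σ] [DecidableEq σ]

/-- First-order partial derivative in the `i`-th coordinate direction. -/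
noncomputable def pd (i : σ) (f : (σ → ℝ) → ℝ) : (σ → ℝ) → ℝ :=
  fun x => fderiv ℝ f x (Pi.single i 1)

/-- Iterated partial derivative `∂^{|α|} f / ∂x^α` for a multi-index `α`. -/
noncomputable def mpd (α : σ → ℕ) (f : (σ → ℝ) → ℝ) : (σ → ℝ) → ℝ :=
  (Finset.univ : Finset σ).toList.foldr (fun i g => (pd i)^[α i] g) f

/-- `α! = α_1! ⋯ α_n!`. -/
def mfact (α : σ → ℕ) : ℕ := ∏ i, (α i).factorial

/-- `|α| = α_1 + ⋯ + α_n`. -/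
def mdeg (α : σ → ℕ) : ℕ := ∑ i, α i

/-- `f` belongs to the Denjoy–Carleman class `Q_M(V)`. -/
def MemDC (M : ℕ → ℝ) (V : Set (σ → ℝ)) (f : (σ → ℝ) → ℝ) : Prop :=
  ContDiffOn ℝ (⊤ : ℕ∞) f V ∧
  ∀ K ⊆ V, IsCompact K → ∃ A B : ℝ, 0 < A ∧ 0 < B ∧
    ∀ x ∈ K, ∀ α : σ → ℕ,
      |mpd α f x| ≤ A * B ^ mdeg α * (mfact α : ℝ) * M (mdeg α)

/-- `X` is a closed `Q_M`-subset of the open set `U`: it is closed in `U` and locally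
the common zero set of finitely many functions of class `Q_M`. -/
def IsQMClosed (M : ℕ → ℝ) {n : ℕ} (U X : Set (Fin n → ℝ)) : Prop :=
  X ⊆ U ∧ closure X ∩ U ⊆ X ∧
  ∀ b ∈ X, ∃ V : Set (Fin n → ℝ), IsOpen V ∧ b ∈ V ∧ V ⊆ U ∧
    ∃ (k : ℕ) (g : Fin k → ((Fin n → ℝ) → ℝ)),
      (∀ i, MemDC M V (g i)) ∧ X ∩ V = {x ∈ V | ∀ i, g i x = 0}

/-- `f : X∖Z → ℝ` belongs to `Q_M(X,Z)`: it is a quotient `g/h` of restrictions to `X` of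
functions of class `Q_M` on a neighbourhood of `X`, where `h` vanishes nowhere on `X∖Z`. -/
def MemQXZ (M : ℕ → ℝ) {n : ℕ} (X Z : Set (Fin n → ℝ)) (f : (Fin n → ℝ) → ℝ) : Prop :=
  ∃ (V : Set (Fin n → ℝ)) (g h : (Fin n → ℝ) → ℝ), IsOpen V ∧ X ⊆ V ∧
    MemDC M V g ∧ MemDC M V h ∧ (∀ x ∈ X \ Z, h x ≠ 0) ∧
    ∀ x ∈ X \ Z, f x = g x / h x

/-- `b` is a `Q_M`-smooth point of `X ⊆ ℝ^n`: near `b`, `X` is the graph of a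
`Q_M`-map over some subset `I` of the coordinates. -/
def QMSmoothPt (M : ℕ → ℝ) {n : ℕ} (X : Set (Fin n → ℝ)) (b : Fin n → ℝ) : Prop :=
  ∃ W : Set (Fin n → ℝ), IsOpen W ∧ b ∈ W ∧
    ∃ (I : Finset (Fin n)) (Ω : Set ({ i : Fin n // i ∈ I } → ℝ))
      (ψ : ({ i : Fin n // i ∈ I } → ℝ) → ({ i : Fin n // i ∉ I } → ℝ)),
      IsOpen Ω ∧ (∀ j : { i : Fin n // i ∉ I }, MemDC M Ω (fun u => ψ u j)) ∧
      X ∩ W = {y ∈ W | (fun i : { i : Fin n // i ∈ I } => y i) ∈ Ω ∧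
        ∀ j : { i : Fin n // i ∉ I }, y j = ψ (fun i : { i : Fin n // i ∈ I } => y i) j}

/-- The formal Taylor expansion `T_a f` of `f` at `a`, as a multivariate formal
power series. -/
noncomputable def taylorAt {n : ℕ} (f : (Fin n → ℝ) → ℝ) (a : Fin n → ℝ) :
    MvPowerSeries (Fin n) ℝ :=
  fun α : Fin n →₀ ℕ => mpd (fun i => α i) f a / (mfact fun i => α i : ℕ)

/-- `f` is flat at `x`: all iterated partial derivatives (including order `0`) vanish. -/
def FlatAt {n : ℕ} (f : (Fin n → ℝ) → ℝ) (x : Fin n → ℝ) : Prop :=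
  ∀ α : Fin n → ℕ, mpd α f x = 0

end QDC

namespace QDC
open Filter Topology
open scoped ContDiff

/-- smooth at a point -/
abbrev Sm {n : ℕ} (a : Fin n → ℝ) (f : (Fin n → ℝ) → ℝ) : Prop := ContDiffAt ℝ ∞ f a

section taylor
variable {n : ℕ} {a : Fin n → ℝ} {f g : (Fin n → ℝ) → ℝ}

theorem Sm.add' (hf : Sm a f) (hg : Sm a g) : Sm a (f + g) := ContDiffAt.add hf hg

theorem Sm.mul' (hf : Sm a f) (hg : Sm a g) : Sm a (f * g) := ContDiffAt.mul hf hg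

theorem Sm.neg' (hf : Sm a f) : Sm a (-f) := ContDiffAt.neg hf

theorem pd_congr (i : Fin n) (h : f =ᶠ[𝓝 a] g) : pd i f =ᶠ[𝓝 a] pd i g := by
  filter_upwards [h.fderiv (𝕜 := ℝ)] with x hx
  simp [pd, hx]

theorem Sm.pd (i : Fin n) (h : Sm a f) : Sm a (pd i f) := by
  have h1 : ContDiffAt ℝ ∞ (fderiv ℝ f) a := h.fderiv_right (by simp)
  exact h1.clm_apply contDiffAt_const

theorem pd_iter_congr (i : Fin n) (k : ℕ) (h : f =ᶠ[𝓝 a] g) :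
    (pd i)^[k] f =ᶠ[𝓝 a] (pd i)^[k] g := by
  induction k generalizing f g with
  | zero => simpa using h
  | succ k ih => simpa using ih (pd_congr i h)

theorem Sm.pd_iter (i : Fin n) (k : ℕ) (h : Sm a f) : Sm a ((QDC.pd i)^[k] f) := by
  induction k generalizing f with
  | zero => simpa using h
  | succ k ih => simpa using ih (h.pd i)

theorem pd_comm (i j : Fin n) (h : Sm a f) : pd i (pd j f) =ᶠ[𝓝 a] pd j (pd i f) := by
  have h2 : ContDiffAt ℝ 2 f a := h.of_le (WithTop.coe_le_coe.2 (le_top : (2 : ℕ∞) ≤ ⊤))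
  filter_upwards [h2.eventually (by simp)] with x hx
  have hs := hx.isSymmSndFDerivAt (by simp)
  have h1 : DifferentiableAt ℝ (fderiv ℝ f) x :=
    (hx.fderiv_right (m := 1) (by norm_num)).differentiableAt (by norm_num)
  have key : ∀ i j : Fin n, pd i (pd j f) x =
      fderiv ℝ (fderiv ℝ f) x (Pi.single i 1) (Pi.single j 1) := by
    intro i j
    unfold pd
    rw [fderiv_clm_apply h1 (by fun_prop)]
    simp
  rw [key, key]
  exact hs _ _

theorem pd_iter_comm (i j : Fin n) (k : ℕ) (h : Sm a f) :
    pd i ((pd j)^[k] f) =ᶠ[𝓝 a] (pd j)^[k] (pd i f) := by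
  induction k generalizing f with
  | zero => simp
  | succ k ih =>
    simp only [Function.iterate_succ, Function.comp]
    exact (ih (h.pd j)).trans (pd_iter_congr j k (pd_comm i j h))

/-- list version of mpd -/
noncomputable def lpd (l : List (Fin n)) (α : Fin n → ℕ) (f : (Fin n → ℝ) → ℝ) :
    (Fin n → ℝ) → ℝ := l.foldr (fun i g => (pd i)^[α i] g) f

theorem lpd_congr (l : List (Fin n)) (α : Fin n → ℕ) (h : f =ᶠ[𝓝 a] g) :
    lpd l α f =ᶠ[𝓝 a] lpd l α g := by
  induction l with
  | nil => simpa [lpd] using h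
  | cons i l ih => exact pd_iter_congr i _ ih

theorem Sm.lpd (l : List (Fin n)) (α : Fin n → ℕ) (h : Sm a f) : Sm a (lpd l α f) := by
  induction l with
  | nil => simpa [QDC.lpd] using h
  | cons i l ih => exact ih.pd_iter i _

theorem pd_lpd (i : Fin n) (l : List (Fin n)) (α : Fin n → ℕ) (h : Sm a f) :
    pd i (lpd l α f) =ᶠ[𝓝 a] lpd l α (pd i f) := by
  induction l with
  | nil => simp [lpd]
  | cons j l ih => exact (pd_iter_comm i j _ (h.lpd l α)).trans (pd_iter_congr j _ ih)

theorem lpd_not_mem (i : Fin n) (l : List (Fin n)) (α : Fin n → ℕ) (hi : i ∉ l) :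
    lpd l (α + Pi.single i 1) f = lpd l α f := by
  induction l with
  | nil => simp [lpd]
  | cons j l ih =>
    simp only [List.mem_cons, not_or] at hi
    have := ih hi.2
    simp only [lpd, List.foldr_cons] at this ⊢
    rw [this]
    simp [Pi.single_apply, Ne.symm hi.1]

theorem lpd_mem (i : Fin n) (l : List (Fin n)) (hl : l.Nodup) (α : Fin n → ℕ) (hi : i ∈ l)
    (h : Sm a f) : lpd l (α + Pi.single i 1) f =ᶠ[𝓝 a] pd i (lpd l α f) := by
  induction l with
  | nil => simp at hi
  | cons j l ih =>
    rw [List.nodup_cons] at hl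
    by_cases hij : i = j
    · subst hij
      have := lpd_not_mem (f := f) i l α hl.1
      simp only [lpd, List.foldr_cons] at this ⊢
      rw [this]
      simp only [Pi.add_apply, Pi.single_eq_same]
      rw [Function.iterate_succ_apply']
    · have hi' : i ∈ l := by simpa [hij] using hi
      have h1 := ih hl.2 hi'
      have h2 : lpd (j :: l) (α + Pi.single i 1) f =
          (pd j)^[α j] (lpd l (α + Pi.single i 1) f) := by
        simp [lpd, Pi.single_apply, Ne.symm hij]
      rw [h2]
      exact (pd_iter_congr j _ h1).trans (pd_iter_comm i j _ (h.lpd l α)).symm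

theorem mpd_pd (i : Fin n) (α : Fin n → ℕ) (h : Sm a f) :
    mpd α (pd i f) a = mpd (α + Pi.single i 1) f a := by
  have h1 := lpd_mem i (Finset.univ : Finset (Fin n)).toList (Finset.nodup_toList _) α (by simp) h
  have h2 := pd_lpd i (Finset.univ : Finset (Fin n)).toList α h
  exact (h1.trans h2).eq_of_nhds.symm

theorem taylorAt_congr (h : f =ᶠ[𝓝 a] g) : taylorAt f a = taylorAt g a := by
  funext α
  unfold taylorAt
  have := (lpd_congr (Finset.univ : Finset (Fin n)).toList (fun i => α i) h).eq_of_nhds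
  have h' : mpd (fun i => α i) f a = mpd (fun i => α i) g a := this
  rw [h']

theorem coeff_taylorAt (α : Fin n →₀ ℕ) : MvPowerSeries.coeff α (taylorAt f a) =
    mpd (fun i => α i) f a / (mfact fun i => α i : ℕ) := rfl

theorem mfact_succ (α : Fin n → ℕ) (i : Fin n) :
    mfact (α + Pi.single i 1) = (α i + 1) * mfact α := by
  unfold mfact
  rw [← Finset.mul_prod_erase _ _ (Finset.mem_univ i),
    ← Finset.mul_prod_erase Finset.univ (fun j => (α j).factorial) (Finset.mem_univ i)]
  have : ∏ x ∈ Finset.univ.erase i, ((α + Pi.single i 1 : Fin n → ℕ) x).factorial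
      = ∏ x ∈ Finset.univ.erase i, (α x).factorial := by
    apply Finset.prod_congr rfl
    intro x hx
    simp [Pi.single_apply, (Finset.mem_erase.1 hx).1]
  rw [this]
  simp [Nat.factorial_succ, mul_assoc]

theorem mfact_pos (α : Fin n → ℕ) : 0 < mfact α := Finset.prod_pos fun _ _ => Nat.factorial_pos _

theorem taylorAt_pd (i : Fin n) (h : Sm a f) :
    taylorAt (pd i f) a = MvPowerSeries.pderiv ℝ i (taylorAt f a) := by
  ext α
  rw [MvPowerSeries.coeff_pderiv, coeff_taylorAt, coeff_taylorAt, mpd_pd i _ h]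
  have e : (fun j => (α + Finsupp.single i 1 : Fin n →₀ ℕ) j) = (fun j => α j) + Pi.single i 1 := by
    ext j; simp [Finsupp.single_apply, Pi.single_apply, eq_comm]
  rw [e, mfact_succ]
  have := mfact_pos (fun j => α j)
  have h2 : (mfact (fun j => α j) : ℝ) ≠ 0 := by positivity
  have h3 : ((α i : ℝ) + 1) ≠ 0 := by positivity
  push_cast
  field_simp

theorem constantCoeff_taylorAt : MvPowerSeries.constantCoeff (taylorAt f a) = f a := by
  rw [← MvPowerSeries.coeff_zero_eq_constantCoeff_apply, coeff_taylorAt]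
  have : ∀ l : List (Fin n), l.foldr (fun i g => (pd i)^[(0 : Fin n →₀ ℕ) i] g) f = f := by
    intro l; induction l <;> simp_all
  simp only [mpd, this]
  simp [mfact]

theorem coeff_succ_eq (X : MvPowerSeries (Fin n) ℝ) (β : Fin n →₀ ℕ) (i : Fin n) :
    MvPowerSeries.coeff (β + Finsupp.single i 1) X =
      MvPowerSeries.coeff β (MvPowerSeries.pderiv ℝ i X) / (β i + 1) := by
  rw [MvPowerSeries.coeff_pderiv]
  have h3 : ((β i : ℝ) + 1) ≠ 0 := by positivity
  field_simp

theorem exists_succ (α : Fin n →₀ ℕ) (k : ℕ) (h : α.degree = k + 1) :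
    ∃ β i, α = β + Finsupp.single i 1 ∧ β.degree = k := by
  have : α ≠ 0 := by rintro rfl; simp at h
  obtain ⟨i, hi⟩ := Finsupp.ne_iff.1 this
  refine ⟨α - Finsupp.single i 1, i, ?_, ?_⟩
  · rw [tsub_add_cancel_of_le]
    simp only [Finsupp.single_le_iff]
    exact Nat.one_le_iff_ne_zero.2 hi
  · have h2 : α = (α - Finsupp.single i 1) + Finsupp.single i 1 := by
      rw [tsub_add_cancel_of_le]
      simp only [Finsupp.single_le_iff]
      exact Nat.one_le_iff_ne_zero.2 hi
    have := congrArg Finsupp.degree h2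
    simp at this
    omega

theorem degree_ind (X Y : MvPowerSeries (Fin n) ℝ)
    (h : ∀ k (α : Fin n →₀ ℕ), α.degree = k → MvPowerSeries.coeff α X = MvPowerSeries.coeff α Y) :
    X = Y := by
  ext α; exact h _ α rfl

theorem pd_add (i : Fin n) (hf : Sm a f) (hg : Sm a g) :
    pd i (f + g) =ᶠ[𝓝 a] pd i f + pd i g := by
  have h1 : ContDiffAt ℝ 1 f a := hf.of_le (by exact_mod_cast le_top)
  have h2 : ContDiffAt ℝ 1 g a := hg.of_le (by exact_mod_cast le_top)
  filter_upwards [h1.eventually (by simp), h2.eventually (by simp)] with x hx hy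
  simp [pd, fderiv_add (hx.differentiableAt (by simp)) (hy.differentiableAt (by simp))]

theorem pd_mul (i : Fin n) (hf : Sm a f) (hg : Sm a g) :
    pd i (f * g) =ᶠ[𝓝 a] f * pd i g + g * pd i f := by
  have h1 : ContDiffAt ℝ 1 f a := hf.of_le (by exact_mod_cast le_top)
  have h2 : ContDiffAt ℝ 1 g a := hg.of_le (by exact_mod_cast le_top)
  filter_upwards [h1.eventually (by simp), h2.eventually (by simp)] with x hx hy
  simp [pd, fderiv_mul (hx.differentiableAt (by simp)) (hy.differentiableAt (by simp))]

theorem coeff_deg_zero (α : Fin n →₀ ℕ) (h : α.degree = 0) (X : MvPowerSeries (Fin n) ℝ) :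
    MvPowerSeries.coeff α X = MvPowerSeries.constantCoeff X := by
  rw [Finsupp.degree_eq_zero_iff] at h
  subst h
  exact MvPowerSeries.coeff_zero_eq_constantCoeff_apply _

theorem taylorAt_add (hf : Sm a f) (hg : Sm a g) :
    taylorAt (f + g) a = taylorAt f a + taylorAt g a := by
  apply degree_ind
  intro k
  induction k generalizing f g with
  | zero =>
    intro α h
    simp [coeff_deg_zero α h, constantCoeff_taylorAt, -MvPowerSeries.coeff_zero_eq_constantCoeff]
  | succ k ih =>
    intro α h
    obtain ⟨β, i, rfl, hβ⟩ := exists_succ α k h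
    rw [coeff_succ_eq, coeff_succ_eq, ← taylorAt_pd i (hf.add' hg),
      taylorAt_congr (pd_add i hf hg), ih (hf.pd i) (hg.pd i) β hβ, map_add, taylorAt_pd i hf,
      taylorAt_pd i hg]
    simp

theorem taylorAt_mul (hf : Sm a f) (hg : Sm a g) :
    taylorAt (f * g) a = taylorAt f a * taylorAt g a := by
  apply degree_ind
  intro k
  induction k generalizing f g with
  | zero =>
    intro α h
    simp [coeff_deg_zero α h, constantCoeff_taylorAt, -MvPowerSeries.coeff_zero_eq_constantCoeff]
  | succ k ih =>
    intro α h
    obtain ⟨β, i, rfl, hβ⟩ := exists_succ α k h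
    rw [coeff_succ_eq, coeff_succ_eq, ← taylorAt_pd i (hf.mul' hg),
      taylorAt_congr (pd_mul i hf hg), taylorAt_add (hf.mul' (hg.pd i)) (hg.mul' (hf.pd i)), map_add,
      ih hf (hg.pd i) β hβ, ih hg (hf.pd i) β hβ, taylorAt_pd i hf,
      taylorAt_pd i hg, Derivation.leibniz]
    simp

theorem taylorAt_zero : taylorAt (fun _ : Fin n → ℝ => (0 : ℝ)) a = 0 := by
  have h0 : Sm a (0 : (Fin n → ℝ) → ℝ) := contDiffAt_const
  have := taylorAt_add h0 h0
  simp only [add_zero] at this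
  have h : taylorAt (0 : (Fin n → ℝ) → ℝ) a = 0 := by simpa using this
  exact h

theorem taylorAt_one : taylorAt (fun _ : Fin n → ℝ => (1 : ℝ)) a = 1 := by
  have h0 : Sm a (1 : (Fin n → ℝ) → ℝ) := contDiffAt_const
  have := taylorAt_mul h0 h0
  rw [mul_one] at this
  have hu : IsUnit (taylorAt (1 : (Fin n → ℝ) → ℝ) a) := by
    rw [MvPowerSeries.isUnit_iff_constantCoeff, constantCoeff_taylorAt]
    simp
  have h : taylorAt (1 : (Fin n → ℝ) → ℝ) a = 1 := by
    have h2 := hu.mul_left_cancel (a := taylorAt (1 : (Fin n → ℝ) → ℝ) a) (b := taylorAt (1 : (Fin n → ℝ) → ℝ) a) (c := 1) (by rw [← this, mul_one])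
    exact h2
  exact h

theorem taylorAt_sum {ι : Type*} (s : Finset ι) (F : ι → (Fin n → ℝ) → ℝ) (h : ∀ i ∈ s, Sm a (F i)) :
    taylorAt (fun x => ∑ i ∈ s, F i x) a = ∑ i ∈ s, taylorAt (F i) a := by
  classical
  induction s using Finset.induction_on with
  | empty => simpa using taylorAt_zero
  | insert i s hi ih =>
    simp only [Finset.sum_insert hi]
    rw [← ih (fun j hj => h j (Finset.mem_insert_of_mem hj))]
    exact taylorAt_add (h i (Finset.mem_insert_self _ _))
      (ContDiffAt.sum fun j hj => h j (Finset.mem_insert_of_mem hj))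

theorem pd_translate (i : Fin n) (f : (Fin n → ℝ) → ℝ) (b : Fin n → ℝ) :
    pd i (fun x => f (x + b)) = fun x => pd i f (x + b) := by
  funext x
  simp [pd, fderiv_comp_add_right]

theorem pd_iter_translate (i : Fin n) (k : ℕ) (f : (Fin n → ℝ) → ℝ) (b : Fin n → ℝ) :
    (pd i)^[k] (fun x => f (x + b)) = fun x => (pd i)^[k] f (x + b) := by
  induction k generalizing f with
  | zero => simp
  | succ k ih => simp only [Function.iterate_succ, Function.comp, pd_translate, ih]

theorem taylorAt_translate (f : (Fin n → ℝ) → ℝ) (a b : Fin n → ℝ) :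
    taylorAt (fun x => f (x + b)) a = taylorAt f (a + b) := by
  have : ∀ (l : List (Fin n)) (α : Fin n → ℕ), lpd l α (fun x => f (x + b)) =
      fun x => lpd l α f (x + b) := by
    intro l α
    induction l with
    | nil => rfl
    | cons i l ih =>
      simp only [lpd, List.foldr_cons] at ih ⊢
      rw [ih, pd_iter_translate]
  funext α
  unfold taylorAt
  have h := congrFun (this (Finset.univ : Finset (Fin n)).toList (fun i => α i)) a
  have h' : mpd (fun i => α i) (fun x => f (x + b)) a = mpd (fun i => α i) f (a + b) := h
  rw [h']

theorem taylorAt_neg (hf : Sm a f) : taylorAt (-f) a = - taylorAt f a := by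
  have := taylorAt_add hf hf.neg'
  rw [add_neg_cancel] at this
  have h0 : taylorAt (0 : (Fin n → ℝ) → ℝ) a = 0 := taylorAt_zero
  rw [h0] at this
  exact (neg_eq_of_add_eq_zero_right this.symm).symm

theorem taylorAt_sub (hf : Sm a f) (hg : Sm a g) :
    taylorAt (f - g) a = taylorAt f a - taylorAt g a := by
  rw [sub_eq_add_neg, taylorAt_add hf hg.neg', taylorAt_neg hg, sub_eq_add_neg]

end taylor
end QDC

namespace QDC
open Filter Topology
open scoped ContDiff

/-- germs at 0 of analytic functions -/
def Osub (n : ℕ) : Subring (Germ (𝓝 (0 : Fin n → ℝ)) ℝ) where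
  carrier := {φ | ∃ f : (Fin n → ℝ) → ℝ, AnalyticAt ℝ f 0 ∧ (f : Germ (𝓝 (0 : Fin n → ℝ)) ℝ) = φ}
  zero_mem' := ⟨fun _ => 0, analyticAt_const, rfl⟩
  one_mem' := ⟨fun _ => 1, analyticAt_const, rfl⟩
  add_mem' := by
    rintro _ _ ⟨f, hf, rfl⟩ ⟨g, hg, rfl⟩
    exact ⟨f + g, hf.add hg, rfl⟩
  mul_mem' := by
    rintro _ _ ⟨f, hf, rfl⟩ ⟨g, hg, rfl⟩
    exact ⟨f * g, hf.mul hg, rfl⟩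
  neg_mem' := by
    rintro _ ⟨f, hf, rfl⟩
    exact ⟨-f, hf.neg, rfl⟩

/-- ring of germs -/
abbrev O (n : ℕ) : Type := Osub n

section
variable {n m k : ℕ}

/-- germ of function -/
def O.mk (f : (Fin n → ℝ) → ℝ) (hf : AnalyticAt ℝ f 0) : O n := ⟨f, f, hf, rfl⟩

/-- representative -/
noncomputable def rep (φ : O n) : (Fin n → ℝ) → ℝ := φ.2.choose

theorem rep_an (φ : O n) : AnalyticAt ℝ (rep φ) 0 := φ.2.choose_spec.1

theorem mk_rep (φ : O n) : O.mk (rep φ) (rep_an φ) = φ := Subtype.ext φ.2.choose_spec.2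

theorem O_eq_iff {φ ψ : O n} : φ = ψ ↔ rep φ =ᶠ[𝓝 0] rep ψ := by
  constructor
  · rintro rfl; exact EventuallyEq.rfl
  · intro h
    rw [← mk_rep φ, ← mk_rep ψ]
    exact Subtype.ext (Germ.coe_eq.2 h)

theorem rep_mk (f : (Fin n → ℝ) → ℝ) (hf : AnalyticAt ℝ f 0) : rep (O.mk f hf) =ᶠ[𝓝 0] f := by
  have := mk_rep (O.mk f hf)
  exact Germ.coe_eq.1 (congrArg Subtype.val this)

theorem mk_congr {f g : (Fin n → ℝ) → ℝ} (hf : AnalyticAt ℝ f 0) (hg : AnalyticAt ℝ g 0)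
    (h : f =ᶠ[𝓝 0] g) : O.mk f hf = O.mk g hg := Subtype.ext (Germ.coe_eq.2 h)

theorem rep_add (φ ψ : O n) : rep (φ + ψ) =ᶠ[𝓝 0] rep φ + rep ψ := by
  have h : φ + ψ = O.mk (rep φ + rep ψ) ((rep_an φ).add (rep_an ψ)) := by
    conv_lhs => rw [← mk_rep φ, ← mk_rep ψ]
    rfl
  rw [h]; exact rep_mk _ _

theorem rep_mul (φ ψ : O n) : rep (φ * ψ) =ᶠ[𝓝 0] rep φ * rep ψ := by
  have h : φ * ψ = O.mk (rep φ * rep ψ) ((rep_an φ).mul (rep_an ψ)) := by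
    conv_lhs => rw [← mk_rep φ, ← mk_rep ψ]
    rfl
  rw [h]; exact rep_mk _ _

theorem rep_zero : rep (0 : O n) =ᶠ[𝓝 0] fun _ => 0 := rep_mk (fun _ => 0) analyticAt_const
theorem rep_one : rep (1 : O n) =ᶠ[𝓝 0] fun _ => 1 := rep_mk (fun _ => 1) analyticAt_const

theorem rep_neg (φ : O n) : rep (-φ) =ᶠ[𝓝 0] -rep φ := by
  have h : -φ = O.mk (-rep φ) ((rep_an φ).neg) := by
    conv_lhs => rw [← mk_rep φ]
    rfl
  rw [h]; exact rep_mk _ _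

theorem rep_sum {ι : Type*} (s : Finset ι) (F : ι → O n) :
    rep (∑ i ∈ s, F i) =ᶠ[𝓝 0] fun x => ∑ i ∈ s, rep (F i) x := by
  classical
  induction s using Finset.induction_on with
  | empty => simpa using rep_zero
  | insert i s hi ih =>
    simp only [Finset.sum_insert hi]
    exact (rep_add _ _).trans (EventuallyEq.rfl.add ih)

theorem rep_sub (φ ψ : O n) : rep (φ - ψ) =ᶠ[𝓝 0] rep φ - rep ψ := by
  rw [sub_eq_add_neg, sub_eq_add_neg]
  exact (rep_add _ _).trans (EventuallyEq.rfl.add (rep_neg ψ))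

theorem an_comp_lin (A : (Fin m → ℝ) →L[ℝ] (Fin k → ℝ)) {f : (Fin k → ℝ) → ℝ} (hf : AnalyticAt ℝ f 0) :
    AnalyticAt ℝ (f ∘ A) 0 := hf.comp_of_eq (A.analyticAt 0) (by simp)

/-- pullback by a linear map -/
noncomputable def pull (A : (Fin m → ℝ) →L[ℝ] (Fin k → ℝ)) : O k →+* O m where
  toFun φ := O.mk (rep φ ∘ A) (an_comp_lin A (rep_an φ))
  map_zero' := by
    rw [O_eq_iff]
    refine (rep_mk _ _).trans (EventuallyEq.trans ?_ rep_zero.symm)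
    have : Tendsto A (𝓝 0) (𝓝 0) := by simpa using A.continuous.tendsto 0
    exact this.eventually rep_zero
  map_one' := by
    rw [O_eq_iff]
    refine (rep_mk _ _).trans (EventuallyEq.trans ?_ rep_one.symm)
    have : Tendsto A (𝓝 0) (𝓝 0) := by simpa using A.continuous.tendsto 0
    exact this.eventually rep_one
  map_add' φ ψ := by
    rw [O_eq_iff]
    refine (rep_mk _ _).trans (EventuallyEq.trans ?_ (rep_add _ _).symm)
    have : Tendsto A (𝓝 0) (𝓝 0) := by simpa using A.continuous.tendsto 0
    filter_upwards [this.eventually (rep_add φ ψ), rep_mk (rep φ ∘ A) (an_comp_lin A (rep_an φ)),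
      rep_mk (rep ψ ∘ A) (an_comp_lin A (rep_an ψ))] with x h1 h2 h3
    simp [h1, h2, h3]
  map_mul' φ ψ := by
    rw [O_eq_iff]
    refine (rep_mk _ _).trans (EventuallyEq.trans ?_ (rep_mul _ _).symm)
    have : Tendsto A (𝓝 0) (𝓝 0) := by simpa using A.continuous.tendsto 0
    filter_upwards [this.eventually (rep_mul φ ψ), rep_mk (rep φ ∘ A) (an_comp_lin A (rep_an φ)),
      rep_mk (rep ψ ∘ A) (an_comp_lin A (rep_an ψ))] with x h1 h2 h3
    simp [h1, h2, h3]

theorem rep_pull (A : (Fin m → ℝ) →L[ℝ] (Fin k → ℝ)) (φ : O k) :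
    rep (pull A φ) =ᶠ[𝓝 0] rep φ ∘ A := rep_mk _ (an_comp_lin A (rep_an φ))

theorem tendsto_lin (A : (Fin m → ℝ) →L[ℝ] (Fin k → ℝ)) : Tendsto A (𝓝 0) (𝓝 0) := by
  simpa using A.continuous.tendsto 0

theorem pull_mk (A : (Fin m → ℝ) →L[ℝ] (Fin k → ℝ)) (f : (Fin k → ℝ) → ℝ) (hf : AnalyticAt ℝ f 0)
    (h : AnalyticAt ℝ (f ∘ A) 0) : pull A (O.mk f hf) = O.mk (f ∘ A) h :=
  mk_congr (an_comp_lin A (rep_an _)) _ ((tendsto_lin A).eventually (rep_mk f hf))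

theorem pull_pull {l : ℕ} (A : (Fin m → ℝ) →L[ℝ] (Fin k → ℝ)) (B : (Fin l → ℝ) →L[ℝ] (Fin m → ℝ)) (φ : O k) :
    pull B (pull A φ) = pull (A.comp B) φ :=
  mk_congr (an_comp_lin B (rep_an _)) (an_comp_lin (A.comp B) (rep_an _)) ((tendsto_lin B).eventually (rep_pull A φ))

theorem pull_id (φ : O k) : pull (ContinuousLinearMap.id ℝ _) φ = φ := by
  conv_rhs => rw [← mk_rep φ]
  exact mk_congr (an_comp_lin _ (rep_an _)) _ EventuallyEq.rfl

/-- linear coordinate change -/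
noncomputable def pullE (A : (Fin m → ℝ) ≃L[ℝ] (Fin m → ℝ)) : O m ≃+* O m :=
  RingEquiv.ofRingHom (pull (A : (Fin m → ℝ) →L[ℝ] (Fin m → ℝ))) (pull (A.symm : (Fin m → ℝ) →L[ℝ] (Fin m → ℝ)))
    (by ext1 φ; simp only [RingHom.comp_apply, pull_pull, RingHom.id_apply]
        rw [ContinuousLinearEquiv.coe_symm_comp_coe]; exact pull_id φ)
    (by ext1 φ; simp only [RingHom.comp_apply, pull_pull, RingHom.id_apply]
        rw [ContinuousLinearEquiv.coe_comp_coe_symm]; exact pull_id φ)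

theorem pullE_apply (A : (Fin m → ℝ) ≃L[ℝ] (Fin m → ℝ)) (φ : O m) :
    pullE A φ = pull (A : (Fin m → ℝ) →L[ℝ] (Fin m → ℝ)) φ := rfl

/-- directional derivative -/
noncomputable def DD (e : Fin n → ℝ) (φ : O n) : O n :=
  O.mk (fun x => fderiv ℝ (rep φ) x e) (((ContinuousLinearMap.apply ℝ ℝ e).analyticAt _).comp (rep_an φ).fderiv)

theorem rep_DD (e : Fin n → ℝ) (φ : O n) : rep (DD e φ) =ᶠ[𝓝 0] fun x => fderiv ℝ (rep φ) x e :=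
  rep_mk _ _

theorem rep_diff (φ : O n) : ∀ᶠ x in 𝓝 0, DifferentiableAt ℝ (rep φ) x := by
  filter_upwards [(rep_an φ).eventually_analyticAt] with x hx using hx.differentiableAt

theorem DD_add (e : Fin n → ℝ) (φ ψ : O n) : DD e (φ + ψ) = DD e φ + DD e ψ := by
  rw [O_eq_iff]
  filter_upwards [rep_DD e (φ + ψ), rep_add (DD e φ) (DD e ψ), rep_DD e φ, rep_DD e ψ,
    (rep_add φ ψ).fderiv (𝕜 := ℝ), rep_diff φ, rep_diff ψ] with x h1 h2 h3 h4 h5 h6 h7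
  rw [h1, h2, Pi.add_apply, h3, h4, h5, fderiv_add h6 h7]
  rfl

theorem DD_mul (e : Fin n → ℝ) (φ ψ : O n) : DD e (φ * ψ) = φ * DD e ψ + ψ * DD e φ := by
  rw [O_eq_iff]
  filter_upwards [rep_DD e (φ * ψ), rep_add (φ * DD e ψ) (ψ * DD e φ), rep_mul φ (DD e ψ),
    rep_mul ψ (DD e φ), rep_DD e φ, rep_DD e ψ,
    (rep_mul φ ψ).fderiv (𝕜 := ℝ), rep_diff φ, rep_diff ψ] with x h1 h2 h8 h9 h3 h4 h5 h6 h7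
  rw [h1, h2, Pi.add_apply, h8, h9, Pi.mul_apply, Pi.mul_apply, h3, h4, h5, fderiv_mul h6 h7]
  simp

theorem DD_mk (e : Fin n → ℝ) (f : (Fin n → ℝ) → ℝ) (hf : AnalyticAt ℝ f 0) :
    rep (DD e (O.mk f hf)) =ᶠ[𝓝 0] fun x => fderiv ℝ f x e := by
  filter_upwards [rep_DD e (O.mk f hf), (rep_mk f hf).fderiv (𝕜 := ℝ)] with x h1 h2
  rw [h1, h2]

theorem DD_pull (A : (Fin m → ℝ) →L[ℝ] (Fin k → ℝ)) (e : Fin m → ℝ) (φ : O k) :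
    DD e (pull A φ) = pull A (DD (A e) φ) := by
  rw [O_eq_iff]
  filter_upwards [rep_DD e (pull A φ), (rep_pull A φ).fderiv (𝕜 := ℝ), rep_pull A (DD (A e) φ),
    (tendsto_lin A).eventually (rep_DD (A e) φ), (tendsto_lin A).eventually (rep_diff φ)]
    with x h1 h2 h3 h4 h5
  rw [h1, h2, h3, Function.comp_apply, h4, fderiv_comp _ h5 A.differentiableAt]
  simp

theorem DD_zero_dir (φ : O n) : DD 0 φ = 0 := by
  rw [O_eq_iff]
  filter_upwards [rep_DD 0 φ, rep_zero (n := n)] with x h1 h2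
  rw [h1, h2]; simp

theorem DD_zero (e : Fin n → ℝ) : DD e 0 = 0 := by
  have := DD_add e 0 0
  simpa using this

theorem DD_one (e : Fin n → ℝ) : DD e 1 = 0 := by
  have := DD_mul e 1 1
  simpa using this

/-- evaluation at 0 -/
theorem isUnit_of_ne (φ : O n) (h : rep φ 0 ≠ 0) : IsUnit φ := by
  refine IsUnit.of_mul_eq_one (O.mk (fun x => (rep φ x)⁻¹) ((rep_an φ).inv h)) ?_
  rw [O_eq_iff]
  filter_upwards [rep_mul φ (O.mk (fun x => (rep φ x)⁻¹) ((rep_an φ).inv h)),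
    rep_mk (fun x => (rep φ x)⁻¹) ((rep_an φ).inv h), rep_one (n := n),
    (rep_an φ).continuousAt.eventually_ne h] with x h1 h2 h3 h4
  rw [h1, h3, Pi.mul_apply, h2, mul_inv_cancel₀ h4]

/-- constants -/
noncomputable def cst (n : ℕ) (c : ℝ) : O n := O.mk (fun _ => c) analyticAt_const

theorem rep_natCast (k : ℕ) : rep (k : O n) =ᶠ[𝓝 0] fun _ => (k : ℝ) :=
  rep_mk (fun _ => (k : ℝ)) analyticAt_const

theorem isUnit_natCast (k : ℕ) (hk : k ≠ 0) : IsUnit (k : O n) := by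
  apply isUnit_of_ne
  rw [(rep_natCast k).eq_of_nhds]
  exact_mod_cast hk

/-- Taylor series of germs near 0 -/
theorem rep_smooth (φ : O n) : ∀ᶠ a in 𝓝 0, Sm a (rep φ) := by
  filter_upwards [(rep_an φ).eventually_analyticAt] with x hx using hx.contDiffAt

/-- abbreviation -/
noncomputable abbrev TT (a : Fin n → ℝ) (φ : O n) : MvPowerSeries (Fin n) ℝ := taylorAt (rep φ) a

theorem TT_congr {f g : (Fin n → ℝ) → ℝ} (h : f =ᶠ[𝓝 0] g) :
    ∀ᶠ a in 𝓝 0, taylorAt f a = taylorAt g a := by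
  filter_upwards [h.eventuallyEq_nhds] with a ha using taylorAt_congr ha

theorem TT_add (φ ψ : O n) : ∀ᶠ a in 𝓝 0, TT a (φ + ψ) = TT a φ + TT a ψ := by
  filter_upwards [TT_congr (rep_add φ ψ), rep_smooth φ, rep_smooth ψ] with a h1 h2 h3
  rw [TT, h1, taylorAt_add h2 h3]

theorem TT_mul (φ ψ : O n) : ∀ᶠ a in 𝓝 0, TT a (φ * ψ) = TT a φ * TT a ψ := by
  filter_upwards [TT_congr (rep_mul φ ψ), rep_smooth φ, rep_smooth ψ] with a h1 h2 h3
  rw [TT, h1, taylorAt_mul h2 h3]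

theorem TT_neg (φ : O n) : ∀ᶠ a in 𝓝 0, TT a (-φ) = -TT a φ := by
  filter_upwards [TT_congr (rep_neg φ), rep_smooth φ] with a h1 h2
  rw [TT, h1, taylorAt_neg h2]

theorem TT_zero : ∀ᶠ a in 𝓝 0, TT a (0 : O n) = 0 := by
  filter_upwards [TT_congr (rep_zero (n := n))] with a h1
  rw [TT, h1, taylorAt_zero]

theorem TT_one : ∀ᶠ a in 𝓝 0, TT a (1 : O n) = 1 := by
  filter_upwards [TT_congr (rep_one (n := n))] with a h1
  rw [TT, h1, taylorAt_one]

theorem TT_sum {ι : Type*} (s : Finset ι) (F : ι → O n) :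
    ∀ᶠ a in 𝓝 0, TT a (∑ i ∈ s, F i) = ∑ i ∈ s, TT a (F i) := by
  classical
  induction s using Finset.induction_on with
  | empty => simpa using TT_zero
  | insert i s hi ih =>
    simp only [Finset.sum_insert hi]
    filter_upwards [TT_add (F i) (∑ i ∈ s, F i), ih] with a h1 h2
    rw [h1, h2]

theorem TT_DD (e : Fin n → ℝ) (φ : O n) :
    ∀ᶠ a in 𝓝 0, TT a (DD e φ) = ∑ i, MvPowerSeries.C (e i) * MvPowerSeries.pderiv ℝ i (TT a φ) := by
  have hC : ∀ (c : ℝ) (a : Fin n → ℝ), taylorAt (fun _ => c) a = MvPowerSeries.C c := by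
    intro c a
    apply degree_ind
    intro k α hα
    rcases k with _ | k
    · rw [coeff_deg_zero α hα, coeff_deg_zero α hα, constantCoeff_taylorAt]; simp
    · obtain ⟨β, i, rfl, hβ⟩ := exists_succ α k hα
      rw [coeff_succ_eq, coeff_succ_eq, ← taylorAt_pd i (contDiffAt_const)]
      have : pd i (fun _ : Fin n → ℝ => c) = fun _ => 0 := by funext x; simp [pd]
      rw [this, taylorAt_zero]; simp
  filter_upwards [TT_congr (rep_DD e φ), rep_smooth φ] with a h1 h2
  have h3 : (fun x => fderiv ℝ (rep φ) x e) = fun x => ∑ i, ((fun _ => e i) * pd i (rep φ) : (Fin n → ℝ) → ℝ) x := by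
    funext x
    conv_lhs => rw [pi_eq_sum_univ' e]
    simp only [map_sum, map_smul, Pi.mul_apply, pd, smul_eq_mul]
  rw [TT, h1, h3, taylorAt_sum _ _ (fun i _ => (Sm.mul' contDiffAt_const (h2.pd i)))]
  refine Finset.sum_congr rfl fun i _ => ?_
  rw [taylorAt_mul contDiffAt_const (h2.pd i), hC, taylorAt_pd i h2]

end
end QDC

namespace QDC
open Filter Topology
open scoped ContDiff
set_option linter.all false

section ext
variable {n : ℕ} {A : Type*} [NormedRing A] [NormedAlgebra ℝ A] [NormOneClass A]

/-- extension of a power series to a Banach algebra -/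
noncomputable def extS (A : Type*) [NormedRing A] [NormedAlgebra ℝ A]
    (p : FormalMultilinearSeries ℝ (Fin n → ℝ) ℝ) :
    FormalMultilinearSeries ℝ (Fin n → A) A := fun k =>
  ∑ i : Fin k → Fin n, (p k fun j => Pi.single (i j) 1) •
    (ContinuousMultilinearMap.mkPiAlgebraFin ℝ k A).compContinuousLinearMap
      (fun j => ContinuousLinearMap.proj (R := ℝ) (φ := fun _ : Fin n => A) (i j))

theorem extS_apply (p : FormalMultilinearSeries ℝ (Fin n → ℝ) ℝ) (k : ℕ) (w : Fin n → A) :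
    extS A p k (fun _ => w) = ∑ i : Fin k → Fin n, (p k fun j => Pi.single (i j) 1) •
      (List.ofFn fun j => w (i j)).prod := by
  simp [extS]

theorem norm_extS_le (p : FormalMultilinearSeries ℝ (Fin n → ℝ) ℝ) (k : ℕ) :
    ‖extS A p k‖ ≤ n ^ k * ‖p k‖ := by
  refine ContinuousMultilinearMap.opNorm_le_bound (by positivity) fun w => ?_
  have e : extS A p k w = ∑ i : Fin k → Fin n, (p k fun j => Pi.single (i j) 1) •
      (List.ofFn fun j => w j (i j)).prod := by
    simp [extS]
  rw [e]
  have h : ∀ i : Fin k → Fin n, ‖(p k fun j => Pi.single (i j) 1) •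
      (List.ofFn fun j => w j (i j)).prod‖ ≤ ‖p k‖ * ∏ j, ‖w j‖ := by
    intro i
    rw [norm_smul]
    have h1 : ‖(p k fun j => Pi.single (i j) 1)‖ ≤ ‖p k‖ := by
      refine ((p k).le_opNorm _).trans ?_
      have : ∏ j, ‖(Pi.single (i j) 1 : Fin n → ℝ)‖ ≤ 1 := by
        refine Finset.prod_le_one (fun _ _ => norm_nonneg _) fun j _ => ?_
        simp [Pi.norm_single]
      nlinarith [norm_nonneg (p k)]
    have h2 : ‖(List.ofFn fun j => w j (i j)).prod‖ ≤ ∏ j, ‖w j‖ := by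
      refine (List.norm_prod_le _).trans ?_
      rw [List.map_ofFn, List.prod_ofFn]
      exact Finset.prod_le_prod (fun _ _ => norm_nonneg _) fun j _ => norm_le_pi_norm (w j) (i j)
    exact mul_le_mul h1 h2 (norm_nonneg _) (norm_nonneg _)
  refine (norm_sum_le_of_le _ (fun i _ => h i)).trans ?_
  simp [mul_assoc]

theorem extS_radius (p : FormalMultilinearSeries ℝ (Fin n → ℝ) ℝ) (hp : 0 < p.radius) :
    0 < (extS A p).radius := by
  obtain ⟨C, r, hC, hr, h⟩ := p.le_mul_pow_of_radius_pos hp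
  have hn : 0 < (n : ℝ) + 1 := by positivity
  let R : NNReal := ⟨1 / ((n + 1) * r), by positivity⟩
  have : (R : ENNReal) ≤ (extS A p).radius := by
    refine FormalMultilinearSeries.le_radius_of_bound _ C fun k => ?_
    have h1 := norm_extS_le (A := A) p k
    have h2 : (n : ℝ) ^ k * ‖p k‖ ≤ (n + 1) ^ k * (C * r ^ k) := by
      gcongr
      · linarith
      · exact h k
    calc ‖extS A p k‖ * (R : ℝ) ^ k = ‖extS A p k‖ * (1 / ((n + 1) * r)) ^ k := rfl
      _ ≤ ((n + 1) ^ k * (C * r ^ k)) * (1 / ((n + 1) * r)) ^ k := by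
          gcongr; exact h1.trans h2
      _ = C := by rw [div_pow, mul_pow]; field_simp; simp
  refine lt_of_lt_of_le ?_ this
  rw [ENNReal.coe_pos]
  exact (show (0:ℝ) < 1 / ((n + 1) * r) by positivity)

end ext

section ev
variable {n : ℕ} {X : Type*} [NormedAddCommGroup X] [NormedSpace ℝ X] [Nontrivial X] [CompleteSpace X]

theorem ev_extS (p : FormalMultilinearSeries ℝ (Fin n → ℝ) ℝ) {f : (Fin n → ℝ) → ℝ}
    {r : ENNReal} (hf : HasFPowerSeriesOnBall f p 0 r)
    (a : Fin n → ℝ) (ha : a ∈ Metric.eball 0 r) (w : Fin n → (X →L[ℝ] X))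
    (hw : w ∈ Metric.eball 0 (extS (X →L[ℝ] X) p).radius)
    (hr : 0 < (extS (X →L[ℝ] X) p).radius)
    (ev : X →L[ℝ] ℝ) (hev : ∀ i b, ev (w i b) = a i * ev b) (b : X) :
    ev ((extS (X →L[ℝ] X) p).sum w b) = f a * ev b := by
  have h1 : HasSum (fun k => extS (X →L[ℝ] X) p k fun _ => w) ((extS (X →L[ℝ] X) p).sum w) :=
    FormalMultilinearSeries.hasSum _ hw
  have h2 := ((ev.comp (ContinuousLinearMap.apply ℝ X b)).hasSum h1)
  have h3 := (hf.hasSum ha).mul_right (ev b)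
  rw [zero_add] at h3
  refine h2.unique ?_
  have hfun : ∀ k, (ev.comp (ContinuousLinearMap.apply ℝ X b)) (extS (X →L[ℝ] X) p k fun _ => w) =
      p k (fun _ => a) * ev b := ?_
  · simp only [hfun]; exact h3
  intro k
  rw [extS_apply]
  simp only [ContinuousLinearMap.comp_apply, ContinuousLinearMap.apply_apply,
    ContinuousLinearMap.sum_apply, map_sum, ContinuousLinearMap.smul_apply, map_smul, smul_eq_mul]
  have key : ∀ l : List (Fin n), ev ((l.map w).prod b) = (l.map a).prod * ev b := by
    intro l
    induction l with
    | nil => simp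
    | cons i l ih => simp [hev, ih, mul_assoc]
  have key2 : ∀ i : Fin k → Fin n, ev ((List.ofFn fun j => w (i j)).prod b) =
      (∏ j, a (i j)) * ev b := by
    intro i
    have := key (List.ofFn i)
    simp only [List.map_ofFn] at this
    rw [← List.prod_ofFn]
    exact this
  simp only [key2]
  have h4 : p k (fun _ => a) = ∑ i : Fin k → Fin n, (∏ j, a (i j)) * p k (fun j => Pi.single (i j) 1) := by
    have : (fun _ : Fin k => a) = fun _ : Fin k => ∑ i : Fin n, a i • (Pi.single i 1 : Fin n → ℝ) := by
      funext j
      exact pi_eq_sum_univ' a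
    rw [this, ContinuousMultilinearMap.map_sum]
    refine Finset.sum_congr rfl fun i _ => ?_
    rw [ContinuousMultilinearMap.map_smul_univ]; rfl
  rw [h4, Finset.sum_mul]
  refine Finset.sum_congr rfl fun i _ => ?_
  ring

end ev

/-- bounded sequences -/
abbrev BX := BoundedContinuousFunction ℕ ℝ

/-- right shift -/
noncomputable def BXS : BX →L[ℝ] BX := LinearMap.mkContinuous
    { toFun := fun a => BoundedContinuousFunction.ofNormedAddCommGroup
        (fun k => Nat.casesOn k 0 (fun j => a j)) continuous_of_discreteTopology ‖a‖ (by
          intro k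
          cases k with
          | zero => simpa using norm_nonneg a
          | succ j => exact a.norm_coe_le_norm j)
      map_add' := by intro a b; ext k; cases k <;> simp
      map_smul' := by intro a b; ext k; cases k <;> simp } 1 (by
        intro a
        rw [one_mul]
        refine BoundedContinuousFunction.norm_ofNormedAddCommGroup_le _ (norm_nonneg _) ?_
        intro k
        cases k with
        | zero => simpa using norm_nonneg a
        | succ j => exact a.norm_coe_le_norm j)

/-- left shift -/
noncomputable def BXB : BX →L[ℝ] BX := LinearMap.mkContinuous
    { toFun := fun a => BoundedContinuousFunction.ofNormedAddCommGroup
        (fun k => a (k + 1)) continuous_of_discreteTopology ‖a‖ (fun k => a.norm_coe_le_norm _)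
      map_add' := by intro a b; ext k; simp
      map_smul' := by intro a b; ext k; simp } 1 (by
        intro a
        rw [one_mul]
        exact BoundedContinuousFunction.norm_ofNormedAddCommGroup_le _ (norm_nonneg _)
          (fun k => a.norm_coe_le_norm _))

/-- unit vector -/
noncomputable def BXe : BX := BoundedContinuousFunction.ofNormedAddCommGroup
    (fun k => if k = 0 then (1 : ℝ) else 0) continuous_of_discreteTopology 1 (by
      intro k; split_ifs <;> simp)

/-- zeroth coordinate -/
noncomputable def BXp : BX →L[ℝ] ℝ := BoundedContinuousFunction.evalCLM ℝ 0

/-- bounded sequences with shifts -/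
theorem exists_shift_space : 
    (∀ x, BXB (BXS x) = x) ∧ BXB BXe = 0 ∧ (∀ x, BXp (BXS x) = 0) ∧ BXp BXe = 1 ∧ ‖BXS‖ ≤ 1 ∧ ‖BXB‖ ≤ 1 := by
  refine ⟨?_, ?_, ?_, ?_, ?_, ?_⟩
  · intro x; ext k; simp [BXB, BXS]
  · ext k; simp [BXB, BXe]
  · intro x; simp [BXp, BXS]
  · simp [BXp, BXe]
  · exact LinearMap.mkContinuous_norm_le _ zero_le_one _
  · exact LinearMap.mkContinuous_norm_le _ zero_le_one _

section shift
variable {X : Type} [NormedAddCommGroup X] [NormedSpace ℝ X] [CompleteSpace X]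
  {S B : X →L[ℝ] X} {e0 : X} {π : X →L[ℝ] ℝ}

/-- evaluation functional -/
noncomputable def evs (B : X →L[ℝ] X) (π : X →L[ℝ] ℝ) (s : ℝ) : X →L[ℝ] ℝ :=
  π.comp (Ring.inverse (1 - s • B))

theorem isUnit_evs (hB : ‖B‖ ≤ 1) {s : ℝ} (hs : |s| < 1) : IsUnit (1 - s • B) := by
  have : ‖s • B‖ < 1 := by
    rw [norm_smul, Real.norm_eq_abs]
    nlinarith [abs_nonneg s, norm_nonneg B]
  exact (Units.oneSub (s • B) this).isUnit

theorem inv_right (hB : ‖B‖ ≤ 1) {s : ℝ} (hs : |s| < 1) (x : X) :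
    Ring.inverse (1 - s • B) x - s • B (Ring.inverse (1 - s • B) x) = x := by
  have := Ring.mul_inverse_cancel _ (isUnit_evs hB hs)
  have := congrArg (fun T : X →L[ℝ] X => T x) this
  simpa using this

theorem inv_left (hB : ‖B‖ ≤ 1) {s : ℝ} (hs : |s| < 1) (x : X) :
    Ring.inverse (1 - s • B) (x - s • B x) = x := by
  have := Ring.inverse_mul_cancel _ (isUnit_evs hB hs)
  have := congrArg (fun T : X →L[ℝ] X => T x) this
  simpa using this

theorem evs_S (hB : ‖B‖ ≤ 1) (hBS : ∀ x, B (S x) = x) (hπ : ∀ x, π (S x) = 0) {s : ℝ} (hs : |s| < 1) (x : X) :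
    evs B π s (S x) = s * evs B π s x := by
  have h := inv_left hB hs (S x)
  rw [hBS, map_sub, map_smul] at h
  have h2 := congrArg π h
  rw [map_sub, map_smul, hπ, smul_eq_mul] at h2
  simp only [evs, ContinuousLinearMap.comp_apply]
  linarith

theorem evs_e0 (hB : ‖B‖ ≤ 1) (he : B e0 = 0) (hπ : π e0 = 1) {s : ℝ} (hs : |s| < 1) :
    evs B π s e0 = 1 := by
  have h := inv_left hB hs e0
  rw [he, smul_zero, sub_zero] at h
  simp [evs, h, hπ]

theorem evs_poly (hB : ‖B‖ ≤ 1) {s : ℝ} (hs : |s| < 1) (d : ℕ) (b : X) :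
    evs B π s b = ∑ k ∈ Finset.range d, s ^ k * π ((B ^ k) b) + s ^ d * evs B π s ((B ^ d) b) := by
  induction d with
  | zero => simp
  | succ d ih =>
    rw [ih, Finset.sum_range_succ, add_assoc]
    congr 1
    have h := inv_left hB hs ((B ^ d) b)
    rw [map_sub, map_smul] at h
    have h2 := congrArg π h
    rw [map_sub, map_smul, smul_eq_mul] at h2
    have h3 : (B ^ (d + 1)) b = B ((B ^ d) b) := by rw [pow_succ']; rfl
    simp only [evs, ContinuousLinearMap.comp_apply, h3]
    rw [← h2]; ring

theorem evs_analytic (hB : ‖B‖ ≤ 1) {s : ℝ} (hs : |s| < 1) : AnalyticAt ℝ (evs B π) s := by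
  have h1 : AnalyticAt ℝ (fun s : ℝ => 1 - s • B) s :=
    analyticAt_const.sub (analyticAt_id.smul analyticAt_const)
  obtain ⟨u, hu⟩ := isUnit_evs hB hs
  have h2 : AnalyticAt ℝ (fun s : ℝ => Ring.inverse (1 - s • B)) s :=
    (analyticAt_inverse (𝕜 := ℝ) u).comp_of_eq h1 hu.symm
  exact ((ContinuousLinearMap.compL ℝ X X ℝ π).analyticAt _).comp h2

end shift
end QDC

namespace QDC
open Filter Topology
open scoped ContDiff
set_option linter.all false

section
variable {X : Type} [NormedAddCommGroup X] [NormedSpace ℝ X] [CompleteSpace X] [Nontrivial X]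

/-- argument of the operator extension -/
noncomputable def wv {m : ℕ} (BXS : X →L[ℝ] X) (ρ : ℝ) (x : Fin m → ℝ) : Fin (m + 1) → (X →L[ℝ] X) :=
  Fin.snoc (α := fun _ => (X →L[ℝ] X)) (fun j => x j • (1 : X →L[ℝ] X)) (ρ • BXS)

theorem wv_an (BXS : X →L[ℝ] X) {m : ℕ} (ρ : ℝ) (x : Fin m → ℝ) : AnalyticAt ℝ (wv BXS ρ) x := by
  rw [analyticAt_pi_iff]
  intro i
  refine Fin.lastCases ?_ (fun j => ?_) i
  · have : (fun x : Fin m → ℝ => wv BXS ρ x (Fin.last m)) = fun _ => ρ • BXS := by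
      funext x; simp [wv]
    rw [this]; exact analyticAt_const
  · have : (fun x : Fin m → ℝ => wv BXS ρ x j.castSucc) = fun x => x j • (1 : X →L[ℝ] X) := by
      funext x; simp [wv]
    rw [this]
    exact ((ContinuousLinearMap.proj (R := ℝ) (φ := fun _ : Fin m => ℝ) j).analyticAt x).smul analyticAt_const

theorem norm_wv_zero (BXS : X →L[ℝ] X) (hS : ‖BXS‖ ≤ 1) {m : ℕ} (ρ : ℝ) : ‖wv (m := m) BXS ρ 0‖ ≤ |ρ| := by
  rw [pi_norm_le_iff_of_nonneg (abs_nonneg ρ)]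
  intro i
  refine Fin.lastCases ?_ (fun j => ?_) i
  · simp only [wv, Fin.snoc_last, norm_smul, Real.norm_eq_abs]
    nlinarith [abs_nonneg ρ]
  · simp [wv]

theorem BXB_pow_S {BXS BXB : X →L[ℝ] X} (hBS : ∀ x, BXB (BXS x) = x) (d k : ℕ) (x : X) (h : d ≤ k) : (BXB ^ d) ((BXS ^ k) x) = (BXS ^ (k - d)) x := by
  induction d generalizing k with
  | zero => simp
  | succ d ih =>
    obtain ⟨j, rfl⟩ : ∃ j, k = j + 1 := ⟨k - 1, by omega⟩
    rw [pow_succ BXB, pow_succ' BXS]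
    simp only [ContinuousLinearMap.mul_apply]
    rw [hBS, ih j (by omega)]
    congr 2; omega

theorem norm_pow_le_one {T : X →L[ℝ] X} (h : ‖T‖ ≤ 1) (k : ℕ) : ‖T ^ k‖ ≤ 1 :=
  (norm_pow_le T k).trans (pow_le_one₀ (norm_nonneg _) h)

theorem extS_wv_zero (BXS : X →L[ℝ] X) {m : ℕ} (p : FormalMultilinearSeries ℝ (Fin (m + 1) → ℝ) ℝ) (ρ : ℝ) (k : ℕ) :
    extS (X →L[ℝ] X) p k (fun _ => wv BXS ρ 0) =
      ((p k fun _ => Pi.single (Fin.last m) 1) * ρ ^ k) • BXS ^ k := by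
  rw [extS_apply, Finset.sum_eq_single (fun _ => Fin.last m)]
  · simp only [wv, Fin.snoc_last, List.ofFn_const, List.prod_replicate]
    rw [smul_pow, smul_smul]
  · intro i _ hi
    obtain ⟨j, hj⟩ := Function.ne_iff.1 hi
    have h0 : (List.ofFn fun j => wv (m := m) BXS ρ 0 (i j)).prod = 0 := by
      apply List.prod_eq_zero
      rw [List.mem_ofFn]
      refine ⟨j, ?_⟩
      obtain ⟨l, hl⟩ := Fin.exists_castSucc_eq.2 hj
      simp [← hl, wv]
    rw [h0, smul_zero]
  · simp

theorem tail_bound {C r ρ : ℝ} (hC : 0 < C) (hr : 0 < r) (hρ : 0 < ρ) (h : r * ρ ≤ 1 / 2) (d : ℕ)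
    (u : ℕ → (X →L[ℝ] X)) (L : X →L[ℝ] X) (hu : HasSum u L) (h0 : ∀ k < d, u k = 0)
    (hk : ∀ k, ‖u k‖ ≤ C * (r * ρ) ^ k) : ‖L - u d‖ ≤ 2 * C * (r * ρ) ^ (d + 1) := by
  have h1 : HasSum (fun k => u (k + (d + 1))) (L - u d) := by
    rw [hasSum_nat_add_iff (d + 1)]
    rw [Finset.sum_range_succ, Finset.sum_eq_zero (fun k hk => h0 k (Finset.mem_range.1 hk))]
    simpa using hu
  rw [← h1.tsum_eq]
  have hg : HasSum (fun k : ℕ => C * (r * ρ) ^ (d + 1) * (r * ρ) ^ k) (C * (r * ρ) ^ (d + 1) * (1 - r * ρ)⁻¹) :=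
    (hasSum_geometric_of_lt_one (by positivity) (by linarith)).mul_left _
  refine (tsum_of_norm_bounded hg fun k => ?_).trans ?_
  · refine (hk _).trans (le_of_eq ?_)
    rw [pow_add]; ring
  · have : (1 - r * ρ)⁻¹ ≤ 2 := by
      rw [inv_le_comm₀ (by linarith) (by norm_num)]; linarith
    have h3 : 0 ≤ C * (r * ρ) ^ (d + 1) := by positivity
    nlinarith

set_option maxHeartbeats 1000000 in
/-- **Weierstrass division** (existence). -/
theorem weierstrass_division_aux (BXS BXB : X →L[ℝ] X) (BXe : X) (BXp : X →L[ℝ] ℝ) (hBS : ∀ x, BXB (BXS x) = x) (hBe : BXB BXe = 0) (hpS : ∀ x, BXp (BXS x) = 0) (hpe : BXp BXe = 1)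
    (hS : ‖BXS‖ ≤ 1) (hB : ‖BXB‖ ≤ 1) {m : ℕ} {f g : (Fin (m + 1) → ℝ) → ℝ}
    {p : FormalMultilinearSeries ℝ (Fin (m + 1) → ℝ) ℝ} (hf : HasFPowerSeriesAt f p 0)
    (hg : AnalyticAt ℝ g 0) (d : ℕ) (hlt : ∀ k < d, (p k fun _ => Pi.single (Fin.last m) 1) = 0)
    (hd : (p d fun _ => Pi.single (Fin.last m) 1) ≠ 0) :
    ∃ (q : (Fin (m + 1) → ℝ) → ℝ) (r : ℕ → (Fin m → ℝ) → ℝ), AnalyticAt ℝ q 0 ∧ (∀ k, AnalyticAt ℝ (r k) 0) ∧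
      ∀ᶠ x in 𝓝 0, g x = q x * f x + ∑ k ∈ Finset.range d, r k (fun j => x j.castSucc) * x (Fin.last m) ^ k := by
  obtain ⟨pg, hpg⟩ := hg
  obtain ⟨Rf, hRf⟩ := hf
  obtain ⟨Rg, hRg⟩ := hpg
  have radf : 0 < (extS (X →L[ℝ] X) p).radius := extS_radius p (hRf.r_pos.trans_le hRf.r_le)
  have radg : 0 < (extS (X →L[ℝ] X) pg).radius := extS_radius pg (hRg.r_pos.trans_le hRg.r_le)
  obtain ⟨C, r, hC, hr, hCr⟩ := p.le_mul_pow_of_radius_pos (hRf.r_pos.trans_le hRf.r_le)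
  set c := fun k => p k fun _ => Pi.single (Fin.last m) 1 with hc
  have hcb : ∀ k, |c k| ≤ C * r ^ k := by
    intro k
    refine le_trans ?_ (hCr k)
    have := (p k).le_opNorm (fun _ => (Pi.single (Fin.last m) 1 : Fin (m + 1) → ℝ))
    simpa [Pi.norm_single] using this
  -- choose ρ
  obtain ⟨ρ, hρ, hρ1, hρ2, hρf, hρg⟩ : ∃ ρ : ℝ, 0 < ρ ∧ r * ρ ≤ 1 / 2 ∧ 2 * C * r ^ (d + 1) * ρ < |c d| ∧
      ENNReal.ofReal ρ < (extS (X →L[ℝ] X) p).radius ∧ ENNReal.ofReal ρ < (extS (X →L[ℝ] X) pg).radius := by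
    have e1 : ∀ᶠ ρ in 𝓝 (0 : ℝ), r * ρ < 1 / 2 := by
      have : Tendsto (fun ρ : ℝ => r * ρ) (𝓝 0) (𝓝 (r * 0)) := (continuous_const.mul continuous_id).tendsto 0
      rw [mul_zero] at this
      exact this.eventually (gt_mem_nhds (by norm_num))
    have e2 : ∀ᶠ ρ in 𝓝 (0 : ℝ), 2 * C * r ^ (d + 1) * ρ < |c d| := by
      have : Tendsto (fun ρ : ℝ => 2 * C * r ^ (d + 1) * ρ) (𝓝 0) (𝓝 (2 * C * r ^ (d + 1) * 0)) :=
        (continuous_const.mul continuous_id).tendsto 0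
      rw [mul_zero] at this
      exact this.eventually (gt_mem_nhds (abs_pos.2 hd))
    have e3 : Tendsto ENNReal.ofReal (𝓝 0) (𝓝 0) := by
      simpa using ENNReal.continuous_ofReal.tendsto 0
    have e4 : ∀ᶠ ρ in 𝓝[>] (0 : ℝ), 0 < ρ := self_mem_nhdsWithin
    have := (e4.and (nhdsWithin_le_nhds (e1.and (e2.and ((e3.eventually (gt_mem_nhds radf)).and (e3.eventually (gt_mem_nhds radg))))))).exists
    obtain ⟨ρ, h1, h2, h3, h4, h5⟩ := this
    exact ⟨ρ, h1, h2.le, h3, h4, h5⟩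
  have hw0 : ‖wv (m := m) BXS ρ 0‖ₑ ≤ ENNReal.ofReal ρ := by
    rw [← ofReal_norm_eq_enorm]
    exact ENNReal.ofReal_le_ofReal ((norm_wv_zero BXS hS ρ).trans (abs_of_pos hρ).le)
  have hwf : wv (m := m) BXS ρ 0 ∈ Metric.eball (0 : Fin (m + 1) → (X →L[ℝ] X)) (extS (X →L[ℝ] X) p).radius := by
    rw [mem_eball_zero_iff]; exact hw0.trans_lt hρf
  have hwg : wv (m := m) BXS ρ 0 ∈ Metric.eball (0 : Fin (m + 1) → (X →L[ℝ] X)) (extS (X →L[ℝ] X) pg).radius := by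
    rw [mem_eball_zero_iff]; exact hw0.trans_lt hρg
  let F : (Fin m → ℝ) → (X →L[ℝ] X) := fun x => (extS (X →L[ℝ] X) p).sum (wv BXS ρ x)
  let G : (Fin m → ℝ) → (X →L[ℝ] X) := fun x => (extS (X →L[ℝ] X) pg).sum (wv BXS ρ x)
  have hFan : AnalyticAt ℝ F 0 :=
    (((extS (X →L[ℝ] X) p).hasFPowerSeriesOnBall radf).analyticAt_of_mem hwf).comp (wv_an BXS ρ 0)
  have hGan : AnalyticAt ℝ G 0 :=
    (((extS (X →L[ℝ] X) pg).hasFPowerSeriesOnBall radg).analyticAt_of_mem hwg).comp (wv_an BXS ρ 0)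
  -- the operator L
  have hL0 : IsUnit (BXB ^ d * F 0) := by
    have h1 : HasSum (fun k => extS (X →L[ℝ] X) p k fun _ => wv BXS ρ 0) (F 0) := FormalMultilinearSeries.hasSum _ hwf
    have h2 : HasSum (fun k => (BXB ^ d) * (extS (X →L[ℝ] X) p k fun _ => wv BXS ρ 0)) (BXB ^ d * F 0) := h1.mul_left _
    have h3 : ∀ k, (BXB ^ d) * (extS (X →L[ℝ] X) p k fun _ => wv BXS ρ 0) = (c k * ρ ^ k) • (BXB ^ d * BXS ^ k) := by
      intro k; rw [extS_wv_zero]; exact mul_smul_comm _ _ _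
    have h4 := tail_bound hC hr hρ hρ1 d _ _ h2 (fun k hk => by rw [h3, show c k = 0 from hlt k hk]; simp) (fun k => by
      rw [h3, norm_smul, Real.norm_eq_abs, abs_mul, abs_pow, abs_of_pos hρ, mul_pow, ← mul_assoc]
      have h5 : ‖BXB ^ d * BXS ^ k‖ ≤ 1 := (norm_mul_le _ _).trans (by
        have := norm_pow_le_one hB d
        have := norm_pow_le_one hS k
        nlinarith [norm_nonneg (BXB ^ d), norm_nonneg (BXS ^ k)])
      have h6 := hcb k
      calc |c k| * ρ ^ k * ‖BXB ^ d * BXS ^ k‖ ≤ (C * r ^ k) * ρ ^ k * 1 := by gcongr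
        _ = _ := by ring)
    have h5 : BXB ^ d * BXS ^ d = 1 := by
      ext1 x
      have := BXB_pow_S hBS d d x le_rfl
      rw [ContinuousLinearMap.mul_apply, this]; simp
    simp only [h3, h5] at h4
    have hcd : c d * ρ ^ d ≠ 0 := mul_ne_zero hd (by positivity)
    have h6 : ‖1 - (c d * ρ ^ d)⁻¹ • (BXB ^ d * F 0)‖ < 1 := by
      have : 1 - (c d * ρ ^ d)⁻¹ • (BXB ^ d * F 0) =
          (-(c d * ρ ^ d)⁻¹) • ((BXB ^ d * F 0) - (c d * ρ ^ d) • (1 : X →L[ℝ] X)) := by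
        rw [smul_sub, smul_smul, neg_mul, inv_mul_cancel₀ hcd, neg_smul, neg_smul, one_smul]
        abel
      rw [this, norm_smul, norm_neg, norm_inv, Real.norm_eq_abs, abs_mul, abs_pow, abs_of_pos hρ]
      have hpos : 0 < |c d| * ρ ^ d := mul_pos (abs_pos.2 hd) (by positivity)
      rw [inv_mul_lt_iff₀ hpos, mul_one]
      refine h4.trans_lt ?_
      have : 2 * C * (r * ρ) ^ (d + 1) = (2 * C * r ^ (d + 1) * ρ) * ρ ^ d := by ring
      rw [this]
      exact mul_lt_mul_of_pos_right hρ2 (by positivity)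
    have h7 := (Units.oneSub _ h6).isUnit
    rw [Units.val_oneSub, sub_sub_cancel] at h7
    have h8 : BXB ^ d * F 0 = (c d * ρ ^ d) • ((c d * ρ ^ d)⁻¹ • (BXB ^ d * F 0)) := by
      rw [smul_smul, mul_inv_cancel₀ hcd, one_smul]
    rw [h8]
    exact h7.smul (Units.mk0 _ hcd)
  have hLan : AnalyticAt ℝ (fun x => BXB ^ d * F x) 0 :=
    ((ContinuousLinearMap.mul ℝ (X →L[ℝ] X) (BXB ^ d)).analyticAt _).comp hFan
  let qh : (Fin m → ℝ) → X := fun x => Ring.inverse (BXB ^ d * F x) ((BXB ^ d) (G x BXe))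
  have hinv : AnalyticAt ℝ (fun x => Ring.inverse (BXB ^ d * F x)) 0 := by
    obtain ⟨u, hu⟩ := hL0
    exact (analyticAt_inverse (𝕜 := ℝ) u).comp_of_eq hLan hu.symm
  have apply_an : ∀ {T : (Fin m → ℝ) → (X →L[ℝ] X)} {v : (Fin m → ℝ) → X}, AnalyticAt ℝ T 0 → AnalyticAt ℝ v 0 →
      AnalyticAt ℝ (fun x => T x (v x)) 0 := by
    intro T v hT hv
    exact AnalyticAt.comp (g := fun y : (X →L[ℝ] X) × X => y.1 y.2) (f := fun x => (T x, v x))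
      ((ContinuousLinearMap.id ℝ (X →L[ℝ] X)).analyticAt_bilinear (T 0, v 0)) (AnalyticAt.prod hT hv)
  have hqh : AnalyticAt ℝ qh 0 := by
    refine apply_an hinv ?_
    exact ((BXB ^ d).analyticAt _).comp (apply_an hGan analyticAt_const)
  let b : (Fin m → ℝ) → X := fun x => G x BXe - F x (qh x)
  have hb : AnalyticAt ℝ b 0 := (apply_an hGan analyticAt_const).sub (apply_an hFan hqh)
  let ini : (Fin (m + 1) → ℝ) →L[ℝ] (Fin m → ℝ) := ContinuousLinearMap.pi fun j => ContinuousLinearMap.proj j.castSucc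
  refine ⟨fun x => evs BXB BXp (x (Fin.last m) / ρ) (qh (ini x)), fun k x => ρ⁻¹ ^ k * BXp ((BXB ^ k) (b x)), ?_, ?_, ?_⟩
  · have h1 : AnalyticAt ℝ (fun x : Fin (m + 1) → ℝ => evs BXB BXp (x (Fin.last m) / ρ)) 0 := by
      have h2 : AnalyticAt ℝ (fun x : Fin (m + 1) → ℝ => x (Fin.last m) / ρ) 0 :=
        ((ContinuousLinearMap.proj (R := ℝ) (φ := fun _ : Fin (m + 1) => ℝ) (Fin.last m)).analyticAt 0).div analyticAt_const hρ.ne'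
      exact (evs_analytic hB (s := 0) (by simp)).comp_of_eq h2 (by simp)
    have h2 : AnalyticAt ℝ (fun x => qh (ini x)) 0 := hqh.comp_of_eq (ini.analyticAt 0) (by simp)
    exact AnalyticAt.comp (g := fun y : (X →L[ℝ] ℝ) × X => y.1 y.2)
      (f := fun x : Fin (m + 1) → ℝ => (evs BXB BXp (x (Fin.last m) / ρ), qh (ini x)))
      ((ContinuousLinearMap.id ℝ (X →L[ℝ] ℝ)).analyticAt_bilinear _) (AnalyticAt.prod h1 h2)
  · intro k
    exact analyticAt_const.mul ((BXp.analyticAt _).comp (((BXB ^ k).analyticAt _).comp hb))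
  · have t1 : Tendsto ini (𝓝 0) (𝓝 0) := by simpa using ini.continuous.tendsto 0
    have t2 : Tendsto (fun x : Fin (m + 1) → ℝ => x (Fin.last m) / ρ) (𝓝 0) (𝓝 0) := by
      have : Continuous (fun x : Fin (m + 1) → ℝ => x (Fin.last m) / ρ) := by fun_prop
      simpa using this.tendsto 0
    have t3 : Tendsto (fun x => wv BXS ρ (ini x)) (𝓝 0) (𝓝 (wv BXS ρ 0)) :=
      (wv_an BXS ρ 0).continuousAt.tendsto.comp t1
    have u1 : ∀ᶠ x in 𝓝 (0 : Fin (m + 1) → ℝ), IsUnit (BXB ^ d * F (ini x)) :=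
      (hLan.continuousAt.tendsto.comp t1).eventually (Units.isOpen.mem_nhds hL0)
    have u2 : ∀ᶠ x in 𝓝 (0 : Fin (m + 1) → ℝ), |x (Fin.last m) / ρ| < 1 := by
      have := (continuous_abs.tendsto (0:ℝ)).comp t2
      rw [abs_zero] at this
      exact this.eventually (gt_mem_nhds one_pos)
    filter_upwards [t3.eventually (Metric.isOpen_eball.mem_nhds hwf), t3.eventually (Metric.isOpen_eball.mem_nhds hwg),
      u1, u2, Metric.eball_mem_nhds 0 hRf.r_pos, Metric.eball_mem_nhds 0 hRg.r_pos] with x x1 x2 x3 x4 x5 x6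
    set s := x (Fin.last m) / ρ with hs
    have hev : ∀ i b, evs BXB BXp s (wv BXS ρ (ini x) i b) = x i * evs BXB BXp s b := by
      intro i b
      refine Fin.lastCases ?_ (fun j => ?_) i
      · simp only [wv, Fin.snoc_last, ContinuousLinearMap.smul_apply, map_smul, smul_eq_mul]
        rw [evs_S hB hBS hpS x4, hs]
        field_simp
      · simp [wv, ini]
    have k1 := ev_extS p hRf x x5 _ x1 radf (evs BXB BXp s) hev (qh (ini x))
    have k2 := ev_extS pg hRg x x6 _ x2 radg (evs BXB BXp s) hev BXe
    rw [evs_e0 hB hBe hpe x4, mul_one] at k2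
    have k3 : (BXB ^ d) (b (ini x)) = 0 := by
      have : (BXB ^ d * F (ini x)) (qh (ini x)) = (BXB ^ d) (G (ini x) BXe) := by
        have := Ring.mul_inverse_cancel _ x3
        have := congrArg (fun T : X →L[ℝ] X => T ((BXB ^ d) (G (ini x) BXe))) this
        simpa only [ContinuousLinearMap.mul_apply, ContinuousLinearMap.one_apply] using this
      simp only [b, map_sub]
      rw [← this]
      simp [ContinuousLinearMap.mul_apply]
    have k4 := evs_poly (π := BXp) hB x4 d (b (ini x))
    rw [k3, map_zero, mul_zero, add_zero] at k4
    have k5 : G (ini x) BXe = F (ini x) (qh (ini x)) + b (ini x) := by simp [b]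
    change evs BXB BXp s (G (ini x) BXe) = g x at k2
    change evs BXB BXp s (F (ini x) (qh (ini x))) = _ at k1
    rw [← k2, k5, map_add, k1, k4]
    have e3 : (fun j : Fin m => x j.castSucc) = ini x := by funext j; simp [ini]
    rw [e3]
    congr 1
    · ring
    · refine Finset.sum_congr rfl fun k _ => ?_
      rw [hs, div_pow, inv_pow]
      field_simp

end

/-- **Weierstrass division** (existence). -/
theorem weierstrass_division {m : ℕ} {f g : (Fin (m + 1) → ℝ) → ℝ}
    {p : FormalMultilinearSeries ℝ (Fin (m + 1) → ℝ) ℝ} (hf : HasFPowerSeriesAt f p 0)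
    (hg : AnalyticAt ℝ g 0) (d : ℕ) (hlt : ∀ k < d, (p k fun _ => Pi.single (Fin.last m) 1) = 0)
    (hd : (p d fun _ => Pi.single (Fin.last m) 1) ≠ 0) :
    ∃ (q : (Fin (m + 1) → ℝ) → ℝ) (r : ℕ → (Fin m → ℝ) → ℝ), AnalyticAt ℝ q 0 ∧ (∀ k, AnalyticAt ℝ (r k) 0) ∧
      ∀ᶠ x in 𝓝 0, g x = q x * f x + ∑ k ∈ Finset.range d, r k (fun j => x j.castSucc) * x (Fin.last m) ^ k := by
  obtain ⟨h1, h2, h3, h4, h5, h6⟩ := exists_shift_space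
  have : Nontrivial BX := ⟨BXe, 0, by intro h; rw [h] at h4; simp at h4⟩
  exact weierstrass_division_aux BXS BXB BXe BXp h1 h2 h3 h4 h5 h6 hf hg d hlt hd

end QDC

namespace QDC
open Filter Topology
open scoped ContDiff
set_option linter.all false

/-- forget the last variable -/
noncomputable def iniL (m : ℕ) : (Fin (m + 1) → ℝ) →L[ℝ] (Fin m → ℝ) :=
  ContinuousLinearMap.pi fun j => ContinuousLinearMap.proj j.castSucc

/-- inclusion of germs -/
noncomputable abbrev inc (m : ℕ) : O m →+* O (m + 1) := pull (iniL m)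

theorem last_an (m : ℕ) : AnalyticAt ℝ (fun x : Fin (m + 1) → ℝ => x (Fin.last m)) 0 :=
  (ContinuousLinearMap.proj (R := ℝ) (φ := fun _ : Fin (m + 1) => ℝ) (Fin.last m)).analyticAt 0

/-- last coordinate -/
noncomputable def tt (m : ℕ) : O (m + 1) := O.mk (fun x => x (Fin.last m)) (last_an m)

theorem rep_tt (m : ℕ) : rep (tt m) =ᶠ[𝓝 0] fun x => x (Fin.last m) := rep_mk _ _

theorem rep_pow {n : ℕ} (φ : O n) (k : ℕ) : rep (φ ^ k) =ᶠ[𝓝 0] fun x => rep φ x ^ k := by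
  induction k with
  | zero => simpa using rep_one
  | succ k ih =>
    rw [pow_succ]
    filter_upwards [rep_mul (φ ^ k) φ, ih] with x h1 h2
    rw [h1, Pi.mul_apply, h2, pow_succ]

/-- regular in the last variable -/
def Reg {m : ℕ} (f : O (m + 1)) (d : ℕ) : Prop :=
  ∃ p : FormalMultilinearSeries ℝ (Fin (m + 1) → ℝ) ℝ, HasFPowerSeriesAt (rep f) p 0 ∧ (∀ k < d, (p k fun _ => Pi.single (Fin.last m) 1) = 0) ∧
    (p d fun _ => Pi.single (Fin.last m) 1) ≠ 0

theorem Reg.div {m : ℕ} {f : O (m + 1)} {d : ℕ} (h : Reg f d) (g : O (m + 1)) :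
    ∃ (q : O (m + 1)) (r : Fin d → O m), g = q * f + ∑ k, inc m (r k) * tt m ^ (k : ℕ) := by
  obtain ⟨p, hp, h1, h2⟩ := h
  obtain ⟨q, r, hq, hr, hx⟩ := weierstrass_division hp (rep_an g) d h1 h2
  refine ⟨O.mk q hq, fun k => O.mk (r k) (hr k), ?_⟩
  rw [O_eq_iff]
  have e1 : ∀ᶠ x in 𝓝 (0 : Fin (m + 1) → ℝ), ∀ k : Fin d,
      rep (inc m (O.mk (r k) (hr k)) * tt m ^ (k : ℕ)) x = r k (iniL m x) * x (Fin.last m) ^ (k : ℕ) := by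
    rw [eventually_all]
    intro k
    filter_upwards [rep_mul (inc m (O.mk (r k) (hr k))) (tt m ^ (k : ℕ)), rep_pow (tt m) k, rep_tt m,
      rep_pull (iniL m) (O.mk (r k) (hr k)), (tendsto_lin (iniL m)).eventually (rep_mk (r k) (hr k))] with x x1 x2 x3 x4 x5
    rw [x1, Pi.mul_apply, x2, x3, x4, Function.comp_apply, x5]
  filter_upwards [hx, e1, rep_add (O.mk q hq * f) (∑ k : Fin d, inc m (O.mk (r k) (hr k)) * tt m ^ (k : ℕ)),
    rep_mul (O.mk q hq) f, rep_mk q hq, rep_sum Finset.univ (fun k : Fin d => inc m (O.mk (r k) (hr k)) * tt m ^ (k : ℕ))]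
    with x x1 x2 x3 x4 x5 x6
  rw [x3, Pi.add_apply, x4, Pi.mul_apply, x5, x6, x1]
  simp only [x2]
  rw [Finset.sum_range]
  rfl

theorem exists_reg {m : ℕ} (f : O (m + 1)) (hf : f ≠ 0) :
    ∃ (A : (Fin (m + 1) → ℝ) ≃L[ℝ] (Fin (m + 1) → ℝ)) (d : ℕ), Reg (pullE A f) d := by
  obtain ⟨p, hp⟩ := rep_an f
  have h1 : ∃ k v, p k (fun _ => v) ≠ 0 := by
    by_contra hcon
    push Not at hcon
    apply hf
    rw [O_eq_iff]
    refine EventuallyEq.trans ?_ rep_zero.symm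
    filter_upwards [hp.eventually_hasSum] with x hx
    simp only [hcon, zero_add] at hx
    exact hx.unique hasSum_zero
  obtain ⟨k, v, hv⟩ := h1
  set e : Fin (m + 1) → ℝ := Pi.single (Fin.last m) 1 with he
  have he0 : e ≠ 0 := by
    intro h
    have := congrFun h (Fin.last m)
    simp [he] at this
  have h2 : ∃ v, v ≠ 0 ∧ p k (fun _ => v) ≠ 0 := by
    by_cases hv0 : v = 0
    · refine ⟨e, he0, ?_⟩
      subst hv0
      rcases k with _ | k
      · convert hv using 2
      · exfalso
        apply hv
        exact (p (k + 1)).map_coord_zero 0 rfl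
    · exact ⟨v, hv0, hv⟩
  obtain ⟨v, hv0, hv⟩ := h2
  obtain ⟨A, hA⟩ := SeparatingDual.exists_continuousLinearEquiv_apply_eq (R := ℝ) he0 hv0
  have h3 : HasFPowerSeriesAt (rep (pullE A f)) (p.compContinuousLinearMap (A : (Fin (m + 1) → ℝ) →L[ℝ] (Fin (m + 1) → ℝ))) 0 := by
    have h4 : HasFPowerSeriesAt (rep f ∘ A) (p.compContinuousLinearMap (A : (Fin (m + 1) → ℝ) →L[ℝ] (Fin (m + 1) → ℝ))) 0 := by
      have : HasFPowerSeriesAt (rep f) p ((A : (Fin (m + 1) → ℝ) →L[ℝ] (Fin (m + 1) → ℝ)) 0) := by simpa using hp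
      exact this.compContinuousLinearMap
    exact h4.congr (rep_pull (A : (Fin (m + 1) → ℝ) →L[ℝ] (Fin (m + 1) → ℝ)) f).symm
  have h5 : ∃ k, (p.compContinuousLinearMap (A : (Fin (m + 1) → ℝ) →L[ℝ] (Fin (m + 1) → ℝ)) k fun _ => e) ≠ 0 := by
    refine ⟨k, ?_⟩
    simp only [FormalMultilinearSeries.compContinuousLinearMap_apply]
    convert hv using 2
    exact funext fun _ => hA
  classical
  refine ⟨A, Nat.find h5, _, h3, fun k hk => ?_, Nat.find_spec h5⟩
  have := Nat.find_min h5 hk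
  simpa using this

theorem O_zero_unit (φ : O 0) (h : φ ≠ 0) : IsUnit φ := by
  apply isUnit_of_ne
  intro h0
  apply h
  rw [O_eq_iff]
  refine EventuallyEq.trans ?_ rep_zero.symm
  refine Eventually.of_forall fun x => ?_
  rw [Subsingleton.elim x 0, h0]

theorem O_noeth_step (m : ℕ) [IsNoetherianRing (O m)] : IsNoetherianRing (O (m + 1)) := by
  rw [isNoetherianRing_iff_ideal_fg]
  have main : ∀ (I : Ideal (O (m + 1))) (f : O (m + 1)) (d : ℕ), f ∈ I → Reg f d → I.FG := by
    intro I f d hfI hf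
    let σ : (Fin d → O m) → O (m + 1) := fun r => ∑ k, inc m (r k) * tt m ^ (k : ℕ)
    have σadd : ∀ r s, σ (r + s) = σ r + σ s := by
      intro r s; simp [σ, add_mul, Finset.sum_add_distrib]
    have σsmul : ∀ a r, σ (a • r) = inc m a * σ r := by
      intro a r; simp [σ, Finset.mul_sum, mul_assoc]
    have σzero : σ 0 = 0 := by simp [σ]
    let N : Submodule (O m) (Fin d → O m) :=
      { carrier := {r | σ r ∈ I}
        add_mem' := fun {a b} ha hb => by
          simp only [Set.mem_setOf_eq, σadd] at *; exact I.add_mem ha hb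
        zero_mem' := by simp [σzero]
        smul_mem' := fun c x hx => by
          simp only [Set.mem_setOf_eq, σsmul] at *; exact I.mul_mem_left _ hx }
    obtain ⟨S, hS⟩ := IsNoetherian.noetherian N
    refine (Submodule.fg_def).2 ⟨{f} ∪ σ '' S, (Set.finite_singleton f).union (S.finite_toSet.image _), ?_⟩
    apply le_antisymm
    · rw [Submodule.span_le]
      rintro x (rfl | ⟨r, hr, rfl⟩)
      · exact hfI
      · have : r ∈ N := by rw [← hS]; exact Submodule.subset_span hr
        exact this
    · intro g hg
      obtain ⟨q, r, hqr⟩ := hf.div g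
      have h1 : σ r ∈ I := by
        have : σ r = g - q * f := by rw [hqr]; simp [σ]
        rw [this]
        exact I.sub_mem hg (I.mul_mem_left _ hfI)
      have h2 : r ∈ Submodule.span (O m) (S : Set (Fin d → O m)) := by rw [hS]; exact h1
      have h3 : ∀ r ∈ Submodule.span (O m) (S : Set (Fin d → O m)), σ r ∈ Submodule.span (O (m + 1)) ({f} ∪ σ '' S) := by
        intro r hr
        induction hr using Submodule.span_induction with
        | mem x hx => exact Submodule.subset_span (Or.inr ⟨x, hx, rfl⟩)
        | zero => rw [σzero]; exact zero_mem _
        | add x y _ _ hx hy => rw [σadd]; exact add_mem hx hy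
        | smul a x _ hx => rw [σsmul]; exact Submodule.smul_mem _ _ hx
      rw [hqr]
      refine add_mem ?_ (h3 r h2)
      exact Submodule.smul_mem _ q (Submodule.subset_span (Or.inl rfl))
  intro I
  by_cases hI : I = ⊥
  · rw [hI]; exact Submodule.fg_bot
  obtain ⟨f, hfI, hf0⟩ := Submodule.exists_mem_ne_zero_of_ne_bot hI
  obtain ⟨A, d, hA⟩ := exists_reg f hf0
  have h1 := main (I.map (pullE A)) (pullE A f) d (Ideal.mem_map_of_mem _ hfI) hA
  have h2 : I = (I.map (pullE A)).map (pullE A).symm := by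
    exact (Ideal.map_of_equiv (pullE A)).symm
  rw [h2]
  exact h1.map _

instance O_noeth (n : ℕ) : IsNoetherianRing (O n) := by
  induction n with
  | zero =>
    rw [isNoetherianRing_iff_ideal_fg]
    intro I
    by_cases hI : I = ⊥
    · rw [hI]; exact Submodule.fg_bot
    obtain ⟨f, hfI, hf0⟩ := Submodule.exists_mem_ne_zero_of_ne_bot hI
    rw [Ideal.eq_top_of_isUnit_mem I hfI (O_zero_unit f hf0)]
    exact Ideal.fg_top _
  | succ m ih => exact O_noeth_step m

end QDC

namespace QDC
open Filter Topology
open scoped ContDiff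
set_option linter.all false

theorem reg_of_line {m : ℕ} (f : O (m + 1))
    (h : ¬ ∀ᶠ t in 𝓝 (0 : ℝ), rep f (t • Pi.single (Fin.last m) 1) = 0) : ∃ d, Reg f d := by
  obtain ⟨p, hp⟩ := rep_an f
  have h5 : ∃ k, (p k fun _ => (Pi.single (Fin.last m) 1 : Fin (m + 1) → ℝ)) ≠ 0 := by
    by_contra hcon
    push Not at hcon
    apply h
    have ht : Tendsto (fun t : ℝ => t • (Pi.single (Fin.last m) 1 : Fin (m + 1) → ℝ)) (𝓝 0) (𝓝 0) := by
      have : Continuous (fun t : ℝ => t • (Pi.single (Fin.last m) 1 : Fin (m + 1) → ℝ)) := by fun_prop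
      simpa using this.tendsto 0
    filter_upwards [ht.eventually hp.eventually_hasSum] with t hx
    have : ∀ k, (p k fun _ => t • (Pi.single (Fin.last m) 1 : Fin (m + 1) → ℝ)) = 0 := by
      intro k
      have := (p k).map_smul_univ (fun _ => t) (fun _ => (Pi.single (Fin.last m) 1 : Fin (m + 1) → ℝ))
      rw [this, hcon, smul_zero]
    simp only [this, zero_add] at hx
    exact hx.unique hasSum_zero
  classical
  refine ⟨Nat.find h5, p, hp, fun k hk => ?_, Nat.find_spec h5⟩
  have := Nat.find_min h5 hk
  simpa using this

/-- evaluation of polynomials -/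
noncomputable abbrev ev (m : ℕ) : Polynomial (O m) →+* O (m + 1) := Polynomial.eval₂RingHom (inc m) (tt m)

theorem ev_C {m : ℕ} (a : O m) : ev m (Polynomial.C a) = inc m a := by simp [ev]
theorem ev_X {m : ℕ} : ev m Polynomial.X = tt m := by simp [ev]

theorem iniL_last (m : ℕ) : iniL m (Pi.single (Fin.last m) 1) = 0 := by
  funext j
  simp [iniL, Fin.castSucc_ne_last]

theorem iniL_snoc (m : ℕ) (e : Fin m → ℝ) : iniL m (Fin.snoc (α := fun _ => ℝ) e 0) = e := by
  funext j
  simp [iniL]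

theorem DD_tt (m : ℕ) : DD (Pi.single (Fin.last m) 1) (tt m) = 1 := by
  rw [O_eq_iff]
  refine EventuallyEq.trans (rep_DD _ _) (EventuallyEq.trans ?_ rep_one.symm)
  filter_upwards [(rep_tt m).eventuallyEq_nhds] with x hx
  rw [hx.fderiv_eq]
  have : HasFDerivAt (fun x : Fin (m + 1) → ℝ => x (Fin.last m)) (ContinuousLinearMap.proj (R := ℝ) (φ := fun _ : Fin (m + 1) => ℝ) (Fin.last m)) x :=
    (ContinuousLinearMap.proj (R := ℝ) (φ := fun _ : Fin (m + 1) => ℝ) (Fin.last m)).hasFDerivAt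
  rw [this.fderiv]
  simp

theorem DD_ev {m : ℕ} (G : Polynomial (O m)) :
    DD (Pi.single (Fin.last m) 1) (ev m G) = ev m (Polynomial.derivative G) := by
  have hC : ∀ a : O m, DD (Pi.single (Fin.last m) 1) (inc m a) = 0 := by
    intro a; rw [DD_pull, iniL_last, DD_zero_dir, map_zero]
  induction G using Polynomial.induction_on with
  | C a => rw [ev_C, hC]; simp
  | add p q hp hq => rw [map_add, DD_add, hp, hq]; simp
  | monomial n a ih =>
    have h1 : Polynomial.C a * Polynomial.X ^ (n + 1) = (Polynomial.C a * Polynomial.X ^ n) * Polynomial.X := by ring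
    rw [h1, Polynomial.derivative_mul, map_mul (ev m) _ Polynomial.X, DD_mul, ih, ev_X, DD_tt, map_add, map_mul (ev m) _ Polynomial.X, ev_X,
      Polynomial.derivative_X, mul_one, mul_one]
    ring

/-- the claim for one ideal -/
def PSI {n : ℕ} (p : Ideal (O n)) : Prop :=
  ∃ (κ : Type) (_ : Fintype κ) (_ : DecidableEq κ) (h : κ → O n) (e : κ → (Fin n → ℝ)),
    (∀ i, h i ∈ p) ∧ (Matrix.of fun i j => DD (e j) (h i)).det ∉ p ∧
    ∀ φ ∈ p, ∃ δ, δ ∉ p ∧ δ * φ ∈ Ideal.span (Set.range h)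

theorem PSI_bot {n : ℕ} (hp : (⊥ : Ideal (O n)).IsPrime) : PSI (⊥ : Ideal (O n)) := by
  have h1 : (1 : O n) ∉ (⊥ : Ideal (O n)) := fun h => hp.ne_top ((Ideal.eq_top_iff_one _).2 h)
  refine ⟨Empty, inferInstance, inferInstance, fun i => i.elim, fun i => i.elim, fun i => i.elim, ?_, ?_⟩
  · rw [Matrix.det_isEmpty]; exact h1
  · intro φ hφ
    refine ⟨1, h1, ?_⟩
    rw [Ideal.mem_bot.1 hφ]; simp

theorem PSI_transport {n : ℕ} (A : (Fin n → ℝ) ≃L[ℝ] (Fin n → ℝ)) (p : Ideal (O n))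
    (h : PSI (p.comap ((pullE A).symm : O n →+* O n))) : PSI p := by
  obtain ⟨κ, i1, i2, h, e, h1, h2, h3⟩ := h
  have key : ∀ i j, DD (A (e j)) ((pullE A).symm (h i)) = (pullE A).symm (DD (e j) (h i)) := by
    intro i j
    apply (pullE A).injective
    rw [RingEquiv.apply_symm_apply]
    have := DD_pull (A : (Fin n → ℝ) →L[ℝ] (Fin n → ℝ)) (e j) ((pullE A).symm (h i))
    have h4 : pull (A : (Fin n → ℝ) →L[ℝ] (Fin n → ℝ)) ((pullE A).symm (h i)) = h i := (pullE A).apply_symm_apply (h i)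
    rw [h4] at this
    rw [this]; rfl
  refine ⟨κ, i1, i2, fun i => (pullE A).symm (h i), fun j => A (e j), h1, ?_, ?_⟩
  · intro h5
    apply h2
    rw [Ideal.mem_comap]
    convert h5
    rw [RingHom.map_det]
    congr 1
    ext i j : 2
    simp [key]
  · intro φ hφ
    obtain ⟨δ, hδ, hs⟩ := h3 (pullE A φ) (by rw [Ideal.mem_comap]; simpa using hφ)
    refine ⟨(pullE A).symm δ, hδ, ?_⟩
    have := Ideal.mem_map_of_mem ((pullE A).symm : O n →+* O n) hs
    rw [Ideal.map_span, ← Set.range_comp] at this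
    simpa [Function.comp_def] using this

theorem prime_poly {R : Type*} [CommRing R] (p0 : Ideal R) [hp0 : p0.IsPrime] {κ : Type} (h : κ → R)
    (hh : ∀ φ ∈ p0, ∃ δ, δ ∉ p0 ∧ δ * φ ∈ Ideal.span (Set.range h))
    (p1 : Ideal (Polynomial R)) (hp1 : ∀ a ∈ p0, Polynomial.C a ∈ p1)
    (G : Polynomial R) (hG : G ∈ p1) (hl : G.leadingCoeff ∉ p0) (hk : 1 ≤ G.natDegree)
    (hmin : ∀ B ∈ p1, B.leadingCoeff ∉ p0 → G.natDegree ≤ B.natDegree) (D : ℕ) :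
    ∀ B ∈ p1, B.natDegree < D → ∃ δ, δ ∉ p0 ∧
      Polynomial.C δ * B ∈ (Ideal.span (Set.range h)).map Polynomial.C ⊔ Ideal.span {G} := by
  have h1 : (1 : R) ∉ p0 := fun h => hp0.ne_top ((Ideal.eq_top_iff_one _).2 h)
  induction D with
  | zero => intro B _ h; omega
  | succ D ih =>
    intro B hB hD
    by_cases hb : B.leadingCoeff ∈ p0
    · have hE : B.eraseLead ∈ p1 := by
        have : B.eraseLead = B - Polynomial.C B.leadingCoeff * Polynomial.X ^ B.natDegree := by
          rw [eq_sub_iff_add_eq, Polynomial.eraseLead_add_C_mul_X_pow]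
        rw [this]
        exact p1.sub_mem hB (p1.mul_mem_right _ (hp1 _ hb))
      have h2 : ∃ δ, δ ∉ p0 ∧ Polynomial.C δ * B.eraseLead ∈ (Ideal.span (Set.range h)).map Polynomial.C ⊔ Ideal.span {G} := by
        rcases B.eraseLead_natDegree_lt_or_eraseLead_eq_zero with h3 | h3
        · exact ih _ hE (by omega)
        · exact ⟨1, h1, by rw [h3]; simp⟩
      obtain ⟨δ1, hδ1, h3⟩ := h2
      obtain ⟨δ0, hδ0, h4⟩ := hh _ hb
      refine ⟨δ0 * δ1, fun h => (hp0.mem_or_mem h).elim hδ0 hδ1, ?_⟩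
      have : Polynomial.C (δ0 * δ1) * B = Polynomial.C δ0 * (Polynomial.C δ1 * B.eraseLead) +
          Polynomial.C (δ0 * B.leadingCoeff) * (Polynomial.C δ1 * Polynomial.X ^ B.natDegree) := by
        conv_lhs => rw [← Polynomial.eraseLead_add_C_mul_X_pow B]
        simp only [map_mul]
        ring
      rw [this]
      refine add_mem (Ideal.mul_mem_left _ _ h3) (Ideal.mul_mem_right _ _ ?_)
      exact Ideal.mem_sup_left (Ideal.mem_map_of_mem _ h4)
    · have hN := hmin B hB hb
      set N := B.natDegree with hNdef
      set k := G.natDegree with hkdef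
      set B' := Polynomial.C G.leadingCoeff * B - Polynomial.C B.leadingCoeff * (Polynomial.X ^ (N - k) * G) with hB'
      have hB'm : B' ∈ p1 := p1.sub_mem (p1.mul_mem_left _ hB) (p1.mul_mem_left _ (p1.mul_mem_left _ hG))
      have d1 : B'.natDegree ≤ N := by
        refine (Polynomial.natDegree_sub_le_of_le (n := N) (m := N) ?_ ?_).trans (by simp)
        · exact Polynomial.natDegree_C_mul_le _ _
        · refine (Polynomial.natDegree_C_mul_le _ _).trans ?_
          refine Polynomial.natDegree_mul_le.trans ?_
          have := Polynomial.natDegree_X_pow_le (R := R) (N - k)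
          omega
      have c1 : B'.coeff N = 0 := by
        rw [hB', Polynomial.coeff_sub, Polynomial.coeff_C_mul, Polynomial.coeff_C_mul, Polynomial.coeff_X_pow_mul', if_pos (by omega)]
        have : N - (N - k) = k := by omega
        rw [this]
        simp only [Polynomial.leadingCoeff, ← hNdef, ← hkdef]
        ring
      have d2 : B'.natDegree < N := by
        rcases lt_or_eq_of_le d1 with h | h
        · exact h
        · exfalso
          have : B'.leadingCoeff = 0 := by rw [Polynomial.leadingCoeff, h, c1]
          rw [Polynomial.leadingCoeff_eq_zero] at this
          rw [this] at h
          simp at h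
          omega
      obtain ⟨δ1, hδ1, h3⟩ := ih B' hB'm (by omega)
      refine ⟨δ1 * G.leadingCoeff, fun h => (hp0.mem_or_mem h).elim hδ1 hl, ?_⟩
      have : Polynomial.C (δ1 * G.leadingCoeff) * B = Polynomial.C δ1 * B' +
          (Polynomial.C δ1 * Polynomial.C B.leadingCoeff * Polynomial.X ^ (N - k)) * G := by
        simp only [map_mul, hB']
        ring
      rw [this]
      refine add_mem h3 (Ideal.mul_mem_left _ _ ?_)
      exact Ideal.mem_sup_right (Ideal.mem_span_singleton_self _)

theorem PS_step {m : ℕ} (IH : ∀ p : Ideal (O m), p.IsPrime → PSI p) (p : Ideal (O (m + 1))) (hp : p.IsPrime)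
    (f : O (m + 1)) (hf : f ∈ p) (d : ℕ) (hd : Reg f d) : PSI p := by
  -- the Weierstrass polynomial
  obtain ⟨q, r, hqr⟩ := hd.div (tt m ^ d)
  let P : Polynomial (O m) := Polynomial.X ^ d - ∑ k : Fin d, Polynomial.C (r k) * Polynomial.X ^ (k : ℕ)
  have hdeg : Polynomial.degree (∑ k : Fin d, Polynomial.C (r k) * Polynomial.X ^ (k : ℕ)) < (d : WithBot ℕ) := by
    rw [Polynomial.degree_lt_iff_coeff_zero]
    intro j hj
    simp only [Polynomial.finsetSum_coeff, Polynomial.coeff_C_mul, Polynomial.coeff_X_pow]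
    apply Finset.sum_eq_zero
    intro k _
    have := k.2
    rw [if_neg (by omega), mul_zero]
  have hPm : P.Monic := Polynomial.monic_X_pow_sub hdeg
  have hevP : ev m P = tt m ^ d - ∑ k, inc m (r k) * tt m ^ (k : ℕ) := by
    simp only [P, map_sub, map_sum, map_mul, map_pow, ev_X, ev_C]
  have hevPp : ev m P ∈ p := by
    rw [hevP, hqr, add_sub_cancel_right]
    exact p.mul_mem_left _ hf
  have hPreg : ∃ d', Reg (ev m P) d' := by
    apply reg_of_line
    intro hev
    let Q : Polynomial ℝ := Polynomial.X ^ d - ∑ k : Fin d, Polynomial.C (rep (r k) 0) * Polynomial.X ^ (k : ℕ)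
    have hdegQ : Polynomial.degree (∑ k : Fin d, Polynomial.C (rep (r k) 0) * Polynomial.X ^ (k : ℕ)) < (d : WithBot ℕ) := by
      rw [Polynomial.degree_lt_iff_coeff_zero]
      intro j hj
      simp only [Polynomial.finsetSum_coeff, Polynomial.coeff_C_mul, Polynomial.coeff_X_pow]
      apply Finset.sum_eq_zero
      intro k _
      have := k.2
      rw [if_neg (by omega), mul_zero]
    have hQm : Q.Monic := Polynomial.monic_X_pow_sub hdegQ
    have ht : Tendsto (fun t : ℝ => t • (Pi.single (Fin.last m) 1 : Fin (m + 1) → ℝ)) (𝓝 0) (𝓝 0) := by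
      have : Continuous (fun t : ℝ => t • (Pi.single (Fin.last m) 1 : Fin (m + 1) → ℝ)) := by fun_prop
      simpa using this.tendsto 0
    have e1 : ∀ᶠ x in 𝓝 (0 : Fin (m + 1) → ℝ), ∀ k : Fin d,
        rep (inc m (r k) * tt m ^ (k : ℕ)) x = rep (r k) (iniL m x) * x (Fin.last m) ^ (k : ℕ) := by
      rw [eventually_all]
      intro k
      filter_upwards [rep_mul (inc m (r k)) (tt m ^ (k : ℕ)), rep_pow (tt m) k, rep_tt m,
        rep_pull (iniL m) (r k)] with x x1 x2 x3 x4
      rw [x1, Pi.mul_apply, x2, x3, x4, Function.comp_apply]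
    have hz : ∀ᶠ t in 𝓝 (0 : ℝ), Q.eval t = 0 := by
      rw [hevP] at hev
      filter_upwards [hev, ht.eventually (rep_sub (tt m ^ d) (∑ k, inc m (r k) * tt m ^ (k : ℕ))), ht.eventually e1,
        ht.eventually (rep_pow (tt m) d), ht.eventually (rep_tt m),
        ht.eventually (rep_sum Finset.univ (fun k : Fin d => inc m (r k) * tt m ^ (k : ℕ)))] with t t1 t2 t3 t4 t5 t6
      rw [t1, Pi.sub_apply, t4, t5, t6] at t2
      simp only [t3, map_smul, iniL_last, smul_zero] at t2
      simp only [Q, Polynomial.eval_sub, Polynomial.eval_pow, Polynomial.eval_X, Polynomial.eval_finsetSum, Polynomial.eval_mul, Polynomial.eval_C]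
      simpa using t2.symm
    have hQ0 : Q = 0 := by
      apply Polynomial.eq_zero_of_infinite_isRoot
      obtain ⟨ε, hε, hb⟩ := Metric.eventually_nhds_iff_ball.1 hz
      refine Set.Infinite.mono (s := Set.Ioo 0 ε) ?_ (Set.Ioo_infinite hε)
      intro t ht
      exact hb t (by rw [mem_ball_zero_iff, Real.norm_eq_abs, abs_of_pos ht.1]; exact ht.2)
    exact hQm.ne_zero hQ0
  obtain ⟨d', hd'⟩ := hPreg
  have hp0 : (p.comap (inc m)).IsPrime := inferInstance
  obtain ⟨κ, i1, i2, h, e, h1, h2, h3⟩ := IH _ hp0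
  have hone : (1 : O m) ∉ p.comap (inc m) := fun h => hp0.ne_top ((Ideal.eq_top_iff_one _).2 h)
  have hex : ∃ k, ∃ G : Polynomial (O m), ev m G ∈ p ∧ G.leadingCoeff ∉ p.comap (inc m) ∧ G.natDegree = k :=
    ⟨_, P, hevPp, by rw [hPm]; exact hone, rfl⟩
  classical
  obtain ⟨G, hG, hl, hGk⟩ := Nat.find_spec hex
  have hmin : ∀ B ∈ p.comap (ev m), B.leadingCoeff ∉ p.comap (inc m) → G.natDegree ≤ B.natDegree := by
    intro B hB hBl
    rw [hGk]
    exact Nat.find_min' hex ⟨B, hB, hBl, rfl⟩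
  have hk1 : 1 ≤ G.natDegree := by
    by_contra hlt
    have h0 : G.natDegree = 0 := by omega
    apply hl
    rw [Polynomial.eq_C_of_natDegree_eq_zero h0, ev_C] at hG
    rw [Polynomial.leadingCoeff, h0]
    exact hG
  have hG' : ev m (Polynomial.derivative G) ∉ p := by
    intro hmem
    have hc : (Polynomial.derivative G).coeff (G.natDegree - 1) ∉ p.comap (inc m) := by
      rw [Polynomial.coeff_derivative, Nat.sub_add_cancel hk1]
      intro hcon
      rcases hp0.mem_or_mem hcon with h4 | h4
      · exact hl h4
      · have : ((G.natDegree - 1 : ℕ) : O m) + 1 = (G.natDegree : O m) := by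
          exact_mod_cast congrArg (Nat.cast (R := O m)) (Nat.sub_add_cancel hk1)
        rw [this] at h4
        exact hp0.ne_top (Ideal.eq_top_of_isUnit_mem _ h4 (isUnit_natCast _ (by omega)))
    have hdl : (Polynomial.derivative G).natDegree ≤ G.natDegree - 1 := Polynomial.natDegree_derivative_le G
    have hde : (Polynomial.derivative G).natDegree = G.natDegree - 1 := by
      refine le_antisymm hdl ?_
      apply Polynomial.le_natDegree_of_ne_zero
      intro h0
      rw [h0] at hc
      exact hc (zero_mem _)
    have := hmin (Polynomial.derivative G) hmem (by rw [Polynomial.leadingCoeff, hde]; exact hc)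
    omega
  have main : ∀ B : Polynomial (O m), ev m B ∈ p → ∃ δ, δ ∉ p ∧
      δ * ev m B ∈ Ideal.span (Set.range (Sum.elim (fun i => inc m (h i)) (fun _ : Unit => ev m G))) := by
    intro B hB
    obtain ⟨δ, hδ, hm⟩ := prime_poly (p.comap (inc m)) h h3 (p.comap (ev m))
      (fun a ha => by rw [Ideal.mem_comap, ev_C]; exact ha) G hG hl hk1 hmin (B.natDegree + 1) B hB (Nat.lt_succ_self _)
    refine ⟨inc m δ, hδ, ?_⟩
    have h5 := Ideal.mem_map_of_mem (ev m) hm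
    rw [map_mul, ev_C, Ideal.map_sup, Ideal.map_map, Ideal.map_span, Ideal.map_span] at h5
    refine (show _ ≤ Ideal.span (Set.range (Sum.elim (fun i => inc m (h i)) (fun _ : Unit => ev m G))) from sup_le ?_ ?_) h5
    · rw [Ideal.span_le]
      rintro _ ⟨_, ⟨i, rfl⟩, rfl⟩
      refine Ideal.subset_span ⟨Sum.inl i, ?_⟩
      simp [ev]
    · rw [Ideal.span_le]
      rintro _ ⟨_, rfl, rfl⟩
      exact Ideal.subset_span ⟨Sum.inr (), rfl⟩
  refine ⟨κ ⊕ Unit, inferInstance, inferInstance, Sum.elim (fun i => inc m (h i)) (fun _ : Unit => ev m G),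
    Sum.elim (fun j => Fin.snoc (α := fun _ => ℝ) (e j) 0) (fun _ => Pi.single (Fin.last m) 1), ?_, ?_, ?_⟩
  · rintro (i | i)
    · exact h1 i
    · exact hG
  · have hM : (Matrix.of fun i j => DD (Sum.elim (fun j => Fin.snoc (α := fun _ => ℝ) (e j) 0) (fun _ : Unit => Pi.single (Fin.last m) 1) j)
        (Sum.elim (fun i => inc m (h i)) (fun _ : Unit => ev m G) i)) =
        Matrix.fromBlocks ((Matrix.of fun i j => DD (e j) (h i)).map (inc m)) 0
          (Matrix.of fun (_ : Unit) j => DD (Fin.snoc (α := fun _ => ℝ) (e j) 0) (ev m G))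
          (Matrix.of fun (_ : Unit) (_ : Unit) => ev m (Polynomial.derivative G)) := by
      ext (i | i) (j | j) : 2
      · simp [DD_pull, iniL_snoc]
      · simp [DD_pull, iniL_last, DD_zero_dir]
      · simp
      · exact congrArg Subtype.val (DD_ev G)
    rw [hM, Matrix.det_fromBlocks_zero₁₂]
    intro hcon
    rcases hp.mem_or_mem hcon with h4 | h4
    · apply h2
      rw [Ideal.mem_comap, RingHom.map_det]
      exact h4
    · apply hG'
      simpa using h4
  · intro φ hφ
    obtain ⟨q', r', hqr'⟩ := hd'.div φ
    let B : Polynomial (O m) := ∑ k : Fin d', Polynomial.C (r' k) * Polynomial.X ^ (k : ℕ)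
    have hB : ev m B = ∑ k, inc m (r' k) * tt m ^ (k : ℕ) := by
      simp only [B, map_sum, map_mul, map_pow, ev_X, ev_C]
    rw [← hB] at hqr'
    have hBp : ev m B ∈ p := by
      have : ev m B = φ - q' * ev m P := by rw [hqr']; ring
      rw [this]
      exact p.sub_mem hφ (p.mul_mem_left _ hevPp)
    obtain ⟨δ1, hδ1, m1⟩ := main P hevPp
    obtain ⟨δ2, hδ2, m2⟩ := main B hBp
    refine ⟨δ1 * δ2, fun h => (hp.mem_or_mem h).elim hδ1 hδ2, ?_⟩
    have : δ1 * δ2 * φ = (δ2 * q') * (δ1 * ev m P) + δ1 * (δ2 * ev m B) := by rw [hqr']; ring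
    rw [this]
    exact add_mem (Ideal.mul_mem_left _ _ m1) (Ideal.mul_mem_left _ _ m2)

theorem PSI_all (n : ℕ) : ∀ p : Ideal (O n), p.IsPrime → PSI p := by
  induction n with
  | zero =>
    intro p hp
    by_cases hb : p = ⊥
    · subst hb; exact PSI_bot hp
    · obtain ⟨f, hfI, hf0⟩ := Submodule.exists_mem_ne_zero_of_ne_bot hb
      exact absurd (Ideal.eq_top_of_isUnit_mem p hfI (O_zero_unit f hf0)) hp.ne_top
  | succ m ih =>
    intro p hp
    by_cases hb : p = ⊥
    · subst hb; exact PSI_bot hp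
    · obtain ⟨f, hfI, hf0⟩ := Submodule.exists_mem_ne_zero_of_ne_bot hb
      obtain ⟨A, d, hA⟩ := exists_reg f hf0
      apply PSI_transport A
      refine PS_step ih _ inferInstance (pullE A f) ?_ d hA
      rw [Ideal.mem_comap]
      simpa using hfI

/-- uniform version: one multiplier, divisible by the Jacobian -/
theorem prime_structure {n : ℕ} (p : Ideal (O n)) (hp : p.IsPrime) :
    ∃ (κ : Type) (_ : Fintype κ) (_ : DecidableEq κ) (h : κ → O n) (e : κ → (Fin n → ℝ)) (δ' : O n),
    (∀ i, h i ∈ p) ∧ (Matrix.of fun i j => DD (e j) (h i)).det * δ' ∉ p ∧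
    ∀ φ ∈ p, (Matrix.of fun i j => DD (e j) (h i)).det * δ' * φ ∈ Ideal.span (Set.range h) := by
  obtain ⟨κ, i1, i2, h, e, h1, h2, h3⟩ := PSI_all n p hp
  have key : ∃ δ, δ ∉ p ∧ ∀ φ ∈ p, δ * φ ∈ Ideal.span (Set.range h) := by
    obtain ⟨S, hS⟩ := IsNoetherian.noetherian p
    have : ∀ S : Finset (O n), (S : Set (O n)) ⊆ p → ∃ δ, δ ∉ p ∧ ∀ φ ∈ S, δ * φ ∈ Ideal.span (Set.range h) := by
      classical
      intro S
      induction S using Finset.induction_on with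
      | empty => intro _; exact ⟨_, h2, by simp⟩
      | insert a s _ ih =>
        intro hs
        obtain ⟨δ1, a1, b1⟩ := ih (fun x hx => hs (by simp [Finset.mem_coe.1 hx]))
        obtain ⟨δ2, a2, b2⟩ := h3 a (hs (by simp))
        refine ⟨δ1 * δ2, fun h => (hp.mem_or_mem h).elim a1 a2, ?_⟩
        intro φ hφ
        rcases Finset.mem_insert.1 hφ with rfl | hφ
        · rw [mul_assoc]; exact Ideal.mul_mem_left _ _ b2
        · rw [mul_comm δ1, mul_assoc]; exact Ideal.mul_mem_left _ _ (b1 _ hφ)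
    obtain ⟨δ, a1, b1⟩ := this S (by rw [← hS]; exact Submodule.subset_span)
    refine ⟨δ, a1, fun φ hφ => ?_⟩
    rw [← hS] at hφ
    induction hφ using Submodule.span_induction with
    | mem x hx => exact b1 x hx
    | zero => simp
    | add x y _ _ hx hy => rw [mul_add]; exact add_mem hx hy
    | smul a x _ hx => rw [smul_eq_mul, mul_left_comm]; exact Ideal.mul_mem_left _ _ hx
  obtain ⟨δ', a1, b1⟩ := key
  refine ⟨κ, i1, i2, h, e, δ', h1, fun h => (hp.mem_or_mem h).elim h2 a1, fun φ hφ => ?_⟩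
  rw [mul_assoc]; exact Ideal.mul_mem_left _ _ (b1 _ hφ)

end QDC

namespace QDC
open Filter Topology
open scoped ContDiff
set_option linter.all false

section koszul
variable {R : Type*} [CommRing R] [IsNoetherianRing R] [IsLocalRing R] [Algebra ℝ R]
variable {κ : Type} [Fintype κ] [DecidableEq κ]

theorem koszul_colon (h : κ → R) (hm : ∀ i, h i ∈ IsLocalRing.maximalIdeal R)
    (D : κ → Derivation ℝ R R) (hD : ∀ i j, D j (h i) = if i = j then 1 else 0)
    (s : Finset κ) (k : κ) (hk : k ∉ s) (w : R) (hw : w * h k ∈ Ideal.span (h '' s)) :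
    w ∈ Ideal.span (h '' s) := by
  set J := Ideal.span (h '' s) with hJ
  have hDJ : ∀ x ∈ J, D k x ∈ J := by
    intro x hx
    induction hx using Submodule.span_induction with
    | mem x hx =>
      obtain ⟨i, hi, rfl⟩ := hx
      rw [hD, if_neg (by rintro rfl; exact hk hi)]
      exact zero_mem _
    | zero => rw [map_zero]; exact zero_mem _
    | add x y _ _ hx hy => rw [map_add]; exact add_mem hx hy
    | smul a x hx1 hx =>
      rw [smul_eq_mul, Derivation.leibniz]
      exact add_mem (J.mul_mem_left _ hx) (J.mul_mem_right _ hx1)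
  have claim : ∀ m : ℕ, ∃ v, w - v * h k ^ m ∈ J := by
    intro m
    induction m with
    | zero => exact ⟨w, by simp⟩
    | succ m ih =>
      obtain ⟨v, hv⟩ := ih
      have h1 : v * h k ^ (m + 1) ∈ J := by
        have : v * h k ^ (m + 1) = w * h k - (w - v * h k ^ m) * h k := by ring
        rw [this]; exact sub_mem hw (J.mul_mem_right _ hv)
      have h2 := hDJ _ h1
      rw [Derivation.leibniz, Derivation.leibniz_pow, hD, if_pos rfl] at h2
      simp only [smul_eq_mul, nsmul_eq_mul, Nat.add_sub_cancel, mul_one] at h2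
      set c : R := algebraMap ℝ R ((m + 1 : ℝ)⁻¹) with hc
      have hcc : c * ((m + 1 : ℕ) : R) = 1 := by
        have : ((m + 1 : ℕ) : R) = algebraMap ℝ R (m + 1 : ℝ) := by simp
        rw [this, hc, ← map_mul, inv_mul_cancel₀ (by positivity), map_one]
      refine ⟨- c * D k v, ?_⟩
      have h3 : w - (- c * D k v) * h k ^ (m + 1) = (w - v * h k ^ m) +
          c * (v * (((m + 1 : ℕ) : R) * h k ^ m) + h k ^ (m + 1) * D k v) := by
        have : c * (v * (((m + 1 : ℕ) : R) * h k ^ m) + h k ^ (m + 1) * D k v) =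
          (c * ((m + 1 : ℕ) : R)) * v * h k ^ m + c * D k v * h k ^ (m + 1) := by ring
        rw [this, hcc]; ring
      rw [h3]
      exact add_mem hv (J.mul_mem_left _ h2)
  have kr := Ideal.iInf_pow_smul_eq_bot_of_isLocalRing (M := R ⧸ J) (Ideal.span {h k})
    (by
      intro htop
      have := hm k
      have h4 : IsUnit (h k) := by rwa [Ideal.span_singleton_eq_top] at htop
      exact (IsLocalRing.mem_maximalIdeal _).1 this h4)
  have hmem : Ideal.Quotient.mk J w ∈ (⨅ i : ℕ, Ideal.span {h k} ^ i • ⊤ : Submodule R (R ⧸ J)) := by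
    rw [Submodule.mem_iInf]
    intro m
    obtain ⟨v, hv⟩ := claim m
    have : Ideal.Quotient.mk J w = (h k ^ m) • Ideal.Quotient.mk J v := by
      rw [← sub_eq_zero, Algebra.smul_def]
      have h5 := Ideal.Quotient.eq_zero_iff_mem.2 hv
      rw [map_sub, map_mul] at h5
      rw [mul_comm]
      exact h5
    rw [this]
    refine Submodule.smul_mem_smul ?_ trivial
    exact Ideal.pow_mem_pow (Ideal.mem_span_singleton_self _) m
  rw [kr, Submodule.mem_bot] at hmem
  exact Ideal.Quotient.eq_zero_iff_mem.1 hmem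

theorem mem_span_image_finset {R : Type*} [CommRing R] {κ : Type} [DecidableEq κ] (h : κ → R) (s : Finset κ) (x : R)
    (hx : x ∈ Ideal.span (h '' s)) : ∃ z : κ → R, x = ∑ i ∈ s, z i * h i := by
  induction hx using Submodule.span_induction with
  | mem x hx =>
    obtain ⟨i, hi, rfl⟩ := hx
    refine ⟨fun j => if j = i then 1 else 0, ?_⟩
    have hi' : i ∈ s := hi
    simp [ite_mul, hi']
  | zero => exact ⟨0, by simp⟩
  | add x y _ _ hx hy =>
    obtain ⟨z1, rfl⟩ := hx
    obtain ⟨z2, rfl⟩ := hy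
    exact ⟨z1 + z2, by simp [add_mul, Finset.sum_add_distrib]⟩
  | smul a x _ hx =>
    obtain ⟨z, rfl⟩ := hx
    exact ⟨fun i => a * z i, by simp [Finset.mul_sum, mul_assoc]⟩

theorem koszul_rel (h : κ → R) (hm : ∀ i, h i ∈ IsLocalRing.maximalIdeal R)
    (D : κ → Derivation ℝ R R) (hD : ∀ i j, D j (h i) = if i = j then 1 else 0)
    (s : Finset κ) : ∀ w : κ → R, ∑ i ∈ s, w i * h i = 0 →
      ∃ y : κ → κ → R, ∀ i ∈ s, w i = ∑ k ∈ s, (y k i - y i k) * h k := by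
  induction s using Finset.induction_on with
  | empty => intro w _; exact ⟨0, by simp⟩
  | insert k s hk ih =>
    intro w hw
    rw [Finset.sum_insert hk] at hw
    have h1 : w k * h k ∈ Ideal.span (h '' s) := by
      rw [eq_neg_of_add_eq_zero_left hw]
      refine neg_mem (sum_mem fun i hi => Ideal.mul_mem_left _ _ (Ideal.subset_span ⟨i, hi, rfl⟩))
    obtain ⟨z, hz⟩ := mem_span_image_finset h s _ (koszul_colon h hm D hD s k hk _ h1)
    obtain ⟨y, hy⟩ := ih (fun i => w i + z i * h k) (by
      simp only [add_mul, Finset.sum_add_distrib]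
      rw [hz, Finset.sum_mul] at hw
      rw [← hw, add_comm]
      congr 1
      exact Finset.sum_congr rfl fun i _ => by ring)
    have hne : ∀ i ∈ s, i ≠ k := fun i hi h => hk (h ▸ hi)
    refine ⟨fun a b => if b = k then (if a = k then 0 else z a) else if a = k then 0 else y a b, ?_⟩
    intro i hi
    rw [Finset.sum_insert hk]
    rcases Finset.mem_insert.1 hi with rfl | hi
    · simp only [if_true, sub_self, zero_mul, zero_add]
      rw [hz]
      refine Finset.sum_congr rfl fun j hj => ?_
      simp [hne j hj]
    · have h2 := hy i hi
      have h3 : ∑ x ∈ s, ((if i = k then if x = k then 0 else z x else if x = k then 0 else y x i) -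
          if x = k then if i = k then 0 else z i else if i = k then 0 else y i x) * h x = ∑ x ∈ s, (y x i - y i x) * h x := by
        refine Finset.sum_congr rfl fun j hj => ?_
        simp [hne j hj, hne i hi]
      rw [h3, ← h2]
      simp [hne i hi]

theorem koszul_full (h : κ → R) (D : κ → Derivation ℝ R R)
    (hdet : IsUnit (Matrix.of fun i j => D j (h i)).det)
    (w : κ → R) (hw : ∑ i, w i * h i = 0) :
      ∃ y : κ → κ → R, ∀ i, w i = ∑ k, (y k i - y i k) * h k := by
  by_cases hu : ∃ i, IsUnit (h i)
  · obtain ⟨i0, hi0⟩ := hu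
    obtain ⟨g, hg⟩ := hi0.exists_right_inv
    refine ⟨fun a b => if a = i0 then w b * g else 0, fun i => ?_⟩
    simp only [sub_mul, Finset.sum_sub_distrib, ite_mul, zero_mul, Finset.sum_ite_eq', Finset.mem_univ, if_true]
    by_cases hi : i = i0
    · simp only [hi, if_true]
      have : ∑ x, w x * g * h x = 0 := by
        rw [← zero_mul g, ← hw, Finset.sum_mul]
        exact Finset.sum_congr rfl fun j _ => by ring
      rw [this, sub_zero, mul_assoc, mul_comm g, hg, mul_one]
    · simp only [hi, if_false]
      rw [Finset.sum_const_zero, sub_zero, mul_assoc, mul_comm g, hg, mul_one]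
  · push Not at hu
    set M := (Matrix.of fun i j => D j (h i)) with hM
    have hMB : M * M⁻¹ = 1 := Matrix.mul_nonsing_inv M hdet
    have hsum : ∀ (j : κ) (x : R), (∑ l, M⁻¹ l j • D l) x = ∑ l, M⁻¹ l j * D l x := by
      intro j x
      have := map_sum (Derivation.coeFnAddMonoidHom (R := ℝ) (A := R) (M := R)) (fun l => M⁻¹ l j • D l) Finset.univ
      have h2 := congrFun this x
      exact h2.trans (Finset.sum_apply _ _ _)
    obtain ⟨y, hy⟩ := koszul_rel h (fun i => (IsLocalRing.mem_maximalIdeal _).2 (hu i)) (fun j => ∑ l, M⁻¹ l j • D l)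
      (by
        intro i j
        rw [hsum]
        have := congrFun (congrFun hMB i) j
        rw [Matrix.mul_apply, Matrix.one_apply] at this
        rw [← this]
        refine Finset.sum_congr rfl fun l _ => ?_
        simp [hM, mul_comm])
      Finset.univ w hw
    exact ⟨y, fun i => hy i (Finset.mem_univ i)⟩
end koszul

/-- Taylor expansion as hom to germs -/
noncomputable def Theta (n : ℕ) : O n →+* Germ (𝓝 (0 : Fin n → ℝ)) (MvPowerSeries (Fin n) ℝ) where
  toFun φ := ((fun a => TT a φ : (Fin n → ℝ) → MvPowerSeries (Fin n) ℝ) : Germ (𝓝 (0 : Fin n → ℝ)) (MvPowerSeries (Fin n) ℝ))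
  map_zero' := Germ.coe_eq.2 TT_zero
  map_one' := Germ.coe_eq.2 TT_one
  map_add' φ ψ := Germ.coe_eq.2 (TT_add φ ψ)
  map_mul' φ ψ := Germ.coe_eq.2 (TT_mul φ ψ)

theorem TT_det {n : ℕ} {κ : Type} [Fintype κ] [DecidableEq κ] (M : Matrix κ κ (O n)) :
    ∀ᶠ a in 𝓝 0, TT a M.det = (Matrix.of fun i j => TT a (M i j)).det := by
  let N : Matrix κ κ ((Fin n → ℝ) → MvPowerSeries (Fin n) ℝ) := Matrix.of fun i j a => TT a (M i j)
  have h1 : Theta n M.det = (N.det : (Fin n → ℝ) → MvPowerSeries (Fin n) ℝ) := by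
    rw [RingHom.map_det]
    exact (RingHom.map_det (Germ.coeRingHom (R := MvPowerSeries (Fin n) ℝ) (𝓝 (0 : Fin n → ℝ))) N).symm
  have h2 : ∀ᶠ a in 𝓝 0, TT a M.det = N.det a := Germ.coe_eq.1 h1
  filter_upwards [h2] with a ha
  rw [ha]
  exact RingHom.map_det (Pi.evalRingHom (fun _ => MvPowerSeries (Fin n) ℝ) a) N

theorem TT_dot {n : ℕ} {ι : Type*} [Fintype ι] (x y : ι → O n) :
    ∀ᶠ a in 𝓝 0, TT a (∑ j, x j * y j) = ∑ j, TT a (x j) * TT a (y j) := by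
  have h : ∀ᶠ a in 𝓝 0, ∀ j, TT a (x j * y j) = TT a (x j) * TT a (y j) :=
    eventually_all.2 fun j => TT_mul _ _
  filter_upwards [TT_sum Finset.univ (fun j => x j * y j), h] with a h1 h2
  rw [h1]; exact Finset.sum_congr rfl fun j _ => h2 j

theorem TT_sub {n : ℕ} (φ ψ : O n) : ∀ᶠ a in 𝓝 0, TT a (φ - ψ) = TT a φ - TT a ψ := by
  rw [sub_eq_add_neg]
  filter_upwards [TT_add φ (-ψ), TT_neg ψ] with a h1 h2
  rw [h1, h2, sub_eq_add_neg]
end QDC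

namespace QDC
open Filter Topology
open scoped ContDiff
set_option linter.all false

/-- relations are generated by analytic relations at all nearby points -/
def RelGood {n : ℕ} {ι : Type} [Fintype ι] (f : ι → O n) : Prop :=
  ∃ (κ : Type) (_ : Fintype κ) (c : κ → ι → O n), (∀ k, ∑ j, c k j * f j = 0) ∧
    ∀ᶠ a in 𝓝 0, ∀ u : ι → MvPowerSeries (Fin n) ℝ, ∑ j, u j * TT a (f j) = 0 →
      ∃ v : κ → MvPowerSeries (Fin n) ℝ, ∀ j, u j = ∑ k, v k * TT a (c k j)

theorem relGood_top {n : ℕ} {ι : Type} [Fintype ι] (f : ι → O n) (h : Ideal.span (Set.range f) = ⊤) : RelGood f := by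
  classical
  obtain ⟨x, hx⟩ := Ideal.mem_span_range_iff_exists_fun.1 (show (1 : O n) ∈ Ideal.span (Set.range f) by rw [h]; trivial)
  refine ⟨ι, inferInstance, fun l j => (if l = j then 1 else 0) - f l * x j, ?_, ?_⟩
  · intro l
    simp only [sub_mul, Finset.sum_sub_distrib, ite_mul, one_mul, zero_mul, Finset.sum_ite_eq, Finset.mem_univ, if_true,
      mul_assoc, ← Finset.mul_sum, hx, mul_one, sub_self]
  · have e1 : ∀ᶠ a in 𝓝 0, ∀ l j, TT a ((if l = j then 1 else 0) - f l * x j) = (if l = j then 1 else 0) - TT a (f l) * TT a (x j) := by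
      rw [eventually_all]; intro l; rw [eventually_all]; intro j
      filter_upwards [TT_sub (if l = j then 1 else 0) (f l * x j), TT_mul (f l) (x j), TT_one (n := n), TT_zero (n := n)] with a a1 a2 a3 a4
      rw [a1, a2]
      split_ifs <;> simp [a3, a4]
    filter_upwards [e1] with a a1 u hu
    refine ⟨u, fun j => ?_⟩
    simp only [a1, mul_sub, Finset.sum_sub_distrib, mul_ite, mul_one, mul_zero, Finset.sum_ite_eq', Finset.mem_univ, if_true]
    have : ∑ l, u l * (TT a (f l) * TT a (x j)) = (∑ l, u l * TT a (f l)) * TT a (x j) := by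
      rw [Finset.sum_mul]; exact Finset.sum_congr rfl fun l _ => by ring
    rw [this, hu, zero_mul, sub_zero]

theorem span_option {n : ℕ} {ι : Type} (f : ι → O n) (a : O n) :
    Ideal.span (Set.range (fun o : Option ι => o.elim a f)) = Ideal.span (Set.range f) ⊔ Ideal.span {a} := by
  rw [← Ideal.span_union]
  congr 1
  ext x
  simp only [Set.mem_range, Set.mem_union, Set.mem_singleton_iff, Option.exists, Option.elim_none, Option.elim_some]
  constructor
  · rintro (h | h)
    · exact Or.inr h.symm
    · exact Or.inl h
  · rintro (h | h)
    · exact Or.inr h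
    · exact Or.inl h.symm

/-- colon ideal -/
def colonI {n : ℕ} (I : Ideal (O n)) (a : O n) : Ideal (O n) := Submodule.comap (LinearMap.mulLeft (O n) a) I

theorem mem_colonI {n : ℕ} (I : Ideal (O n)) (a x : O n) : x ∈ colonI I a ↔ a * x ∈ I := Iff.rfl

theorem sum_swap3 {R : Type*} [CommRing R] {α β : Type*} [Fintype α] [Fintype β] (y : α → R) (s : α → β → R) (b : β → R) :
    ∑ k, y k * ∑ l, s k l * b l = ∑ l, (∑ k, y k * s k l) * b l := by
  simp only [Finset.mul_sum, Finset.sum_mul]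
  rw [Finset.sum_comm]
  exact Finset.sum_congr rfl fun _ _ => Finset.sum_congr rfl fun _ _ => by ring

theorem relGood_nonprime {n : ℕ} {ι : Type} [Fintype ι] (f : ι → O n) (a : O n) {r : ℕ} (g : Fin r → O n)
    (hg : Ideal.span (Set.range g) = colonI (Ideal.span (Set.range f)) a)
    (h1 : RelGood (fun o : Option ι => o.elim a f)) (h2 : RelGood g) : RelGood f := by
  obtain ⟨κ1, i1, c1, r1, e1⟩ := h1
  obtain ⟨κ2, i2, s, r2, e2⟩ := h2
  have hε : ∀ k, ∃ ε : Fin r → O n, ∑ l, ε l * g l = c1 k none := by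
    intro k
    apply Ideal.mem_span_range_iff_exists_fun.1
    rw [hg, mem_colonI]
    have := r1 k
    rw [Fintype.sum_option] at this
    simp only [Option.elim_none, Option.elim_some] at this
    rw [mul_comm, eq_neg_of_add_eq_zero_left this]
    exact neg_mem (sum_mem fun j _ => Ideal.mul_mem_left _ _ (Ideal.subset_span ⟨j, rfl⟩))
  have hb : ∀ l, ∃ b : ι → O n, ∑ j, b j * f j = a * g l := by
    intro l
    apply Ideal.mem_span_range_iff_exists_fun.1
    rw [← mem_colonI, ← hg]
    exact Ideal.subset_span ⟨l, rfl⟩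
  choose ε hε using hε
  choose b hb using hb
  refine ⟨κ1 ⊕ κ2, inferInstance, Sum.elim (fun k j => c1 k (some j) + ∑ l, ε k l * b l j) (fun m j => ∑ l, s m l * b l j), ?_, ?_⟩
  · rintro (k | m)
    · have := r1 k
      rw [Fintype.sum_option] at this
      simp only [Option.elim_none, Option.elim_some] at this
      simp only [Sum.elim_inl, add_mul, Finset.sum_add_distrib]
      rw [← sum_swap3]
      simp only [hb]
      have h3 : ∑ l, ε k l * (a * g l) = c1 k none * a := by
        rw [← hε k, Finset.sum_mul]; exact Finset.sum_congr rfl fun _ _ => by ring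
      rw [h3, ← this]; ring
    · simp only [Sum.elim_inr]
      rw [← sum_swap3]
      simp only [hb]
      have h3 : ∑ l, s m l * (a * g l) = (∑ l, s m l * g l) * a := by
        rw [Finset.sum_mul]; exact Finset.sum_congr rfl fun _ _ => by ring
      rw [h3, r2, zero_mul]
  · have t1 : ∀ᶠ x in 𝓝 0, ∀ k j, TT x (c1 k (some j) + ∑ l, ε k l * b l j) = TT x (c1 k (some j)) + ∑ l, TT x (ε k l) * TT x (b l j) := by
      rw [eventually_all]; intro k; rw [eventually_all]; intro j
      filter_upwards [TT_add (c1 k (some j)) (∑ l, ε k l * b l j), TT_dot (fun l => ε k l) (fun l => b l j)] with x x1 x2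
      rw [x1, x2]
    have t2 : ∀ᶠ x in 𝓝 0, ∀ m j, TT x (∑ l, s m l * b l j) = ∑ l, TT x (s m l) * TT x (b l j) := by
      rw [eventually_all]; intro k; rw [eventually_all]; intro j
      exact TT_dot (fun l => s k l) (fun l => b l j)
    have t3 : ∀ᶠ x in 𝓝 0, ∀ k, TT x (c1 k none) = ∑ l, TT x (ε k l) * TT x (g l) := by
      rw [eventually_all]; intro k; rw [← hε k]
      exact TT_dot (fun l => ε k l) g
    filter_upwards [e1, e2, t1, t2, t3] with x x1 x2 x3 x4 x5 u hu
    obtain ⟨v, hv⟩ := x1 (fun o => o.elim 0 u) (by rw [Fintype.sum_option]; simpa using hu)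
    have hv0 : (0 : MvPowerSeries (Fin n) ℝ) = ∑ k, v k * TT x (c1 k none) := hv none
    have hvj : ∀ j, u j = ∑ k, v k * TT x (c1 k (some j)) := fun j => hv (some j)
    obtain ⟨z, hz⟩ := x2 (fun l => ∑ k, v k * TT x (ε k l)) (by
      rw [← sum_swap3, hv0]
      simp only [x5])
    refine ⟨Sum.elim v (fun m => - z m), fun j => ?_⟩
    rw [Fintype.sum_sum_type]
    simp only [Sum.elim_inl, Sum.elim_inr, x3, x4, mul_add, Finset.sum_add_distrib, neg_mul, Finset.sum_neg_distrib]
    rw [sum_swap3, sum_swap3, ← hvj j]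
    simp only [← hz]
    ring

theorem relGood_prime {n : ℕ} {ι : Type} [Fintype ι] (f : ι → O n) (hp : (Ideal.span (Set.range f)).IsPrime)
    (IH : ∀ δ ∉ Ideal.span (Set.range f), RelGood (fun o : Option ι => o.elim δ f)) : RelGood f := by
  classical
  obtain ⟨κ, i1, i2, h, e, δ', h1, h2, h3⟩ := prime_structure _ hp
  set θ := (Matrix.of fun i j => DD (e j) (h i)).det with hθ
  set δ := θ * δ' with hδ
  obtain ⟨κ1, i3, c1, r1, e1⟩ := IH δ h2
  have hε : ∀ k, ∃ ε : ι → O n, ∑ l, ε l * f l = c1 k none := by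
    intro k
    apply Ideal.mem_span_range_iff_exists_fun.1
    have := r1 k
    rw [Fintype.sum_option] at this
    simp only [Option.elim_none, Option.elim_some] at this
    refine (hp.mem_or_mem (y := δ) ?_).resolve_right h2
    rw [eq_neg_of_add_eq_zero_left this]
    exact neg_mem (sum_mem fun j _ => Ideal.mul_mem_left _ _ (Ideal.subset_span ⟨j, rfl⟩))
  have hb : ∀ l, ∃ b : κ → O n, ∑ i, b i * h i = δ * f l := by
    intro l
    apply Ideal.mem_span_range_iff_exists_fun.1
    exact h3 _ (Ideal.subset_span ⟨l, rfl⟩)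
  have hE : ∀ i, ∃ E : ι → O n, ∑ j, E j * f j = h i := fun i => Ideal.mem_span_range_iff_exists_fun.1 (h1 i)
  choose ε hε using hε
  choose b hb using hb
  choose E hE using hE
  refine ⟨κ1 ⊕ (ι ⊕ (κ × κ)), inferInstance, Sum.elim (fun k j => c1 k (some j) + δ * ε k j)
    (Sum.elim (fun l j => (if l = j then δ else 0) - ∑ i, b l i * E i j) (fun ki j => h ki.1 * E ki.2 j - h ki.2 * E ki.1 j)), ?_, ?_⟩
  · rintro (k | l | ki)
    · have := r1 k
      rw [Fintype.sum_option] at this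
      simp only [Option.elim_none, Option.elim_some] at this
      simp only [Sum.elim_inl, add_mul, Finset.sum_add_distrib, mul_assoc, ← Finset.mul_sum, hε]
      rw [← this]; ring
    · simp only [Sum.elim_inl, Sum.elim_inr, sub_mul, Finset.sum_sub_distrib, ite_mul, zero_mul, Finset.sum_ite_eq, Finset.mem_univ, if_true]
      rw [← sum_swap3]
      simp only [hE, hb, sub_self]
    · simp only [Sum.elim_inr, sub_mul, Finset.sum_sub_distrib, mul_assoc, ← Finset.mul_sum, hE]
      ring
  · have t1 : ∀ᶠ x in 𝓝 0, ∀ k j, TT x (c1 k (some j) + δ * ε k j) = TT x (c1 k (some j)) + TT x δ * TT x (ε k j) := by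
      rw [eventually_all]; intro k; rw [eventually_all]; intro j
      filter_upwards [TT_add (c1 k (some j)) (δ * ε k j), TT_mul δ (ε k j)] with x x1 x2
      rw [x1, x2]
    have t2 : ∀ᶠ x in 𝓝 0, ∀ l j, TT x ((if l = j then δ else 0) - ∑ i, b l i * E i j) =
        (if l = j then TT x δ else 0) - ∑ i, TT x (b l i) * TT x (E i j) := by
      rw [eventually_all]; intro l; rw [eventually_all]; intro j
      filter_upwards [TT_sub (if l = j then δ else 0) (∑ i, b l i * E i j), TT_dot (fun i => b l i) (fun i => E i j), TT_zero (n := n)] with x x1 x2 x3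
      rw [x1, x2]
      split_ifs <;> simp [x3]
    have t3 : ∀ᶠ x in 𝓝 0, ∀ k, TT x (c1 k none) = ∑ l, TT x (ε k l) * TT x (f l) := by
      rw [eventually_all]; intro k; rw [← hε k]
      exact TT_dot (fun l => ε k l) f
    have t4 : ∀ᶠ x in 𝓝 0, ∀ (k i : κ) j, TT x (h k * E i j - h i * E k j) =
        TT x (h k) * TT x (E i j) - TT x (h i) * TT x (E k j) := by
      rw [eventually_all]; intro k; rw [eventually_all]; intro i; rw [eventually_all]; intro j
      filter_upwards [TT_sub (h k * E i j) (h i * E k j), TT_mul (h k) (E i j), TT_mul (h i) (E k j)] with x x1 x2 x3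
      rw [x1, x2, x3]
    have t5 : ∀ᶠ x in 𝓝 0, ∀ l, TT x δ * TT x (f l) = ∑ i, TT x (b l i) * TT x (h i) := by
      rw [eventually_all]; intro l
      filter_upwards [TT_mul δ (f l), TT_dot (fun i => b l i) h] with x x1 x2
      rw [← x1, ← hb l, x2]
    have t6 : ∀ᶠ x in 𝓝 0, ∀ i j, TT x (DD (e j) (h i)) = ∑ l, MvPowerSeries.C (e j l) * MvPowerSeries.pderiv ℝ l (TT x (h i)) := by
      rw [eventually_all]; intro i; rw [eventually_all]; intro j
      exact TT_DD (e j) (h i)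
    filter_upwards [e1, t1, t2, t3, t4, t5, t6, TT_mul θ δ', TT_det (Matrix.of fun i j => DD (e j) (h i))] with x x1 x2 x3 x4 x5 x6 x7 x8 x9 u hu
    by_cases hun : IsUnit (TT x δ)
    · have hun' : IsUnit (TT x θ) := by
        rw [hδ, x8] at hun
        exact isUnit_of_mul_isUnit_left hun
      obtain ⟨y, hy⟩ := koszul_full (fun i => TT x (h i)) (fun j => ∑ l, (MvPowerSeries.C (e j l) : MvPowerSeries (Fin n) ℝ) • MvPowerSeries.pderiv ℝ l)
        (by
          have hsum : ∀ (j : κ) (z : MvPowerSeries (Fin n) ℝ), (∑ l, (MvPowerSeries.C (e j l) : MvPowerSeries (Fin n) ℝ) • MvPowerSeries.pderiv ℝ l) z =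
              ∑ l, MvPowerSeries.C (e j l) * MvPowerSeries.pderiv ℝ l z := by
            intro j z
            have := map_sum (Derivation.coeFnAddMonoidHom (R := ℝ) (A := MvPowerSeries (Fin n) ℝ) (M := MvPowerSeries (Fin n) ℝ)) (fun l => (MvPowerSeries.C (e j l) : MvPowerSeries (Fin n) ℝ) • MvPowerSeries.pderiv ℝ l) Finset.univ
            have h2 := congrFun this z
            exact h2.trans (Finset.sum_apply _ _ _)
          rw [hθ, x9] at hun'
          convert hun' using 3
          funext i j
          simp only [Matrix.of_apply]
          rw [hsum, x7])
        (fun i => ∑ l, u l * TT x (b l i)) (by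
          rw [← sum_swap3]
          simp only [← x6]
          have : ∑ l, u l * (TT x δ * TT x (f l)) = (∑ l, u l * TT x (f l)) * TT x δ := by
            rw [Finset.sum_mul]; exact Finset.sum_congr rfl fun _ _ => by ring
          rw [this, hu, zero_mul])
      obtain ⟨g, hg⟩ := hun.exists_right_inv
      refine ⟨Sum.elim 0 (Sum.elim (fun l => g * u l) (fun ki => g * y ki.1 ki.2)), fun j => ?_⟩
      rw [Fintype.sum_sum_type, Fintype.sum_sum_type, Fintype.sum_prod_type]
      simp only [Sum.elim_inl, Sum.elim_inr, Pi.zero_apply, zero_mul, Finset.sum_const_zero, zero_add, x3, x5, mul_sub, Finset.sum_sub_distrib,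
        mul_ite, mul_zero, Finset.sum_ite_eq', Finset.mem_univ, if_true]
      have s1 : ∑ l, g * u l * ∑ i, TT x (b l i) * TT x (E i j) = g * ∑ i, (∑ l, u l * TT x (b l i)) * TT x (E i j) := by
        rw [← sum_swap3, Finset.mul_sum]; exact Finset.sum_congr rfl fun _ _ => by ring
      have s2 : ∑ i, (∑ l, u l * TT x (b l i)) * TT x (E i j) =
          ∑ i, ∑ k, (y k i * (TT x (h k) * TT x (E i j)) - y i k * (TT x (h k) * TT x (E i j))) := by
        refine Finset.sum_congr rfl fun i _ => ?_
        rw [hy i, Finset.sum_mul]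
        exact Finset.sum_congr rfl fun _ _ => by ring
      simp only [Finset.sum_sub_distrib] at s2
      have s3 : ∑ k, ∑ i, g * y k i * (TT x (h k) * TT x (E i j)) = g * ∑ i, ∑ k, y k i * (TT x (h k) * TT x (E i j)) := by
        rw [Finset.sum_comm, Finset.mul_sum]
        refine Finset.sum_congr rfl fun i _ => ?_
        rw [Finset.mul_sum]; exact Finset.sum_congr rfl fun _ _ => by ring
      have s4 : ∑ k, ∑ i, g * y k i * (TT x (h i) * TT x (E k j)) = g * ∑ i, ∑ k, y i k * (TT x (h k) * TT x (E i j)) := by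
        rw [Finset.mul_sum]
        refine Finset.sum_congr rfl fun i _ => ?_
        rw [Finset.mul_sum]; exact Finset.sum_congr rfl fun _ _ => by ring
      rw [s1, s2, s3, s4]
      have : u j = g * u j * TT x δ := by
        rw [mul_comm g, mul_assoc, mul_comm g, hg, mul_one]
      linear_combination this
    · let Rel : Submodule (MvPowerSeries (Fin n) ℝ) (ι → MvPowerSeries (Fin n) ℝ) :=
        { carrier := {u | ∑ j, u j * TT x (f j) = 0}
          add_mem' := fun {a b} ha hb => by
            simp only [Set.mem_setOf_eq, Pi.add_apply, add_mul, Finset.sum_add_distrib] at *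
            rw [ha, hb, add_zero]
          zero_mem' := by simp
          smul_mem' := fun c z hz => by
            simp only [Set.mem_setOf_eq, Pi.smul_apply, smul_eq_mul, mul_assoc, ← Finset.mul_sum] at *
            rw [hz, mul_zero] }
      let Cc : κ1 → ι → MvPowerSeries (Fin n) ℝ := fun k j => TT x (c1 k (some j)) + TT x δ * TT x (ε k j)
      have hle : Rel ≤ Submodule.span _ (Set.range Cc) ⊔ (Ideal.span {TT x δ}) • Rel := by
        intro u hu
        have hu1 : ∑ j, u j * TT x (f j) = 0 := hu
        obtain ⟨v, hv⟩ := x1 (fun o => o.elim 0 u) (by rw [Fintype.sum_option]; simpa using hu1)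
        have hv0 : (0 : MvPowerSeries (Fin n) ℝ) = ∑ k, v k * TT x (c1 k none) := hv none
        have hvj : ∀ j, u j = ∑ k, v k * TT x (c1 k (some j)) := fun j => hv (some j)
        have hu' : (fun j => ∑ k, v k * TT x (ε k j)) ∈ Rel := by
          show ∑ j, (∑ k, v k * TT x (ε k j)) * TT x (f j) = 0
          rw [← sum_swap3, hv0]
          simp only [x4]
        have : u = ∑ k, v k • Cc k + TT x δ • (- fun j => ∑ k, v k * TT x (ε k j)) := by
          funext j
          simp only [Pi.add_apply, Finset.sum_apply, Pi.smul_apply, smul_eq_mul, Pi.neg_apply, Cc, mul_add, Finset.sum_add_distrib]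
          rw [← hvj j, mul_neg, Finset.mul_sum]
          have : ∑ k, v k * (TT x δ * TT x (ε k j)) = ∑ k, TT x δ * (v k * TT x (ε k j)) :=
            Finset.sum_congr rfl fun _ _ => by ring
          rw [this]; ring
        rw [this]
        refine Submodule.add_mem_sup (sum_mem fun k _ => Submodule.smul_mem _ _ (Submodule.subset_span ⟨k, rfl⟩)) ?_
        exact Submodule.smul_mem_smul (Ideal.mem_span_singleton_self _) (neg_mem hu')
      have hnak := Submodule.le_of_le_smul_of_le_jacobson_bot (IsNoetherian.noetherian Rel) (by
        rw [IsLocalRing.jacobson_eq_maximalIdeal ⊥ bot_ne_top, Ideal.span_singleton_le_iff_mem]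
        exact (IsLocalRing.mem_maximalIdeal _).2 hun) hle
      have hmem := hnak (show u ∈ Rel from hu)
      rw [Submodule.mem_span_range_iff_exists_fun] at hmem
      obtain ⟨v, hv⟩ := hmem
      refine ⟨Sum.elim v 0, fun j => ?_⟩
      rw [Fintype.sum_sum_type]
      simp only [Sum.elim_inl, Sum.elim_inr, Pi.zero_apply, zero_mul, Finset.sum_const_zero, add_zero, x2]
      rw [← hv]
      simp [Cc]

/-- Noetherian induction scheme for ideals -/
theorem ideal_induction {n : ℕ} (P : ∀ (ι : Type) [Fintype ι], (ι → O n) → Prop)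
    (htop : ∀ (ι : Type) [Fintype ι] (f : ι → O n), Ideal.span (Set.range f) = ⊤ → P ι f)
    (hnon : ∀ (ι : Type) [Fintype ι] (f : ι → O n) (a : O n) (r : ℕ) (g : Fin r → O n),
      Ideal.span (Set.range g) = colonI (Ideal.span (Set.range f)) a →
      P (Option ι) (fun o : Option ι => o.elim a f) → P (Fin r) g → P ι f)
    (hprime : ∀ (ι : Type) [Fintype ι] (f : ι → O n), (Ideal.span (Set.range f)).IsPrime →
      (∀ δ ∉ Ideal.span (Set.range f), P (Option ι) (fun o : Option ι => o.elim δ f)) → P ι f)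
    (ι : Type) [i : Fintype ι] (f : ι → O n) : P ι f := by
  have key : ∀ I : Ideal (O n), ∀ (ι : Type) [Fintype ι] (f : ι → O n), Ideal.span (Set.range f) = I → P ι f := by
    intro I
    refine IsNoetherian.induction (R := O n) (M := O n) (P := fun I => ∀ (ι : Type) [Fintype ι] (f : ι → O n), Ideal.span (Set.range f) = I → P ι f) ?_ I
    · intro I IH
      change Ideal (O n) at I
      intro ι _ f hf
      have hsup : ∀ a ∉ I, P (Option ι) (fun o : Option ι => o.elim a f) := by
        intro a ha
        refine IH (I ⊔ Ideal.span {a}) ?_ (Option ι) _ (by rw [span_option, hf])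
        refine lt_of_le_of_ne le_sup_left fun h => ha ?_
        rw [h]
        exact Ideal.mem_sup_right (Ideal.mem_span_singleton_self a)
      by_cases ht : I = ⊤
      · exact htop ι f (hf.trans ht)
      by_cases hp : I.IsPrime
      · exact hprime ι f (hf ▸ hp) (by rw [hf]; exact hsup)
      · have : ∃ a b, a * b ∈ I ∧ a ∉ I ∧ b ∉ I := by
          by_contra hcon
          push Not at hcon
          apply hp
          refine ⟨ht, fun {x y} hxy => ?_⟩
          by_cases hx : x ∈ I
          · exact Or.inl hx
          · exact Or.inr (hcon x y hxy hx)
        obtain ⟨a, b, hab, ha, hb⟩ := this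
        obtain ⟨r, g, hg⟩ := Submodule.fg_iff_exists_fin_generating_family.1 (IsNoetherian.noetherian (colonI I a))
        refine hnon ι f a r g (by rw [hf]; exact hg) (hsup a ha) (IH (colonI I a) ?_ (Fin r) g hg)
        refine lt_of_le_of_ne (fun x hx => I.mul_mem_left _ hx) fun h => hb ?_
        rw [h]; exact hab
  exact key _ ι f rfl

theorem relGood_all {n : ℕ} {ι : Type} [Fintype ι] (f : ι → O n) : RelGood f :=
  ideal_induction (fun ι _ f => RelGood f) (fun ι _ f h => relGood_top f h)
    (fun ι _ f a r g hg h1 h2 => relGood_nonprime f a g hg h1 h2)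
    (fun ι _ f hp IH => relGood_prime f hp IH) ι f
end QDC

namespace QDC
open Filter Topology
open scoped ContDiff
set_option linter.all false

section Param
variable {E : Type} [NormedAddCommGroup E] [NormedSpace ℝ E] [FiniteDimensional ℝ E]

theorem param_hasFDerivAt {F : Type} [NormedAddCommGroup F] [NormedSpace ℝ F] [CompleteSpace F]
    (ψ : E × ℝ → F) (h : ContDiff ℝ 1 ψ) (x₀ : E) :
    HasFDerivAt (fun x => ∫ u in (0:ℝ)..1, ψ (x, u))
      (∫ u in (0:ℝ)..1, (fderiv ℝ ψ (x₀, u)).comp (ContinuousLinearMap.inl ℝ E ℝ)) x₀ := by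
  haveI : ProperSpace E := FiniteDimensional.proper ℝ E
  have hcf : Continuous (fderiv ℝ ψ) := h.continuous_fderiv (by norm_num)
  have hc : Continuous (fun p : E × ℝ => (fderiv ℝ ψ p).comp (ContinuousLinearMap.inl ℝ E ℝ)) :=
    hcf.clm_comp continuous_const
  obtain ⟨C, hC⟩ := ((isCompact_closedBall x₀ 1).prod (isCompact_Icc (a := (0:ℝ)) (b := 1))).exists_bound_of_continuousOn
    hc.continuousOn
  refine intervalIntegral.hasFDerivAt_integral_of_dominated_of_fderiv_le (𝕜 := ℝ)
    (F := fun x u => ψ (x, u))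
    (F' := fun x u => (fderiv ℝ ψ (x, u)).comp (ContinuousLinearMap.inl ℝ E ℝ))
    (bound := fun _ => C) (Metric.closedBall_mem_nhds x₀ one_pos) ?_ ?_ ?_ ?_ ?_ ?_
  · refine Eventually.of_forall fun x => ?_
    exact (h.continuous.comp (by fun_prop : Continuous fun u : ℝ => (x, u))).aestronglyMeasurable
  · exact (h.continuous.comp (by fun_prop : Continuous fun u : ℝ => (x₀, u))).intervalIntegrable _ _
  · exact (hc.comp (by fun_prop : Continuous fun u : ℝ => (x₀, u))).aestronglyMeasurable
  · refine Eventually.of_forall fun t ht x hx => ?_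
    rw [Set.uIoc_of_le zero_le_one] at ht
    exact hC (x, t) ⟨hx, ht.1.le, ht.2⟩
  · exact intervalIntegrable_const
  · refine Eventually.of_forall fun t ht x hx => ?_
    have h1 : HasFDerivAt ψ (fderiv ℝ ψ (x, t)) (x, t) :=
      ((h.differentiable (by norm_num)) (x, t)).hasFDerivAt
    exact HasFDerivAt.comp x h1 (hasFDerivAt_prodMk_left x t)

theorem param_contDiff_nat (k : ℕ) : ∀ {F : Type} [NormedAddCommGroup F] [NormedSpace ℝ F]
    [CompleteSpace F] (ψ : E × ℝ → F) (h : ContDiff ℝ ∞ ψ),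
    ContDiff ℝ k (fun x => ∫ u in (0:ℝ)..1, ψ (x, u)) := by
  induction k with
  | zero =>
    intro F _ _ _ ψ h
    rw [Nat.cast_zero, contDiff_zero]
    have : Differentiable ℝ (fun x => ∫ u in (0:ℝ)..1, ψ (x, u)) := fun x =>
      (param_hasFDerivAt ψ (h.of_le (by exact_mod_cast le_top)) x).differentiableAt
    exact this.continuous
  | succ k ih =>
    intro F _ _ _ ψ h
    have hd := param_hasFDerivAt ψ (h.of_le (by exact_mod_cast le_top))
    push_cast
    rw [contDiff_succ_iff_fderiv]
    refine ⟨fun x => (hd x).differentiableAt, fun h => by simp at h, ?_⟩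
    have he : fderiv ℝ (fun x => ∫ u in (0:ℝ)..1, ψ (x, u)) =
      fun x => ∫ u in (0:ℝ)..1, (fderiv ℝ ψ (x, u)).comp (ContinuousLinearMap.inl ℝ E ℝ) :=
      funext fun x => (hd x).fderiv
    rw [he]
    exact ih (fun p => (fderiv ℝ ψ p).comp (ContinuousLinearMap.inl ℝ E ℝ))
      ((h.fderiv_right (m := ∞) (by simp)).clm_comp contDiff_const)

theorem param_contDiff {F : Type} [NormedAddCommGroup F] [NormedSpace ℝ F]
    [CompleteSpace F] (ψ : E × ℝ → F) (h : ContDiff ℝ ∞ ψ) :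
    ContDiff ℝ ∞ (fun x => ∫ u in (0:ℝ)..1, ψ (x, u)) :=
  contDiff_infty.2 fun k => param_contDiff_nat k ψ h

end Param

section Hadamard
variable {E W F : Type} [NormedAddCommGroup E] [NormedSpace ℝ E] [FiniteDimensional ℝ E]
  [NormedAddCommGroup W] [NormedSpace ℝ W] [FiniteDimensional ℝ W]
  [NormedAddCommGroup F] [NormedSpace ℝ F] [CompleteSpace F]

noncomputable def Hd (φ : E × W → F) (p : E × W) : W →L[ℝ] F :=
  ∫ u in (0:ℝ)..1, (fderiv ℝ φ (p.1, u • p.2)).comp (ContinuousLinearMap.inr ℝ E W)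

theorem Hd_cont (φ : E × W → F) (h : ContDiff ℝ ∞ φ) :
    ContDiff ℝ ∞ (fun q : (E × W) × ℝ =>
      (fderiv ℝ φ (q.1.1, q.2 • q.1.2)).comp (ContinuousLinearMap.inr ℝ E W)) := by
  have h1 : ContDiff ℝ ∞ (fderiv ℝ φ) := h.fderiv_right (m := ∞) (by simp)
  exact (h1.comp (by fun_prop : ContDiff ℝ ∞ fun q : (E × W) × ℝ => (q.1.1, q.2 • q.1.2))).clm_comp contDiff_const

theorem Hd_contDiff (φ : E × W → F) (h : ContDiff ℝ ∞ φ) : ContDiff ℝ ∞ (Hd φ) :=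
  param_contDiff _ (Hd_cont φ h)

theorem Hd_eq (φ : E × W → F) (h : ContDiff ℝ ∞ φ) (x : E) (w : W) :
    φ (x, w) = φ (x, 0) + Hd φ (x, w) w := by
  have hc : Continuous (fun u : ℝ => (fderiv ℝ φ (x, u • w)).comp (ContinuousLinearMap.inr ℝ E W)) :=
    (Hd_cont φ h).continuous.comp (by fun_prop : Continuous fun u : ℝ => ((x, w), u))
  have hd : ∀ u : ℝ, HasDerivAt (fun u : ℝ => φ (x, u • w))
      (((fderiv ℝ φ (x, u • w)).comp (ContinuousLinearMap.inr ℝ E W)) w) u := by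
    intro u
    have h1 : HasFDerivAt φ (fderiv ℝ φ (x, u • w)) (x, u • w) :=
      ((h.differentiable (by simp)) _).hasFDerivAt
    have h2 : HasDerivAt (fun u : ℝ => (x, u • w)) ((0 : E), w) u := by
      have := (hasDerivAt_id u).smul_const w
      simp only [id, one_smul] at this
      exact (hasDerivAt_const u x).prodMk this
    have := h1.comp_hasDerivAt u h2
    simpa [Function.comp_def] using this
  have := intervalIntegral.integral_eq_sub_of_hasDerivAt (a := 0) (b := 1) (fun u _ => hd u)
    ((hc.clm_apply continuous_const).intervalIntegrable _ _)
  rw [Hd]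
  rw [ContinuousLinearMap.intervalIntegral_apply (hc.intervalIntegrable _ _), this]
  simp

theorem Hd_zero (φ : E × W → F) (x : E) :
    Hd φ (x, 0) = (fderiv ℝ φ (x, 0)).comp (ContinuousLinearMap.inr ℝ E W) := by
  simp [Hd]

theorem Hd_zero' (φ : E × W → F) (h : ContDiff ℝ ∞ φ) (x : E) (D : W →L[ℝ] F)
    (hD : HasFDerivAt (fun w => φ (x, w)) D 0) : Hd φ (x, 0) = D := by
  rw [Hd_zero]
  have h1 : HasFDerivAt φ (fderiv ℝ φ (x, 0)) (x, 0) :=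
      ((h.differentiable (by simp)) _).hasFDerivAt
  exact (HasFDerivAt.comp (0:W) h1 (hasFDerivAt_prodMk_right x (0:W))).unique hD

/-- multiplication by a function of the first variable -/
theorem Hd_smul (c : E → ℝ) (hc : ContDiff ℝ ∞ c) (φ ψ : E × W → F) (h : ContDiff ℝ ∞ φ)
    (hψ : ∀ x w, ψ (x, w) = c x • φ (x, w)) (p : E × W) :
    Hd ψ p = c p.1 • Hd φ p := by
  have he : ψ = fun p => c p.1 • φ p := funext fun p => hψ p.1 p.2
  have hψs : ContDiff ℝ ∞ ψ := by rw [he]; fun_prop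
  rw [Hd, Hd, ← intervalIntegral.integral_smul]
  congr 1
  ext u w
  have h1 : HasFDerivAt ψ (fderiv ℝ ψ (p.1, u • p.2)) (p.1, u • p.2) :=
      ((hψs.differentiable (by simp)) _).hasFDerivAt
  have h2 : HasFDerivAt φ (fderiv ℝ φ (p.1, u • p.2)) (p.1, u • p.2) :=
      ((h.differentiable (by simp)) _).hasFDerivAt
  have h1' := HasFDerivAt.comp (u • p.2) h1 (hasFDerivAt_prodMk_right p.1 (u • p.2))
  have h2' := (HasFDerivAt.comp (u • p.2) h2 (hasFDerivAt_prodMk_right p.1 (u • p.2))).const_smul (c p.1)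
  have : (ψ ∘ fun w => (p.1, w)) = c p.1 • (φ ∘ fun w => (p.1, w)) := by
    ext w; simp [hψ]
  rw [this] at h1'
  have := h1'.unique h2'
  exact congrArg (fun L => L w) this

end Hadamard
end QDC

namespace QDC
open Filter Topology
open scoped ContDiff
set_option linter.all false

theorem diffeo_half {E : Type} [NormedAddCommGroup E] [NormedSpace ℝ E] [FiniteDimensional ℝ E]
    (g : E → E) (hg : ContDiff ℝ ∞ g) (hL : LipschitzWith (1/2) g) :
    ∃ Ψ : E → E, ContDiff ℝ ∞ Ψ ∧ (∀ p, Ψ p + g (Ψ p) = p) ∧ ∀ q, Ψ (q + g q) = q := by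
  haveI : CompleteSpace E := FiniteDimensional.complete ℝ E
  let f : E → E := fun x => x + g x
  have hf : ContDiff ℝ ∞ f := contDiff_id.add hg
  have hA : ApproximatesLinearOn f ((ContinuousLinearEquiv.refl ℝ E : E ≃L[ℝ] E) : E →L[ℝ] E) Set.univ (1/2) := by
    rw [ApproximatesLinearOn.approximatesLinearOn_iff_lipschitzOnWith]
    have : f - ⇑((ContinuousLinearEquiv.refl ℝ E : E ≃L[ℝ] E) : E →L[ℝ] E) = g := by
      ext x; simp [f]
    rw [this]; exact hL.lipschitzOnWith
  have hc : Subsingleton E ∨ (1/2 : NNReal) < ‖((ContinuousLinearEquiv.refl ℝ E : E ≃L[ℝ] E).symm : E →L[ℝ] E)‖₊⁻¹ := by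
    rcases subsingleton_or_nontrivial E with h | h
    · exact Or.inl h
    · right
      have : ‖((ContinuousLinearEquiv.refl ℝ E : E ≃L[ℝ] E).symm : E →L[ℝ] E)‖₊ = 1 := by
        apply NNReal.eq
        simpa using (ContinuousLinearMap.norm_id (𝕜 := ℝ) (E := E))
      rw [this, inv_one]
      exact NNReal.coe_lt_coe.1 (by norm_num)
  let Φ := hA.toHomeomorph f hc
  have hΦ : ∀ x, Φ x = x + g x := fun x => rfl
  have hinj : ∀ a, Function.Injective (fderiv ℝ f a) := by
    intro a
    have h1 : fderiv ℝ f a = ContinuousLinearMap.id ℝ E + fderiv ℝ g a := by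
      have := (hasFDerivAt_id a).add ((hg.differentiable (by simp) a).hasFDerivAt)
      exact this.fderiv
    have h2 : ‖fderiv ℝ g a‖ ≤ 1/2 := by
      have := norm_fderiv_le_of_lipschitz ℝ hL (x₀ := a)
      simpa using this
    rw [injective_iff_map_eq_zero]
    intro v hv
    rw [h1] at hv
    have h3 : v = - fderiv ℝ g a v := by
      rw [eq_neg_iff_add_eq_zero]; simpa using hv
    have h4 : ‖v‖ ≤ 1/2 * ‖v‖ := by
      calc ‖v‖ = ‖fderiv ℝ g a v‖ := by conv_lhs => rw [h3, norm_neg]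
        _ ≤ ‖fderiv ℝ g a‖ * ‖v‖ := ContinuousLinearMap.le_opNorm _ _
        _ ≤ _ := by gcongr
    have : ‖v‖ = 0 := by linarith [norm_nonneg v]
    exact norm_eq_zero.1 this
  let f' : E → E ≃L[ℝ] E := fun a =>
    (LinearEquiv.ofInjectiveEndo (fderiv ℝ f a : E →ₗ[ℝ] E) (hinj a)).toContinuousLinearEquiv
  have hd : ∀ a, HasFDerivAt (⇑Φ) (f' a : E →L[ℝ] E) a := by
    intro a
    have : (f' a : E →L[ℝ] E) = fderiv ℝ f a := by
      ext v; rfl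
    rw [this]
    exact (hf.differentiable (by simp) a).hasFDerivAt
  refine ⟨Φ.symm, Φ.contDiff_symm hd hf, fun p => ?_, fun q => ?_⟩
  · rw [← hΦ]; exact Φ.apply_symm_apply p
  · rw [← hΦ]; exact Φ.symm_apply_apply q

section Flat
variable {E W : Type} [NormedAddCommGroup E] [NormedSpace ℝ E]
  [NormedAddCommGroup W] [NormedSpace ℝ W]

/-- flat class relative to `θ`, `σ` -/
def FC (θ : E → ℝ) (σ : E → W) {F : Type} [NormedAddCommGroup F] [NormedSpace ℝ F] (u : E → F) : Prop :=
  (∀ x, θ x = 0 → u x = 0) ∧ ∀ m : ℕ, ∃ G : E × W → F, ContDiff ℝ ∞ G ∧ HasCompactSupport G ∧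
    ∀ x, θ x ≠ 0 → u x = θ x ^ m • G (x, σ x)

theorem FC.hasFDerivAt_zero {θ : E → ℝ} (hθ : ContDiff ℝ ∞ θ) {σ : E → W}
    {F : Type} [NormedAddCommGroup F] [NormedSpace ℝ F] {u : E → F} (hu : FC θ σ u) (x : E)
    (hx : θ x = 0) : HasFDerivAt u (0 : E →L[ℝ] F) x := by
  obtain ⟨G, hG, hGc, hGu⟩ := hu.2 2
  obtain ⟨C, hC⟩ := hGc.exists_bound_of_continuous hG.continuous
  have hb : ∀ y, ‖u y‖ ≤ C * ‖θ y‖ ^ 2 := by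
    intro y
    by_cases hy : θ y = 0
    · rw [hu.1 y hy, hy]; simp
    · rw [hGu y hy, norm_smul, norm_pow, mul_comm]
      gcongr
      exact hC _
  have hO : θ =O[𝓝 x] fun y => y - x := by
    have := ((hθ.differentiable (by simp)) x).isBigO_sub
    simpa [hx] using this
  rw [hasFDerivAt_iff_isLittleO]
  have h1 : (fun y => u y - u x - (0 : E →L[ℝ] F) (y - x)) =O[𝓝 x] fun y => ‖y - x‖ ^ 2 := by
    have h2 : (fun y => u y - u x - (0 : E →L[ℝ] F) (y - x)) =O[𝓝 x] fun y => θ y ^ 2 := by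
      refine Asymptotics.IsBigO.of_bound C (Eventually.of_forall fun y => ?_)
      simpa [hu.1 x hx] using hb y
    refine h2.trans ?_
    exact (hO.norm_right).pow 2
  refine h1.trans_isLittleO ?_
  have : (fun y : E => ‖y - x‖ ^ 2) =o[𝓝 x] fun y => ‖y - x‖ ^ 1 :=
    Asymptotics.IsLittleO.comp_tendsto (k := fun y : E => ‖y - x‖) (Asymptotics.isLittleO_pow_pow (m := 1) (n := 2) one_lt_two) (by
        have : Tendsto (fun y : E => ‖y - x‖) (𝓝 x) (𝓝 ‖x - x‖) := by
          apply Continuous.tendsto; fun_prop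
        simpa using this)
  simpa using this

theorem FC.fderiv (θ : E → ℝ) (hθ : ContDiff ℝ ∞ θ) (σ : E → W) (N : ℕ) (B : E × W → (E →L[ℝ] W))
  (hB : ContDiff ℝ ∞ B)
  (hσ : ∀ x, θ x ≠ 0 → HasFDerivAt σ ((θ x)⁻¹ ^ N • B (x, σ x)) x)
    {F : Type} [NormedAddCommGroup F] [NormedSpace ℝ F] {u : E → F} (hu : FC θ σ u) :
    Differentiable ℝ u ∧ FC θ σ (fderiv ℝ u) := by
  have key : ∀ m : ℕ, ∃ G' : E × W → (E →L[ℝ] F), ContDiff ℝ ∞ G' ∧ HasCompactSupport G' ∧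
    ∀ x, θ x ≠ 0 → HasFDerivAt u (θ x ^ m • G' (x, σ x)) x := by
    intro m
    obtain ⟨G, hG, hGc, hGu⟩ := hu.2 (m + N + 1)
    have hdG : ContDiff ℝ ∞ (_root_.fderiv ℝ G) := hG.fderiv_right (m := ∞) (by simp)
    have hdθ : ContDiff ℝ ∞ (_root_.fderiv ℝ θ) := hθ.fderiv_right (m := ∞) (by simp)
    let G1 : E × W → (E →L[ℝ] F) := fun p =>
      (_root_.fderiv ℝ G p).comp ((θ p.1 ^ (N+1)) • (ContinuousLinearMap.inl ℝ E W) +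
        (θ p.1) • ((ContinuousLinearMap.inr ℝ E W).comp (B p)))
    let G2 : E × W → (E →L[ℝ] F) := fun p =>
      ((m + N + 1 : ℝ) * θ p.1 ^ N) • ((_root_.fderiv ℝ θ p.1).smulRight (G p))
    refine ⟨fun p => G1 p + G2 p, ?_, ?_, ?_⟩
    · refine ContDiff.add ?_ ?_
      · refine hdG.clm_comp (ContDiff.add ?_ ?_)
        · exact ((hθ.comp contDiff_fst).pow _).smul contDiff_const
        · exact (hθ.comp contDiff_fst).smul (contDiff_const.clm_comp hB)
      · refine ContDiff.smul (contDiff_const.mul ((hθ.comp contDiff_fst).pow _)) ?_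
        exact (hdθ.comp contDiff_fst).smulRight hG
    · refine HasCompactSupport.add ?_ ?_
      · refine (hGc.fderiv (𝕜 := ℝ)).mono' ?_
        refine (Function.support_subset_iff'.2 fun p hp => ?_)
        have : _root_.fderiv ℝ G p = 0 := image_eq_zero_of_notMem_tsupport hp
        simp [G1, this]
      · refine hGc.mono' ?_
        refine (Function.support_subset_iff'.2 fun p hp => ?_)
        have : G p = 0 := image_eq_zero_of_notMem_tsupport hp
        ext v
        simp [G2, this]
    · intro x hx
      have hev : u =ᶠ[𝓝 x] fun y => θ y ^ (m + N + 1) • G (y, σ y) := by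
        filter_upwards [hθ.continuous.continuousAt.eventually_ne hx] with y hy using hGu y hy
      have h1 : HasFDerivAt (fun y => (y, σ y)) _ x := (hasFDerivAt_id x).prodMk (hσ x hx)
      have h2 : HasFDerivAt G (_root_.fderiv ℝ G (x, σ x)) (x, σ x) :=
        ((hG.differentiable (by simp)) _).hasFDerivAt
      have h3 := HasFDerivAt.comp x h2 h1
      have h4 : HasFDerivAt (fun y => θ y ^ (m + N + 1)) _ x :=
        (((hθ.differentiable (by simp)) x).hasFDerivAt).pow (m + N + 1)
      have h5 := h4.smul h3
      refine (h5.congr_of_eventuallyEq hev).congr_fderiv ?_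
      ext v
      have e1 : θ x ^ (m + N + 1) * (θ x)⁻¹ ^ N = θ x ^ m * θ x := by
        rw [show m + N + 1 = m + 1 + N by ring, pow_add, mul_assoc, ← mul_pow, mul_inv_cancel₀ hx]
        rw [one_pow, mul_one, pow_succ]
      have e2 : ∀ w : W, (_root_.fderiv ℝ G (x, σ x)) (v, (θ x)⁻¹ ^ N • w) =
         (_root_.fderiv ℝ G (x, σ x)) (v, 0) + (θ x)⁻¹ ^ N • (_root_.fderiv ℝ G (x, σ x)) (0, w) := by
        intro w
        rw [← map_smul, ← map_add]; simp
      simp only [G1, G2, Function.comp_apply, ContinuousLinearMap.comp_add, ContinuousLinearMap.comp_smul, ContinuousLinearMap.smul_apply, ContinuousLinearMap.add_apply, ContinuousLinearMap.comp_apply, ContinuousLinearMap.prod_apply, ContinuousLinearMap.id_apply, ContinuousLinearMap.smulRight_apply, ContinuousLinearMap.inl_apply, ContinuousLinearMap.inr_apply]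
      rw [e2]
      simp only [smul_add, smul_smul, e1, nsmul_eq_mul, smul_eq_mul, Nat.add_sub_cancel]
      congr 2
      · congr 1; rw [← pow_add]; rfl
      · push_cast
        ring
  have hd : Differentiable ℝ u := by
    intro x
    by_cases hx : θ x = 0
    · exact (hu.hasFDerivAt_zero hθ x hx).differentiableAt
    · obtain ⟨G', _, _, h⟩ := key 0
      exact (h x hx).differentiableAt
  refine ⟨hd, fun x hx => (hu.hasFDerivAt_zero hθ x hx).fderiv, fun m => ?_⟩
  obtain ⟨G', h1, h2, h⟩ := key m
  exact ⟨G', h1, h2, fun x hx => (h x hx).fderiv⟩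

theorem FC.contDiff_nat (θ : E → ℝ) (hθ : ContDiff ℝ ∞ θ) (σ : E → W) (N : ℕ) (B : E × W → (E →L[ℝ] W))
  (hB : ContDiff ℝ ∞ B)
  (hσ : ∀ x, θ x ≠ 0 → HasFDerivAt σ ((θ x)⁻¹ ^ N • B (x, σ x)) x)
    (k : ℕ) : ∀ {F : Type} [NormedAddCommGroup F] [NormedSpace ℝ F] {u : E → F},
    FC θ σ u → ContDiff ℝ k u := by
  induction k with
  | zero =>
    intro F _ _ u hu
    rw [Nat.cast_zero, contDiff_zero]
    exact (FC.fderiv θ hθ σ N B hB hσ hu).1.continuous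
  | succ k ih =>
    intro F _ _ u hu
    push_cast
    rw [contDiff_succ_iff_fderiv]
    obtain ⟨h1, h2⟩ := FC.fderiv θ hθ σ N B hB hσ hu
    exact ⟨h1, fun h => by simp at h, ih h2⟩

theorem FC.contDiff (θ : E → ℝ) (hθ : ContDiff ℝ ∞ θ) (σ : E → W) (N : ℕ) (B : E × W → (E →L[ℝ] W))
  (hB : ContDiff ℝ ∞ B)
  (hσ : ∀ x, θ x ≠ 0 → HasFDerivAt σ ((θ x)⁻¹ ^ N • B (x, σ x)) x)
    {F : Type} [NormedAddCommGroup F] [NormedSpace ℝ F] {u : E → F}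
    (hu : FC θ σ u) : ContDiff ℝ ∞ u :=
  contDiff_infty.2 fun k => FC.contDiff_nat θ hθ σ N B hB hσ k hu

end Flat
end QDC

namespace QDC
open Filter Topology
open scoped ContDiff
set_option linter.all false

theorem scale_bound {E : Type} [NormedAddCommGroup E] [NormedSpace ℝ E]
    (β : E × ℝ → ℝ) (hβ : ContDiff ℝ ∞ β) (C : ℝ) (k i : ℕ) (hki : k < i)
    (hC : ∀ p, ‖iteratedFDeriv ℝ k β p‖ ≤ C) (lam : ℝ) (hl : 1 ≤ lam) (p : E × ℝ) :
    ‖iteratedFDeriv ℝ k (fun p : E × ℝ => lam⁻¹ ^ i * β (p.1, lam * p.2)) p‖ ≤ C / lam := by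
  have hl0 : 0 < lam := by linarith
  have hC0 : 0 ≤ C := (norm_nonneg _).trans (hC p)
  let L : E × ℝ →L[ℝ] E × ℝ := (ContinuousLinearMap.fst ℝ E ℝ).prod (lam • ContinuousLinearMap.snd ℝ E ℝ)
  have hL : ‖L‖ ≤ lam := by
    refine ContinuousLinearMap.opNorm_le_bound _ hl0.le fun q => ?_
    simp only [L, ContinuousLinearMap.prod_apply, Prod.norm_def]
    have h1 : ‖q.1‖ ≤ lam * ‖q‖ := (norm_fst_le q).trans (by nlinarith [norm_nonneg q])
    have h2 : ‖lam • q.2‖ ≤ lam * ‖q‖ := by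
      rw [norm_smul, Real.norm_of_nonneg hl0.le]; gcongr; exact norm_snd_le q
    exact max_le h1 h2
  have he : (fun p : E × ℝ => lam⁻¹ ^ i * β (p.1, lam * p.2)) = lam⁻¹ ^ i • (β ∘ L) := by
    ext q; simp [L]
  rw [he, iteratedFDeriv_const_smul_apply, L.iteratedFDeriv_comp_right hβ p (by exact_mod_cast le_top)]
  · rw [norm_smul]
    have h3 := ContinuousMultilinearMap.norm_compContinuousLinearMap_le (iteratedFDeriv ℝ k β (L p)) (fun _ => L)
    rw [Finset.prod_const, Finset.card_univ, Fintype.card_fin] at h3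
    have h4 : ‖L‖ ^ k ≤ lam ^ k := by gcongr
    have h5 : ‖lam⁻¹ ^ i‖ = lam⁻¹ ^ i := Real.norm_of_nonneg (by positivity)
    rw [h5]
    obtain ⟨d, rfl⟩ : ∃ d, i = k + d + 1 := ⟨i - k - 1, by omega⟩
    calc lam⁻¹ ^ (k + d + 1) * _ ≤ lam⁻¹ ^ (k + d + 1) * (C * lam ^ k) := by
          gcongr
          refine h3.trans ?_
          gcongr
          exact hC _
      _ = C / lam * (lam⁻¹ ^ d * (lam⁻¹ * lam) ^ k) := by
          rw [pow_succ, pow_add, mul_pow]; field_simp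
      _ ≤ C / lam * 1 := by
          gcongr
          rw [inv_mul_cancel₀ hl0.ne', one_pow, mul_one]
          exact pow_le_one₀ (by positivity) (inv_le_one_of_one_le₀ hl)
      _ = _ := mul_one _
  · exact (hβ.comp L.contDiff).contDiffAt.of_le (by exact_mod_cast le_top)

theorem borel_param {E : Type} [NormedAddCommGroup E] [NormedSpace ℝ E]
    (K : Set E) (hK : IsCompact K) (g : ℕ → E → ℝ) (hg : ∀ l, ContDiff ℝ ∞ (g l))
    (hgK : ∀ l, ∀ x ∉ K, g l x = 0) :
    ∃ Γ : ℕ → E × ℝ → ℝ, (∀ m, ContDiff ℝ ∞ (Γ m)) ∧ (∀ m, ∀ x ∉ K, ∀ t, Γ m (x, t) = 0) ∧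
      ∀ m x t, Γ m (x, t) = g m x + t * Γ (m + 1) (x, t) := by
  let χ : ContDiffBump (0 : ℝ) := ⟨1, 2, one_pos, one_lt_two⟩
  have hχ : ContDiff ℝ ∞ χ := χ.contDiff
  have hχ1 : ∀ s : ℝ, |s| ≤ 1 → χ s = 1 := fun s hs => χ.one_of_mem_closedBall (by simpa [χ] using hs)
  let β : ℕ → ℕ → E × ℝ → ℝ := fun l i p => p.2 ^ i * χ p.2 * g l p.1
  have hβ : ∀ l i, ContDiff ℝ ∞ (β l i) := fun l i =>
    ((contDiff_snd.pow i).mul (hχ.comp contDiff_snd)).mul ((hg l).comp contDiff_fst)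
  have hβc : ∀ l i, HasCompactSupport (β l i) := by
    intro l i
    refine HasCompactSupport.intro (hK.prod (isCompact_closedBall (0:ℝ) 2)) fun p hp => ?_
    by_cases h : p.1 ∈ K
    · have h2 : p.2 ∉ Metric.closedBall (0:ℝ) 2 := fun h' => hp ⟨h, h'⟩
      have : χ p.2 = 0 := χ.zero_of_le_dist (by simpa [χ] using (not_le.1 (fun h' => h2 (by simpa using h'))).le)
      simp [β, this]
    · simp [β, hgK l p.1 h]
  have hbd : ∀ l i k, ∃ C : ℝ, ∀ p, ‖iteratedFDeriv ℝ k (β l i) p‖ ≤ C := fun l i k =>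
    ((hβc l i).iteratedFDeriv k).exists_bound_of_continuous
      ((hβ l i).continuous_iteratedFDeriv (by exact_mod_cast le_top))
  choose C hC using hbd
  let lam : ℕ → ℝ := fun l => 2 ^ l * (1 + ∑ i ∈ Finset.range (l+1), ∑ k ∈ Finset.range (l+1), |C l i k|)
  have hs0 : ∀ l, 0 ≤ ∑ i ∈ Finset.range (l+1), ∑ k ∈ Finset.range (l+1), |C l i k| := fun l => by positivity
  have hlam1 : ∀ l, 1 ≤ lam l := fun l => by
    have : (1:ℝ) ≤ 2 ^ l := one_le_pow₀ (by norm_num)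
    nlinarith [hs0 l]
  have hlamC : ∀ l i k, i ≤ l → k ≤ l → C l i k / lam l ≤ (1/2) ^ l := by
    intro l i k hi hk
    have hp : (0:ℝ) < lam l := by linarith [hlam1 l]
    rw [div_le_iff₀ hp]
    have h1 : |C l i k| ≤ ∑ i ∈ Finset.range (l+1), ∑ k ∈ Finset.range (l+1), |C l i k| := by
      refine le_trans ?_ (Finset.single_le_sum (f := fun i => ∑ k ∈ Finset.range (l+1), |C l i k|) (fun i _ => by positivity)
        (Finset.mem_range.2 (by omega : i < l + 1)))
      exact Finset.single_le_sum (f := fun k => |C l i k|) (fun i _ => by positivity) (Finset.mem_range.2 (by omega))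
    have h2 : (1/2 : ℝ) ^ l * lam l = 1 + ∑ i ∈ Finset.range (l+1), ∑ k ∈ Finset.range (l+1), |C l i k| := by
      simp only [lam]
      rw [← mul_assoc, ← mul_pow]; norm_num
    rw [h2]
    linarith [le_abs_self (C l i k)]
  let tm : ℕ → ℕ → E × ℝ → ℝ := fun m i p => p.2 ^ i * χ (lam (m+i) * p.2) * g (m+i) p.1
  have htm : ∀ m i, tm m i = fun p => (lam (m+i))⁻¹ ^ i * β (m+i) i (p.1, lam (m+i) * p.2) := by
    intro m i
    ext p
    have hp : (0:ℝ) < lam (m+i) := by linarith [hlam1 (m+i)]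
    simp only [tm, β]
    rw [mul_pow, inv_pow]; field_simp
  have htms : ∀ m i, ContDiff ℝ ∞ (tm m i) := fun m i =>
    ((contDiff_snd.pow i).mul (hχ.comp (contDiff_const.mul contDiff_snd))).mul ((hg _).comp contDiff_fst)
  have htmb : ∀ m k i, k < i → ∀ p, ‖iteratedFDeriv ℝ k (tm m i) p‖ ≤ (1/2) ^ i := by
    intro m k i hki p
    rw [htm]
    refine (scale_bound _ (hβ _ _) _ k i hki (hC _ _ _) _ (hlam1 _) p).trans ?_
    refine (hlamC _ _ _ (by omega) (by omega)).trans ?_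
    exact pow_le_pow_of_le_one (by norm_num) (by norm_num) (by omega)
  have hgeo : Summable (fun i : ℕ => (1/2 : ℝ) ^ i) := summable_geometric_of_lt_one (by norm_num) (by norm_num)
  let T : ℕ → E × ℝ → ℝ := fun m p => ∑' i, tm m i p
  have hT : ∀ m, ContDiff ℝ ∞ (T m) := by
    intro m
    refine contDiff_tsum_of_eventually (N := ⊤) (v := fun _ i => (1/2 : ℝ) ^ i) (htms m) (fun k _ => hgeo) (fun k _ => ?_)
    rw [Nat.cofinite_eq_atTop]
    filter_upwards [eventually_gt_atTop k] with i hi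
    exact htmb m k i hi
  have hsum : ∀ m p, Summable (fun i => tm m i p) := by
    intro m p
    refine Summable.of_norm_bounded_eventually (g := fun i : ℕ => (1/2 : ℝ) ^ i) hgeo ?_
    rw [Nat.cofinite_eq_atTop]
    filter_upwards [eventually_gt_atTop 0] with i hi
    have := htmb m 0 i hi p
    rwa [norm_iteratedFDeriv_zero] at this
  have hTs : ∀ m x t, T m (x, t) = χ (lam m * t) * g m x + t * T (m+1) (x, t) := by
    intro m x t
    simp only [T]
    rw [(hsum m (x,t)).tsum_eq_zero_add, ← tsum_mul_left]
    congr 1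
    · simp [tm]
    · congr 1; ext i
      simp only [tm]
      rw [show m + 1 + i = m + (i + 1) by ring, pow_succ]; ring
  let c : ℕ → ℕ → ℝ → ℝ := fun l j t => (χ (lam l * t) - 1) / t ^ j
  have hcs : ∀ l j, ContDiff ℝ ∞ (c l j) := by
    intro l j
    have hp : (0:ℝ) < lam l := by linarith [hlam1 l]
    have hnum : ContDiff ℝ ∞ (fun t : ℝ => χ (lam l * t) - 1) :=
      (hχ.comp (contDiff_const.mul contDiff_id)).sub contDiff_const
    rw [contDiff_iff_contDiffAt]
    intro t
    by_cases ht : t = 0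
    · subst ht
      have : c l j =ᶠ[𝓝 0] fun _ => 0 := by
        filter_upwards [Metric.ball_mem_nhds (0:ℝ) (inv_pos.2 hp)] with s hs
        have : χ (lam l * s) = 1 := by
          apply hχ1
          rw [abs_mul, abs_of_pos hp]
          have : |s| < (lam l)⁻¹ := by simpa using hs
          calc lam l * |s| ≤ lam l * (lam l)⁻¹ := by gcongr
            _ = 1 := mul_inv_cancel₀ hp.ne'
        simp [c, this]
      exact contDiffAt_const.congr_of_eventuallyEq this
    · exact hnum.contDiffAt.div (contDiff_id.pow j).contDiffAt (pow_ne_zero _ ht)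
  have hc1 : ∀ l j t, t * c l (j+1) t = c l j t := by
    intro l j t
    by_cases ht : t = 0
    · subst ht
      have : χ (0:ℝ) = 1 := hχ1 0 (by simp)
      simp [c, this]
    · simp only [c]; rw [pow_succ]; field_simp
  refine ⟨fun m p => T m p + ∑ l ∈ Finset.range m, c l (m - l) p.2 * g l p.1, fun m => ?_, fun m x hx t => ?_, fun m x t => ?_⟩
  · refine (hT m).add (ContDiff.sum fun l _ => ?_)
    exact ((hcs _ _).comp contDiff_snd).mul ((hg l).comp contDiff_fst)
  · have h1 : ∀ i, tm m i (x, t) = 0 := fun i => by simp [tm, hgK _ x hx]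
    have h2 : ∀ l, g l x = 0 := fun l => hgK l x hx
    simp [T, h1, h2]
  · simp only
    rw [hTs, Finset.sum_range_succ, mul_add, mul_add, Finset.mul_sum]
    have h1 : ∀ l ∈ Finset.range m, t * (c l (m + 1 - l) t * g l x) = c l (m - l) t * g l x := by
      intro l hl
      rw [Finset.mem_range] at hl
      rw [← mul_assoc, show m + 1 - l = (m - l) + 1 by omega, hc1]
    rw [Finset.sum_congr rfl h1]
    have h2 : t * (c m (m + 1 - m) t * g m x) = (χ (lam m * t) - 1) * g m x := by
      rw [← mul_assoc, show m + 1 - m = 0 + 1 by omega, hc1]; simp [c]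
    rw [h2]; ring

end QDC

namespace QDC
open Filter Topology
open scoped ContDiff
set_option linter.all false

section HL
variable {V W : Type} [NormedAddCommGroup V] [NormedSpace ℝ V] [FiniteDimensional ℝ V]
  [NormedAddCommGroup W] [NormedSpace ℝ W] [FiniteDimensional ℝ W]

/-- solving the perturbed equation with a uniform small parameter -/
theorem hl_solve (R : ℝ) (hR : 0 ≤ R) (P : V × ℝ × W → W) (hP : ContDiff ℝ ∞ P)
    (hP0 : ∀ x e, P (x, e, 0) = 0) :
    ∃ ε : ℝ, 0 < ε ∧ ∃ N : V × W → W, ContDiff ℝ ∞ N ∧ (∀ x, N (x, 0) = 0) ∧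
      ∀ x s, ‖x‖ ≤ R → ‖s‖ ≤ 1 → s + N (x, s) + ε • P (x, ε, N (x, s)) = 0 := by
  let χ : ContDiffBump (0 : V × ℝ × W) := ⟨R + 2, R + 3, by linarith, by linarith⟩
  have hχ : ContDiff ℝ ∞ χ := χ.contDiff
  let Q : V × ℝ × W → W := fun p => χ p • P p
  have hQ : ContDiff ℝ ∞ Q := hχ.smul hP
  have hQc : HasCompactSupport Q := χ.hasCompactSupport.smul_right
  have hQ0 : ∀ x e, Q (x, e, 0) = 0 := fun x e => by simp [Q, hP0]
  obtain ⟨C, hC⟩ := hQ.lipschitzWith_of_hasCompactSupport hQc (by simp)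
  obtain ⟨D, hD⟩ := hQc.exists_bound_of_continuous hQ.continuous
  have hD0 : 0 ≤ D := (norm_nonneg _).trans (hD 0)
  have hC0 : (0:ℝ) ≤ C := C.2
  let ε : ℝ := 1 / (2 * (C + D + 1))
  have hε0 : 0 < ε := by positivity
  have hεs : ε * (2 * (C + D + 1)) = 1 := by simp only [ε]; field_simp
  have hεC : ε * C ≤ 1/2 := by nlinarith
  have hεD : ε * D ≤ 1 := by nlinarith
  have hε1 : ε ≤ 1 := by nlinarith
  let g : V × W → V × W := fun p => (0, ε • Q (p.1, ε, p.2))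
  have hg : ContDiff ℝ ∞ g := by
    refine contDiff_const.prodMk (contDiff_const.smul (hQ.comp ?_))
    exact contDiff_fst.prodMk (contDiff_const.prodMk contDiff_snd)
  have hL : LipschitzWith (1/2) g := by
    refine LipschitzWith.of_dist_le_mul fun p q => ?_
    have h1 : dist (g p) (g q) = ε * dist (Q (p.1, ε, p.2)) (Q (q.1, ε, q.2)) := by
      simp only [g, Prod.dist_eq, dist_self]
      rw [dist_smul₀, Real.norm_of_nonneg hε0.le]
      exact max_eq_right (by positivity)
    have h2 : dist (p.1, ε, p.2) (q.1, ε, q.2) = dist p q := by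
      simp only [Prod.dist_eq, dist_self]
      rw [max_eq_right (a := (0:ℝ)) dist_nonneg]
    rw [h1]
    calc ε * dist (Q (p.1, ε, p.2)) (Q (q.1, ε, q.2)) ≤ ε * (C * dist (p.1, ε, p.2) (q.1, ε, q.2)) := by
          gcongr; exact hC.dist_le_mul _ _
      _ = ε * C * dist p q := by rw [h2, mul_assoc]
      _ ≤ 1/2 * dist p q := by gcongr
      _ = _ := by norm_num
  obtain ⟨Ψ, hΨ, h1, h2⟩ := diffeo_half g hg hL
  have hfst : ∀ p, (Ψ p).1 = p.1 := fun p => by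
    have := congrArg Prod.fst (h1 p)
    simpa [g] using this
  have hsnd : ∀ p, (Ψ p).2 + ε • Q (p.1, ε, (Ψ p).2) = p.2 := fun p => by
    have := congrArg Prod.snd (h1 p)
    simpa [g, hfst] using this
  refine ⟨ε, hε0, fun p => (Ψ (p.1, -p.2)).2, ?_, ?_, ?_⟩
  · exact contDiff_snd.comp (hΨ.comp (contDiff_fst.prodMk contDiff_snd.neg))
  · intro x
    have := h2 (x, 0)
    simp only [g, hQ0, smul_zero] at this
    simp only [neg_zero]
    have h3 : ((x, (0:W)) + ((0:V), (0:W))) = (x, 0) := by simp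
    rw [h3] at this
    rw [this]
  · intro x s hx hs
    have h3 := hsnd (x, -s)
    simp only at h3 ⊢
    have h4 : ‖(Ψ (x, -s)).2‖ ≤ 2 := by
      have : (Ψ (x, -s)).2 = -s - ε • Q (x, ε, (Ψ (x, -s)).2) := eq_sub_of_add_eq h3
      rw [this]
      calc _ ≤ ‖-s‖ + ‖ε • Q (x, ε, (Ψ (x, -s)).2)‖ := norm_sub_le _ _
        _ ≤ 1 + ε * D := by
          rw [norm_neg, norm_smul, Real.norm_of_nonneg hε0.le]
          gcongr; exact hD _
        _ ≤ 2 := by linarith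
    have h5 : χ (x, ε, (Ψ (x, -s)).2) = 1 := by
      apply χ.one_of_mem_closedBall
      rw [mem_closedBall_zero_iff]
      simp only [χ, Prod.norm_def, Real.norm_of_nonneg hε0.le]
      refine max_le (by linarith) (max_le (by linarith) (by linarith))
    have h6 : Q (x, ε, (Ψ (x, -s)).2) = P (x, ε, (Ψ (x, -s)).2) := by simp [Q, h5]
    rw [← h6, add_assoc, h3]; simp

theorem hl_near (R : ℝ) (hR : 0 ≤ R) (θ : V → ℝ) (hθ : ContDiff ℝ ∞ θ) (A : V → W)
    (K : V × W → W) (hK : ContDiff ℝ ∞ K) (hK0 : ∀ x, K (x, 0) = A x)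
    (hK1 : ∀ x, HasFDerivAt (fun y => K (x, y)) (θ x • ContinuousLinearMap.id ℝ W) 0)
    (L : W →L[ℝ] V) (F : ℕ → V → ℝ) (hF : ∀ m, ContDiff ℝ ∞ (F m))
    (hFm : ∀ m x, F 0 x = θ x ^ m * F m x)
    (hvan : ∀ x y, θ x ≠ 0 → K (x, y) = 0 → F 0 (x + L y) = 0) :
    ∃ ε : ℝ, 0 < ε ∧ ∃ M : ℕ → V × W → (W →L[ℝ] ℝ), (∀ m, ContDiff ℝ ∞ (M m)) ∧
      (∀ m x s, M 0 (x, s) = θ x ^ m • M m (x, s)) ∧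
      ∀ x s, ‖x‖ ≤ R → ‖s‖ ≤ 1 → θ x ≠ 0 → A x = (ε * θ x ^ 3) • s → F 0 x = M 0 (x, s) s := by
  let K1 := Hd K
  have hK1s : ContDiff ℝ ∞ K1 := Hd_contDiff K hK
  let Q := Hd K1
  have hQs : ContDiff ℝ ∞ Q := Hd_contDiff K1 hK1s
  have hKe : ∀ x y, K (x, y) = A x + θ x • y + Q (x, y) y y := by
    intro x y
    have h1 := Hd_eq K hK x y
    have h2 := Hd_eq K1 hK1s x y
    have h3 : K1 (x, 0) = θ x • ContinuousLinearMap.id ℝ W := Hd_zero' K hK x _ (hK1 x)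
    rw [h1, hK0, add_assoc]
    congr 1
    change K1 (x, y) y = _
    rw [h2, h3]
    simp [Q]
  let P : V × ℝ × W → W := fun p => θ p.1 • (Q (p.1, (p.2.1 * θ p.1 ^ 2) • p.2.2) p.2.2 p.2.2)
  have hP : ContDiff ℝ ∞ P := by
    have hθ1 : ContDiff ℝ ∞ (fun p : V × ℝ × W => θ p.1) := hθ.comp contDiff_fst
    have h2 : ContDiff ℝ ∞ (fun p : V × ℝ × W => p.2.2) := by fun_prop
    have h3 : ContDiff ℝ ∞ (fun p : V × ℝ × W => Q (p.1, (p.2.1 * θ p.1 ^ 2) • p.2.2)) := by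
      refine hQs.comp ?_
      exact contDiff_fst.prodMk (((by fun_prop : ContDiff ℝ ∞ (fun p : V × ℝ × W => p.2.1)).mul (hθ1.pow 2)).smul h2)
    exact hθ1.smul ((h3.clm_apply h2).clm_apply h2)
  obtain ⟨ε, hε, N, hN, hN0, hNe⟩ := hl_solve R hR P hP (fun x e => by simp [P])
  let Θ : V × V → (V →L[ℝ] ℝ) := Hd (fun p : V × V => θ (p.1 + p.2))
  have hθa : ContDiff ℝ ∞ (fun p : V × V => θ (p.1 + p.2)) := hθ.comp (contDiff_fst.add contDiff_snd)
  have hΘ : ContDiff ℝ ∞ Θ := Hd_contDiff _ hθa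
  have hΘe : ∀ x w, θ (x + w) = θ x + Θ (x, w) w := fun x w => by
    simpa using Hd_eq (fun p : V × V => θ (p.1 + p.2)) hθa x w
  let z : V × W → V := fun p => (ε * θ p.1) • L (N p)
  have hθ1 : ContDiff ℝ ∞ (fun p : V × W => θ p.1) := hθ.comp contDiff_fst
  have hz : ContDiff ℝ ∞ z := (contDiff_const.mul hθ1).smul (L.contDiff.comp hN)
  have hz0 : ∀ x, z (x, 0) = 0 := fun x => by simp [z, hN0]
  let ell : V × W → ℝ := fun p => 1 + Θ (p.1, θ p.1 • z p) (z p)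
  have hell : ContDiff ℝ ∞ ell := by
    refine contDiff_const.add (ContDiff.clm_apply (hΘ.comp ?_) hz)
    exact contDiff_fst.prodMk (hθ1.smul hz)
  have helle : ∀ p : V × W, θ (p.1 + θ p.1 • z p) = θ p.1 * ell p := by
    intro p
    rw [hΘe]; simp [ell]; ring
  let f : ℕ → V × W → ℝ := fun m p => F m p.1 - ell p ^ m * F m (p.1 + θ p.1 • z p)
  have hf : ∀ m, ContDiff ℝ ∞ (f m) := by
    intro m
    refine ((hF m).comp contDiff_fst).sub ((hell.pow m).mul ((hF m).comp ?_))
    exact contDiff_fst.add (hθ1.smul hz)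
  have hfm : ∀ m (p : V × W), f 0 p = θ p.1 ^ m * f m p := by
    intro m p
    simp only [f]
    rw [hFm m, hFm m (p.1 + θ p.1 • z p), helle]; ring
  have hf0 : ∀ m x, f m (x, 0) = 0 := by
    intro m x
    have : ell (x, 0) = 1 := by simp [ell, hz0]
    simp [f, this, hz0]
  refine ⟨ε, hε, fun m => Hd (f m), fun m => Hd_contDiff _ (hf m), ?_, ?_⟩
  · intro m x s
    exact Hd_smul (fun x => θ x ^ m) (hθ.pow m) (f m) (f 0) (hf m) (fun x w => hfm m (x, w)) (x, s)
  · intro x s hx hs hθx hA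
    have h1 := Hd_eq (f 0) (hf 0) x s
    rw [hf0, zero_add] at h1
    rw [← h1]
    have h2 : F 0 (x + θ x • z (x, s)) = 0 := by
      have : θ x • z (x, s) = L ((ε * θ x ^ 2) • N (x, s)) := by
        simp only [z]; rw [map_smul, smul_smul]; congr 1; ring
      rw [this]
      apply hvan x _ hθx
      have h3 := hNe x s hx hs
      rw [hKe, hA]
      have h4 : (0 : W) = (ε * θ x ^ 3) • (s + N (x, s) + ε • P (x, ε, N (x, s))) := by rw [h3, smul_zero]
      rw [h4]
      simp only [P, map_smul, ContinuousLinearMap.smul_apply, smul_add, smul_smul]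
      module
    simp [f, h2]

end HL
end QDC

namespace QDC
open Filter Topology
open scoped ContDiff
set_option linter.all false

noncomputable def etaC (v : ℝ) : ℝ := Real.smoothTransition (4 * v - 2)
theorem etaC_smooth : ContDiff ℝ ∞ etaC :=
  Real.smoothTransition.contDiff.comp ((contDiff_const.mul contDiff_id).sub contDiff_const)
theorem etaC_zero {v : ℝ} (h : v ≤ 1/2) : etaC v = 0 := Real.smoothTransition.zero_of_nonpos (by linarith)
theorem etaC_one {v : ℝ} (h : 3/4 ≤ v) : etaC v = 1 := Real.smoothTransition.one_of_one_le (by linarith)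

noncomputable def rhoC (v : ℝ) : ℝ := Real.smoothTransition (v + 1) * (1 - etaC v) * v / (1 - v)
theorem rhoC_smooth : ContDiff ℝ ∞ rhoC := by
  have hnum : ContDiff ℝ ∞ (fun v : ℝ => Real.smoothTransition (v + 1) * (1 - etaC v) * v) :=
    ((Real.smoothTransition.contDiff.comp (contDiff_id.add contDiff_const)).mul
      (contDiff_const.sub etaC_smooth)).mul contDiff_id
  rw [contDiff_iff_contDiffAt]
  intro v
  by_cases h : v < 1
  · exact hnum.contDiffAt.div (contDiff_const.sub contDiff_id).contDiffAt (by simp; linarith)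
  · have : rhoC =ᶠ[𝓝 v] fun _ => 0 := by
      filter_upwards [lt_mem_nhds (by linarith : (3/4:ℝ) < v)] with u hu
      simp [rhoC, etaC_one hu.le]
    exact contDiffAt_const.congr_of_eventuallyEq this
theorem rhoC_supp (v : ℝ) (h : v ∉ Set.Icc (-1:ℝ) 1) : rhoC v = 0 := by
  by_cases h1 : v < -1
  · simp [rhoC, Real.smoothTransition.zero_of_nonpos (by linarith : v + 1 ≤ 0)]
  · have : 1 < v := by
      by_contra h2
      exact h ⟨by linarith, by linarith⟩
    simp [rhoC, etaC_one (by linarith : 3/4 ≤ v)]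
theorem rhoC_eq (v : ℝ) (h0 : 0 < v) (h1 : v ≤ 1) : (1 - v) / v * rhoC v = 1 - etaC v := by
  rw [rhoC, Real.smoothTransition.one_of_one_le (by linarith)]
  rcases eq_or_lt_of_le h1 with rfl | h
  · simp [etaC_one (by norm_num : (3/4:ℝ) ≤ 1)]
  · have : 1 - v ≠ 0 := by linarith
    field_simp

section
variable {V : Type} [NormedAddCommGroup V] [NormedSpace ℝ V]

theorem hasFDerivAt_sigma {W : Type} [NormedAddCommGroup W] [NormedSpace ℝ W] (ε : ℝ) (hε : ε ≠ 0)
    (θ : V → ℝ) (hθ : ContDiff ℝ ∞ θ) (A : V → W) (hA : ContDiff ℝ ∞ A) (x : V) (hx : θ x ≠ 0) :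
    HasFDerivAt (fun x => (ε * θ x ^ 3)⁻¹ • A x)
      ((θ x)⁻¹ ^ 4 • (ε⁻¹ • (θ x • fderiv ℝ A x - (3:ℝ) • (fderiv ℝ θ x).smulRight (A x)))) x := by
  have h1 : HasDerivAt (fun t : ℝ => (ε * t ^ 3)⁻¹) (-3 * ε⁻¹ * (θ x)⁻¹ ^ 4) (θ x) := by
    have := (((hasDerivAt_pow 3 (θ x)).const_mul ε)).inv (by positivity)
    refine this.congr_deriv ?_
    field_simp
    norm_num
    ring
  have h2 := h1.comp_hasFDerivAt x (hθ.differentiable (by simp) x).hasFDerivAt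
  have h3 := h2.smul (hA.differentiable (by simp) x).hasFDerivAt
  refine h3.congr_fderiv ?_
  ext v
  simp only [ContinuousLinearMap.smul_apply, ContinuousLinearMap.add_apply, ContinuousLinearMap.sub_apply, ContinuousLinearMap.smulRight_apply, Function.comp_apply, smul_sub, smul_smul, smul_eq_mul]
  rw [sub_eq_add_neg, ← neg_smul]
  congr 2
  · field_simp
  · ring

theorem hasFDerivAt_vx {κ : Type} [Fintype κ] (ε : ℝ) (hε : ε ≠ 0) (θ : V → ℝ) (A : V → κ → ℝ)
    (B : V → V →L[ℝ] (κ → ℝ)) (x : V) (hx : θ x ≠ 0)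
    (h : HasFDerivAt (fun x => (ε * θ x ^ 3)⁻¹ • A x) ((θ x)⁻¹ ^ 4 • B x) x) :
    HasFDerivAt (fun x => (1 + ∑ i, ((ε * θ x ^ 3)⁻¹ • A x) i ^ 2)⁻¹)
      ((θ x)⁻¹ ^ 7 • ((-2 * ((1 + ∑ i, ((ε * θ x ^ 3)⁻¹ • A x) i ^ 2)⁻¹) ^ 2 * ε⁻¹) •
        ∑ i, A x i • (ContinuousLinearMap.proj i).comp (B x))) x := by
  have hi : ∀ i, HasFDerivAt (fun x => ((ε * θ x ^ 3)⁻¹ • A x) i)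
      ((ContinuousLinearMap.proj i).comp ((θ x)⁻¹ ^ 4 • B x)) x := fun i => (hasFDerivAt_pi'.1 h) i
  have h2 : HasFDerivAt (fun x => 1 + ∑ i, ((ε * θ x ^ 3)⁻¹ • A x) i ^ 2) _ x :=
    (HasFDerivAt.fun_sum (u := Finset.univ) fun i _ => (hi i).pow 2).const_add 1
  have hpos : (1 + ∑ i, ((ε * θ x ^ 3)⁻¹ • A x) i ^ 2) ≠ 0 := by
    have : 0 ≤ ∑ i, ((ε * θ x ^ 3)⁻¹ • A x) i ^ 2 := Finset.sum_nonneg fun i _ => sq_nonneg _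
    linarith
  have h3 := (hasDerivAt_inv hpos).comp_hasFDerivAt x h2
  refine h3.congr_fderiv ?_
  ext v
  simp only [ContinuousLinearMap.smul_apply, ContinuousLinearMap.sum_apply, ContinuousLinearMap.comp_apply, smul_eq_mul, Finset.mul_sum, ContinuousLinearMap.proj_apply, Pi.smul_apply]
  refine Finset.sum_congr rfl fun i _ => ?_
  simp only [nsmul_eq_mul, inv_pow]
  push_cast
  have e : (ε * θ x ^ 3)⁻¹ = ε⁻¹ * (θ x)⁻¹ ^ 3 := by rw [mul_inv, inv_pow]
  rw [show (θ x ^ 7)⁻¹ = (θ x)⁻¹ ^ 7 by rw [inv_pow], show (θ x ^ 4)⁻¹ = (θ x)⁻¹ ^ 4 by rw [inv_pow]]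
  generalize ((1 + ∑ i, ((ε * θ x ^ 3)⁻¹ * A x i) ^ 2) ^ 2)⁻¹ = c
  rw [e]; simp; ring
end

theorem hl_abs {V : Type} [NormedAddCommGroup V] [NormedSpace ℝ V] [FiniteDimensional ℝ V]
    {κ : Type} [Fintype κ] [DecidableEq κ] (θ : V → ℝ) (hθ : ContDiff ℝ ∞ θ) (A : V → κ → ℝ) (hA : ContDiff ℝ ∞ A)
    (K : V × (κ → ℝ) → (κ → ℝ)) (hK : ContDiff ℝ ∞ K) (hK0 : ∀ x, K (x, 0) = A x)
    (hK1 : ∀ x, HasFDerivAt (fun y => K (x, y)) (θ x • ContinuousLinearMap.id ℝ (κ → ℝ)) 0)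
    (L : (κ → ℝ) →L[ℝ] V) (F : ℕ → V → ℝ) (hF : ∀ m, ContDiff ℝ ∞ (F m))
    (hFc : ∀ m, HasCompactSupport (F m))
    (hFm : ∀ m x, F 0 x = θ x ^ m * F m x)
    (hvan : ∀ x y, θ x ≠ 0 → K (x, y) = 0 → F 0 (x + L y) = 0) :
    ∃ w : κ → V → ℝ, (∀ i, ContDiff ℝ ∞ (w i)) ∧ ∀ x, F 0 x = ∑ i, A x i * w i x := by
  haveI : ProperSpace V := FiniteDimensional.proper ℝ V
  obtain ⟨R0, hR0, hR0F⟩ : ∃ R0 : ℝ, 0 ≤ R0 ∧ ∀ x, R0 < ‖x‖ → F 0 x = 0 := by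
    obtain ⟨r, hr⟩ := (hFc 0).isBounded.subset_closedBall (0 : V)
    refine ⟨max r 0, le_max_right _ _, fun x hx => image_eq_zero_of_notMem_tsupport fun h => ?_⟩
    have := hr h
    rw [mem_closedBall_zero_iff] at this
    linarith [le_max_left r 0]
  let χ : ContDiffBump (0 : V) := ⟨R0 + 1, R0 + 2, by linarith, by linarith⟩
  have hχ : ContDiff ℝ ∞ χ := χ.contDiff
  have hχ1 : ∀ x, ‖x‖ ≤ R0 + 1 → χ x = 1 := fun x hx => χ.one_of_mem_closedBall (by simpa [χ] using hx)
  have hχ0 : ∀ x, R0 + 2 < ‖x‖ → χ x = 0 := fun x hx => χ.zero_of_le_dist (by simpa [χ] using hx.le)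
  obtain ⟨ε, hε, M, hM, hMm, hMe⟩ := hl_near (R0 + 2) (by linarith) θ hθ A K hK hK0 hK1 L F hF hFm hvan
  let σ : V → κ → ℝ := fun x => (ε * θ x ^ 3)⁻¹ • A x
  let q : (κ → ℝ) → ℝ := fun s => (1 + ∑ i, s i ^ 2)⁻¹
  have hsum0 : ∀ s : κ → ℝ, 0 ≤ ∑ i, s i ^ 2 := fun s => Finset.sum_nonneg fun i _ => sq_nonneg _
  have hq : ContDiff ℝ ∞ q := by
    refine ContDiff.inv ?_ (fun s => by linarith [hsum0 s])
    exact contDiff_const.add (ContDiff.sum fun i _ => (contDiff_apply ℝ ℝ i).pow 2)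
  have hq0 : ∀ s, 0 < q s := fun s => inv_pos.2 (by linarith [hsum0 s])
  have hq1 : ∀ s, q s ≤ 1 := fun s => inv_le_one_of_one_le₀ (by linarith [hsum0 s])
  have hqs : ∀ s, etaC (q s) ≠ 0 → ‖s‖ ≤ 1 := by
    intro s hs
    have h1 : 1/2 < q s := by
      by_contra h
      exact hs (etaC_zero (not_lt.1 h))
    have h2 : ∑ i, s i ^ 2 < 1 := by
      have h3 : q s * (1 + ∑ i, s i ^ 2) = 1 := inv_mul_cancel₀ (by linarith [hsum0 s])
      nlinarith [hsum0 s]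
    rw [pi_norm_le_iff_of_nonneg zero_le_one]
    intro i
    have h3 : s i ^ 2 ≤ ∑ i, s i ^ 2 := Finset.single_le_sum (f := fun i => s i ^ 2) (fun i _ => sq_nonneg _) (Finset.mem_univ i)
    rw [Real.norm_eq_abs]
    exact (sq_le_one_iff_abs_le_one _).1 (by linarith)
  let B : V → V →L[ℝ] (κ → ℝ) := fun x => ε⁻¹ • (θ x • fderiv ℝ A x - (3:ℝ) • (fderiv ℝ θ x).smulRight (A x))
  have hdθ : ContDiff ℝ ∞ (fderiv ℝ θ) := hθ.fderiv_right (m := ∞) (by simp)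
  have hdA : ContDiff ℝ ∞ (fderiv ℝ A) := hA.fderiv_right (m := ∞) (by simp)
  have hB : ContDiff ℝ ∞ B :=
    ((hθ.smul hdA).sub ((hdθ.smulRight hA).const_smul (3:ℝ))).const_smul ε⁻¹
  have hσ : ∀ x, θ x ≠ 0 → HasFDerivAt σ ((θ x)⁻¹ ^ 4 • B x) x := fun x hx =>
    hasFDerivAt_sigma ε hε.ne' θ hθ A hA x hx
  classical
  let near : κ → V → ℝ := fun i x => if θ x = 0 then 0 else
    χ x * etaC (q (σ x)) * M 0 (x, σ x) (Pi.single i 1) / (ε * θ x ^ 3)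
  let far : κ → V → ℝ := fun i x => if θ x = 0 then 0 else
    A x i * F 0 x * rhoC (q (σ x)) / (ε ^ 2 * θ x ^ 6)
  have hnear : ∀ i, ContDiff ℝ ∞ (near i) := by
    intro i
    refine FC.contDiff θ hθ σ 4 (fun p => B p.1) (hB.comp contDiff_fst) hσ ⟨fun x hx => by simp [near, hx], fun m => ?_⟩
    refine ⟨fun p => χ p.1 * etaC (q p.2) * M (m+3) p (Pi.single i 1) / ε, ?_, ?_, ?_⟩
    · exact (((hχ.comp contDiff_fst).mul (etaC_smooth.comp (hq.comp contDiff_snd))).mul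
        ((hM _).clm_apply contDiff_const)).div_const _
    · refine HasCompactSupport.intro ((isCompact_closedBall (0:V) (R0+2)).prod (isCompact_closedBall (0:κ → ℝ) 1)) fun p hp => ?_
      by_cases h1 : ‖p.1‖ ≤ R0 + 2
      · by_cases h2 : etaC (q p.2) = 0
        · simp [h2]
        · exact absurd ⟨by simpa using h1, by simpa using hqs _ h2⟩ hp
      · simp [hχ0 _ (not_le.1 h1)]
    · intro x hx
      simp only [near, if_neg hx]
      rw [hMm (m+3)]
      simp only [ContinuousLinearMap.smul_apply, smul_eq_mul]
      field_simp
      ring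
  have hfar : ∀ i, ContDiff ℝ ∞ (far i) := by
    intro i
    refine FC.contDiff θ hθ (fun x => q (σ x)) 7 (fun p => (-2 * p.2 ^ 2 * ε⁻¹) •
        ∑ i, A p.1 i • (ContinuousLinearMap.proj i : (κ → ℝ) →L[ℝ] ℝ).comp (B p.1)) ?_
        (fun x hx => hasFDerivAt_vx ε hε.ne' θ A B x hx (hσ x hx))
        ⟨fun x hx => by simp [far, hx], fun m => ?_⟩
    · refine ContDiff.smul ((contDiff_const.mul (contDiff_snd.pow 2)).mul contDiff_const) (ContDiff.sum fun i _ => ?_)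
      exact (((contDiff_apply ℝ ℝ i).comp hA).comp contDiff_fst).smul (contDiff_const.clm_comp (hB.comp contDiff_fst))
    · refine ⟨fun p => A p.1 i * F (m+6) p.1 * rhoC p.2 / ε ^ 2, ?_, ?_, ?_⟩
      · exact (((((contDiff_apply ℝ ℝ i).comp hA).comp contDiff_fst).mul ((hF _).comp contDiff_fst)).mul
          (rhoC_smooth.comp contDiff_snd)).div_const _
      · refine HasCompactSupport.intro ((hFc (m+6)).prod (isCompact_Icc (a := (-1:ℝ)) (b := 1))) fun p hp => ?_
        by_cases h1 : p.1 ∈ tsupport (F (m+6))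
        · rw [rhoC_supp p.2 (fun h => hp ⟨h1, h⟩)]; simp
        · rw [image_eq_zero_of_notMem_tsupport h1]; simp
      · intro x hx
        simp only [far, if_neg hx]
        rw [hFm (m+6)]
        simp only [smul_eq_mul]
        field_simp
        ring
  refine ⟨fun i x => near i x + far i x, fun i => (hnear i).add (hfar i), fun x => ?_⟩
  by_cases hx : θ x = 0
  · simp only [near, far, if_pos hx]
    rw [hFm 1, hx]; simp
  · have hA' : A x = (ε * θ x ^ 3) • σ x := by
      simp only [σ]; rw [smul_smul, mul_inv_cancel₀ (by positivity), one_smul]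
    have hAi : ∀ i, A x i = ε * θ x ^ 3 * σ x i := fun i => by
      have := congrFun hA' i; simpa using this
    have h1 : ∑ i, A x i * near i x = etaC (q (σ x)) * F 0 x := by
      have h2 : ∑ i, A x i * near i x = χ x * etaC (q (σ x)) * ∑ i, σ x i * M 0 (x, σ x) (Pi.single i 1) := by
        rw [Finset.mul_sum]
        refine Finset.sum_congr rfl fun i _ => ?_
        simp only [near, if_neg hx]
        rw [hAi]; field_simp
      have h3 : ∑ i, σ x i * M 0 (x, σ x) (Pi.single i 1) = M 0 (x, σ x) (σ x) := by
        generalize M 0 (x, σ x) = D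
        conv_rhs => rw [pi_eq_sum_univ' (σ x)]
        rw [map_sum]
        refine Finset.sum_congr rfl fun i _ => ?_
        rw [map_smul, smul_eq_mul]
      rw [h2, h3]
      by_cases he : etaC (q (σ x)) = 0
      · simp [he]
      · by_cases hn : ‖x‖ ≤ R0 + 2
        · rw [← hMe x (σ x) hn (hqs _ he) hx hA']
          by_cases hn' : ‖x‖ ≤ R0 + 1
          · rw [hχ1 x hn', one_mul]
          · rw [hR0F x (by linarith)]; simp
        · rw [hχ0 x (not_le.1 hn), hR0F x (by linarith)]; simp
    have h2 : ∑ i, A x i * far i x = (1 - etaC (q (σ x))) * F 0 x := by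
      have h3 : ∑ i, A x i * far i x = (∑ i, σ x i ^ 2) * rhoC (q (σ x)) * F 0 x := by
        rw [Finset.sum_mul, Finset.sum_mul]
        refine Finset.sum_congr rfl fun i _ => ?_
        simp only [far, if_neg hx]
        rw [hAi]; field_simp
      rw [h3, ← rhoC_eq _ (hq0 _) (hq1 _)]
      congr 2
      have : q (σ x) * (1 + ∑ i, σ x i ^ 2) = 1 := inv_mul_cancel₀ (by linarith [hsum0 (σ x)])
      have hne := (hq0 (σ x)).ne'
      rw [eq_div_iff hne]
      linarith
    simp only [mul_add, Finset.sum_add_distrib]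
    rw [h1, h2]; ring

end QDC

namespace QDC
open Filter Topology
open scoped ContDiff Matrix
set_option linter.all false

theorem contDiff_det {V : Type} [NormedAddCommGroup V] [NormedSpace ℝ V] {κ : Type} [Fintype κ] [DecidableEq κ]
    (M : V → Matrix κ κ ℝ) (h : ∀ i j, ContDiff ℝ ∞ fun x => M x i j) : ContDiff ℝ ∞ fun x => (M x).det := by
  simp only [Matrix.det_apply]
  refine ContDiff.sum fun s _ => ?_
  have : ContDiff ℝ ∞ fun x => ∏ i, M x (s i) i := contDiff_prod fun i _ => h _ _
  exact this.const_smul (Equiv.Perm.sign s : ℤˣ)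

theorem contDiff_adj {V : Type} [NormedAddCommGroup V] [NormedSpace ℝ V] {κ : Type} [Fintype κ] [DecidableEq κ]
    (M : V → Matrix κ κ ℝ) (h : ∀ i j, ContDiff ℝ ∞ fun x => M x i j) (i j : κ) :
    ContDiff ℝ ∞ fun x => (M x).adjugate i j := by
  simp only [Matrix.adjugate_apply]
  refine contDiff_det _ fun a b => ?_
  by_cases hab : a = j
  · subst hab
    simp only [Matrix.updateRow_self]
    exact contDiff_const
  · simp only [Matrix.updateRow_ne hab]
    exact h a b

theorem hl_main {V : Type} [NormedAddCommGroup V] [NormedSpace ℝ V] [FiniteDimensional ℝ V]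
    {κ : Type} [Fintype κ] [DecidableEq κ] (H : κ → V → ℝ) (hH : ∀ i, ContDiff ℝ ∞ (H i)) (e : κ → V)
    (θ : V → ℝ) (hθd : ∀ x, θ x = (Matrix.of fun i j => fderiv ℝ (H i) x (e j)).det)
    (F : ℕ → V → ℝ) (hF : ∀ m, ContDiff ℝ ∞ (F m))
    (hFc : ∀ m, HasCompactSupport (F m))
    (hFm : ∀ m x, F 0 x = θ x ^ m * F m x)
    (hvan : ∀ y, (∀ i, H i y = 0) → F 0 y = 0) :
    ∃ w : κ → V → ℝ, (∀ i, ContDiff ℝ ∞ (w i)) ∧ ∀ x, F 0 x = ∑ i, H i x * w i x := by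
  let J : V → Matrix κ κ ℝ := fun x => Matrix.of fun i j => fderiv ℝ (H i) x (e j)
  have hJ : ∀ i j, ContDiff ℝ ∞ fun x => J x i j := fun i j =>
    ((hH i).fderiv_right (m := ∞) (by simp)).clm_apply contDiff_const
  have hθ : ContDiff ℝ ∞ θ := by
    rw [show θ = fun x => (J x).det from funext hθd]; exact contDiff_det J hJ
  let C : V → Matrix κ κ ℝ := fun x => (J x).adjugate
  have hC : ∀ i j, ContDiff ℝ ∞ fun x => C x i j := contDiff_adj J hJ
  have hCJ : ∀ x, C x * J x = θ x • 1 := fun x => by rw [hθd]; exact Matrix.adjugate_mul _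
  have hJC : ∀ x, J x * C x = θ x • 1 := fun x => by rw [hθd]; exact Matrix.mul_adjugate _
  let A : V → κ → ℝ := fun x i => ∑ k, C x i k * H k x
  have hA : ContDiff ℝ ∞ A := contDiff_pi.2 fun i => ContDiff.sum fun k _ => (hC i k).mul (hH k)
  let L : (κ → ℝ) →L[ℝ] V := ∑ j, (ContinuousLinearMap.proj (R := ℝ) (φ := fun _ : κ => ℝ) j).smulRight (e j)
  have hL : ∀ y, L y = ∑ j, y j • e j := fun y => by simp [L]
  let K : V × (κ → ℝ) → κ → ℝ := fun p i => ∑ k, C p.1 i k * H k (p.1 + L p.2)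
  have hK : ContDiff ℝ ∞ K := contDiff_pi.2 fun i => ContDiff.sum fun k _ =>
    ((hC i k).comp contDiff_fst).mul ((hH k).comp (contDiff_fst.add (L.contDiff.comp contDiff_snd)))
  have hK1 : ∀ x, HasFDerivAt (fun y => K (x, y)) (θ x • ContinuousLinearMap.id ℝ (κ → ℝ)) 0 := by
    intro x
    rw [hasFDerivAt_pi']
    intro i
    have h1 : ∀ k, HasFDerivAt (fun y => C x i k * H k (x + L y)) (C x i k • ((fderiv ℝ (H k) x).comp L)) 0 := by
      intro k
      have h2 : HasFDerivAt (H k) (fderiv ℝ (H k) x) (x + L 0) := by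
        rw [map_zero, add_zero]
        exact ((hH k).differentiable (by simp) x).hasFDerivAt
      have h3 : HasFDerivAt (fun y => x + L y) L 0 := L.hasFDerivAt.const_add x
      exact (HasFDerivAt.comp (0 : κ → ℝ) h2 h3).const_mul (C x i k)
    refine (HasFDerivAt.fun_sum (u := Finset.univ) fun k _ => h1 k).congr_fderiv ?_
    ext y
    have h4 : ∀ j, ∑ k, C x i k * J x k j = θ x * (if i = j then 1 else 0) := fun j => by
      have := congrFun (congrFun (hCJ x) i) j
      simpa [Matrix.mul_apply, Matrix.one_apply] using this
    have h5 : (∑ k, C x i k • (fderiv ℝ (H k) x).comp L) y = ∑ j, (∑ k, C x i k * J x k j) * y j := by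
      simp only [ContinuousLinearMap.sum_apply, ContinuousLinearMap.smul_apply, ContinuousLinearMap.comp_apply, hL, map_sum, map_smul, smul_eq_mul, Finset.mul_sum, Finset.sum_mul]
      rw [Finset.sum_comm]
      refine Finset.sum_congr rfl fun j _ => Finset.sum_congr rfl fun k _ => ?_
      simp only [J, Matrix.of_apply]; ring
    rw [h5]
    simp [h4]
  have hv : ∀ x y, θ x ≠ 0 → K (x, y) = 0 → F 0 (x + L y) = 0 := by
    intro x y hx hKy
    apply hvan
    intro k
    have h1 : J x *ᵥ (C x *ᵥ fun k => H k (x + L y)) = 0 := by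
      have : (C x *ᵥ fun k => H k (x + L y)) = K (x, y) := by
        ext i; simp [K, Matrix.mulVec, dotProduct]
      rw [this, hKy, Matrix.mulVec_zero]
    rw [Matrix.mulVec_mulVec, hJC, Matrix.smul_mulVec, Matrix.one_mulVec] at h1
    have := congrFun h1 k
    simpa [hx] using this
  obtain ⟨w, hw, hwe⟩ := hl_abs θ hθ A hA K hK (fun x => by ext i; simp [K, A]) hK1 L F hF hFc hFm hv
  refine ⟨fun k x => ∑ i, C x i k * w i x, fun k => ContDiff.sum fun i _ => (hC i k).mul (hw i), fun x => ?_⟩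
  rw [hwe]
  simp only [A, Finset.sum_mul, Finset.mul_sum]
  rw [Finset.sum_comm]
  refine Finset.sum_congr rfl fun i _ => Finset.sum_congr rfl fun k _ => ?_
  ring
end QDC

namespace QDC
open Filter Topology
open scoped ContDiff
set_option linter.all false

section good
variable {n : ℕ}

/-- smooth with support in the ball -/
def SB (R : ℝ) (g : (Fin n → ℝ) → ℝ) : Prop := ContDiff ℝ ∞ g ∧ tsupport g ⊆ Metric.ball 0 R

theorem SB.of {R : ℝ} {g : (Fin n → ℝ) → ℝ} (K : Set (Fin n → ℝ)) (hK : IsClosed K) (hKR : K ⊆ Metric.ball 0 R)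
    (h0 : ∀ x ∉ K, g x = 0) (hs : ∀ x ∈ Metric.ball (0 : Fin n → ℝ) R, Sm x g) : SB R g := by
  have ht : tsupport g ⊆ K := by
    apply closure_minimal _ hK
    intro x hx
    by_contra hxK
    exact hx (h0 x hxK)
  refine ⟨contDiff_iff_contDiffAt.2 fun x => ?_, ht.trans hKR⟩
  by_cases hx : x ∈ K
  · exact hs x (hKR hx)
  · have : g =ᶠ[𝓝 x] fun _ => 0 := by
      filter_upwards [hK.isOpen_compl.mem_nhds hx] with y hy using h0 y hy
    exact contDiffAt_const.congr_of_eventuallyEq this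

theorem SB.sm {R : ℝ} {g : (Fin n → ℝ) → ℝ} (h : SB R g) (a) : Sm a g := h.1.contDiffAt

theorem SB.mul_rep {R : ℝ} {g ψ : (Fin n → ℝ) → ℝ} (h : SB R g) (hψ : ∀ x ∈ Metric.ball (0 : Fin n → ℝ) R, Sm x ψ) :
    SB R (fun x => g x * ψ x) := by
  refine SB.of (tsupport g) (isClosed_tsupport g) h.2 (fun x hx => ?_) fun x hx => ContDiffAt.mul h.1.contDiffAt (hψ x hx)
  rw [image_eq_zero_of_notMem_tsupport hx, zero_mul]

theorem SB.add {R : ℝ} {g ψ : (Fin n → ℝ) → ℝ} (h : SB R g) (hψ : SB R ψ) : SB R (fun x => g x + ψ x) :=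
  ⟨h.1.add hψ.1, (tsupport_add g ψ).trans (Set.union_subset h.2 hψ.2)⟩

theorem SB.zero {R : ℝ} : SB R (fun _ : Fin n → ℝ => (0 : ℝ)) :=
  SB.of ∅ isClosed_empty (by simp) (fun _ _ => rfl) fun _ _ => contDiffAt_const

theorem SB.neg {R : ℝ} {g : (Fin n → ℝ) → ℝ} (h : SB R g) : SB R (fun x => - g x) := by
  refine SB.of (tsupport g) (isClosed_tsupport g) h.2 (fun x hx => ?_) fun x hx => h.1.contDiffAt.neg
  rw [image_eq_zero_of_notMem_tsupport hx, neg_zero]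

theorem SB.sum {R : ℝ} {α : Type*} (s : Finset α) (g : α → (Fin n → ℝ) → ℝ) (h : ∀ i ∈ s, SB R (g i)) :
    SB R (fun x => ∑ i ∈ s, g i x) := by
  classical
  induction s using Finset.induction_on with
  | empty => simpa using SB.zero
  | insert i s hi ih =>
    simp only [Finset.sum_insert hi]
    exact (h i (by simp)).add (ih fun j hj => h j (by simp [hj]))

/-- formal ideal -/
noncomputable def FI {ι : Type} (a : Fin n → ℝ) (φ : ι → O n) : Ideal (MvPowerSeries (Fin n) ℝ) :=
  Ideal.span (Set.range fun j => TT a (φ j))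

theorem mem_FI {ι : Type} [Fintype ι] (a : Fin n → ℝ) (φ : ι → O n) (T : MvPowerSeries (Fin n) ℝ) :
    T ∈ FI a φ ↔ ∃ c : ι → MvPowerSeries (Fin n) ℝ, ∑ i, c i * TT a (φ i) = T :=
  Ideal.mem_span_range_iff_exists_fun

theorem ev_ball {P : (Fin n → ℝ) → Prop} (h : ∀ᶠ a in 𝓝 (0 : Fin n → ℝ), P a) :
    ∀ᶠ R in 𝓝[>] (0 : ℝ), ∀ a ∈ Metric.ball (0 : Fin n → ℝ) R, P a := by
  obtain ⟨ε, hε, h⟩ := Metric.eventually_nhds_iff_ball.1 h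
  filter_upwards [Ioo_mem_nhdsGT hε] with R hR a ha
  exact h a (Metric.ball_subset_ball hR.2.le ha)

theorem taylor_comb {α : Type*} [Fintype α] (a : Fin n → ℝ) (f : (Fin n → ℝ) → ℝ) (g ψ : α → (Fin n → ℝ) → ℝ)
    (hg : ∀ i, Sm a (g i)) (hψ : ∀ i, Sm a (ψ i)) (h : ∀ᶠ x in 𝓝 a, f x = ∑ i, g i x * ψ i x) :
    taylorAt f a = ∑ i, taylorAt (g i) a * taylorAt (ψ i) a := by
  rw [taylorAt_congr h, taylorAt_sum Finset.univ (fun i x => g i x * ψ i x) fun i _ => (hg i).mul' (hψ i)]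
  exact Finset.sum_congr rfl fun i _ => taylorAt_mul (hg i) (hψ i)

/-- division property on a ball -/
def GoodR {ι : Type} [Fintype ι] (φ : ι → O n) (R : ℝ) : Prop :=
  ∀ f, SB R f → (∀ a ∈ Metric.ball (0 : Fin n → ℝ) R, taylorAt f a ∈ FI a φ) →
    ∃ g : ι → (Fin n → ℝ) → ℝ, (∀ j, SB R (g j)) ∧ ∀ x, f x = ∑ j, g j x * rep (φ j) x

def Good {ι : Type} [Fintype ι] (φ : ι → O n) : Prop := ∀ᶠ R in 𝓝[>] (0 : ℝ), GoodR φ R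

theorem colon_flat {ι β : Type} [Fintype ι] [Fintype β] (φ : ι → O n) (ψ : β → O n) (a0 : O n)
    (h : ∀ x, a0 * x ∈ Ideal.span (Set.range φ) → x ∈ Ideal.span (Set.range ψ)) :
    ∀ᶠ a in 𝓝 (0 : Fin n → ℝ), ∀ T, T * TT a a0 ∈ FI a φ → T ∈ FI a ψ := by
  obtain ⟨κ, _, c, hc, hr⟩ := relGood_all (fun o : Option ι => o.elim a0 φ)
  have h1 : ∀ k, c k none ∈ Ideal.span (Set.range ψ) := by
    intro k
    apply h
    have := hc k
    rw [Fintype.sum_option] at this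
    simp only [Option.elim] at this
    rw [Ideal.mem_span_range_iff_exists_fun]
    refine ⟨fun j => - c k (some j), ?_⟩
    simp only [neg_mul, Finset.sum_neg_distrib]
    linear_combination -this
  choose b hb using fun k => Ideal.mem_span_range_iff_exists_fun.1 (h1 k)
  have h2 : ∀ᶠ a in 𝓝 (0 : Fin n → ℝ), ∀ k, TT a (c k none) = ∑ i, TT a (b k i) * TT a (ψ i) :=
    eventually_all.2 fun k => by
      rw [← hb k]; exact TT_dot _ _
  filter_upwards [hr, h2] with a hra h2a T hT
  obtain ⟨u, hu⟩ := (mem_FI _ _ _).1 hT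
  obtain ⟨v, hv⟩ := hra (fun o => o.elim T (fun j => - u j)) (by
    rw [Fintype.sum_option]
    simp only [Option.elim, neg_mul, Finset.sum_neg_distrib]
    rw [hu]; ring)
  have := hv none
  simp only [Option.elim] at this
  rw [this]
  refine Ideal.sum_mem _ fun k _ => Ideal.mul_mem_left _ _ ?_
  rw [h2a]
  exact (mem_FI _ _ _).2 ⟨_, rfl⟩

theorem rep_dot {α : Type*} [Fintype α] (x y : α → O n) :
    ∀ᶠ a in 𝓝 (0 : Fin n → ℝ), rep (∑ j, x j * y j) a = ∑ j, rep (x j) a * rep (y j) a := by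
  have h : ∀ᶠ a in 𝓝 (0 : Fin n → ℝ), ∀ j, rep (x j * y j) a = rep (x j) a * rep (y j) a :=
    eventually_all.2 fun j => rep_mul _ _
  filter_upwards [rep_sum Finset.univ (fun j => x j * y j), h] with a h1 h2
  rw [h1]; exact Finset.sum_congr rfl fun j _ => h2 j

theorem good_top {ι : Type} [Fintype ι] (φ : ι → O n) (h : Ideal.span (Set.range φ) = ⊤) : Good φ := by
  obtain ⟨c, hc⟩ := Ideal.mem_span_range_iff_exists_fun.1 (h ▸ Submodule.mem_top : (1 : O n) ∈ Ideal.span (Set.range φ))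
  filter_upwards [ev_ball (rep_dot c φ), ev_ball (eventually_all.2 fun j => rep_smooth (c j)), ev_ball rep_one] with R h1 h2 h3 f hf _
  refine ⟨fun j x => f x * rep (c j) x, fun j => hf.mul_rep fun x hx => h2 x hx j, fun x => ?_⟩
  by_cases hx : x ∈ Metric.ball (0 : Fin n → ℝ) R
  · have := h1 x hx
    rw [hc, h3 x hx] at this
    simp only [mul_assoc, ← Finset.mul_sum]
    rw [← this, mul_one]
  · have : f x = 0 := image_eq_zero_of_notMem_tsupport fun h => hx (hf.2 h)
    simp [this]

theorem good_nonprime {ι : Type} [Fintype ι] (φ : ι → O n) (a0 : O n) {r : ℕ} (ψ : Fin r → O n)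
    (hψ : Ideal.span (Set.range ψ) = colonI (Ideal.span (Set.range φ)) a0)
    (g1 : Good (fun o : Option ι => o.elim a0 φ)) (g2 : Good ψ) : Good φ := by
  have hb : ∀ l, a0 * ψ l ∈ Ideal.span (Set.range φ) := fun l => by
    rw [← mem_colonI, ← hψ]; exact Ideal.subset_span ⟨l, rfl⟩
  choose b hb using fun l => Ideal.mem_span_range_iff_exists_fun.1 (hb l)
  have hcf := colon_flat φ ψ a0 (fun x hx => by rw [hψ]; exact hx)
  have e1 : ∀ᶠ a in 𝓝 (0 : Fin n → ℝ), ∀ l, rep a0 a * rep (ψ l) a = ∑ j, rep (b l j) a * rep (φ j) a :=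
    eventually_all.2 fun l => by
      filter_upwards [rep_mul a0 (ψ l), rep_dot (b l) φ] with x h1 h2
      rw [← h2, hb l, h1]; rfl
  filter_upwards [g1, g2, ev_ball hcf, ev_ball e1, ev_ball (eventually_all.2 fun l => eventually_all.2 fun j => rep_smooth (b l j)),
    ev_ball (rep_smooth a0), ev_ball (eventually_all.2 fun j => rep_smooth (φ j))] with R g1 g2 hcf e1 sb sa sφ f hf hfor
  obtain ⟨u, hu, huf⟩ := g1 f hf (fun a ha => by
    obtain ⟨c, hc⟩ := (mem_FI _ _ _).1 (hfor a ha)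
    refine (mem_FI _ _ _).2 ⟨fun o => o.elim 0 c, ?_⟩
    rw [Fintype.sum_option]
    simpa using hc)
  obtain ⟨y, hy, hyw⟩ := g2 (u none) (hu none) (fun a ha => hcf a ha _ (by
    have := taylor_comb a f u (fun o : Option ι => rep (o.elim a0 φ)) (fun o => (hu o).sm a)
      (fun o => by cases o with
        | none => exact sa a ha
        | some j => exact sφ a ha j) (Eventually.of_forall huf)
    rw [Fintype.sum_option] at this
    simp only [Option.elim] at this
    rw [show taylorAt (u none) a * TT a a0 = taylorAt f a - ∑ i, taylorAt (u (some i)) a * taylorAt (rep (φ i)) a by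
      rw [this]; ring]
    exact Ideal.sub_mem _ (hfor a ha) ((mem_FI _ _ _).2 ⟨_, rfl⟩)))
  refine ⟨fun j x => u (some j) x + ∑ l, y l x * rep (b l j) x, fun j => (hu _).add (SB.sum _ _ fun l _ => (hy l).mul_rep fun x hx => sb x hx l j), fun x => ?_⟩
  by_cases hx : x ∈ Metric.ball (0 : Fin n → ℝ) R
  · rw [huf x, Fintype.sum_option, hyw x]
    simp only [Option.elim]
    have : (∑ j, y j x * rep (ψ j) x) * rep a0 x = ∑ j, (∑ l, y l x * rep (b l j) x) * rep (φ j) x := by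
      rw [Finset.sum_mul]
      simp only [Finset.sum_mul]
      rw [Finset.sum_comm]
      refine Finset.sum_congr rfl fun l _ => ?_
      rw [mul_assoc, mul_comm (rep (ψ l) x), e1 x hx l, Finset.mul_sum]
      exact Finset.sum_congr rfl fun j _ => by ring
    rw [this, ← Finset.sum_add_distrib]
    simp only [add_mul]
    exact Finset.sum_congr rfl fun j _ => by ring
  · have z : ∀ {g : (Fin n → ℝ) → ℝ}, SB R g → g x = 0 := fun hg => image_eq_zero_of_notMem_tsupport fun h => hx (hg.2 h)
    rw [z hf]
    simp only [z (hu _), z (hy _), zero_mul, Finset.sum_const_zero, add_zero]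

theorem exists_bump {R : ℝ} {K : Set (Fin n → ℝ)} (hK : IsClosed K) (hKR : K ⊆ Metric.ball 0 R) (hR : 0 < R) :
    ∃ χ : (Fin n → ℝ) → ℝ, SB R χ ∧ IsCompact (tsupport χ) ∧ ∀ x ∈ K, ∀ᶠ y in 𝓝 x, χ y = 1 := by
  have hKc : IsCompact K := by
    apply Metric.isCompact_of_isClosed_isBounded hK
    exact Metric.isBounded_ball.subset hKR
  obtain ⟨r, hr, hrR, hK'⟩ : ∃ r, 0 < r ∧ r < R ∧ K ⊆ Metric.ball 0 r := by
    rcases K.eq_empty_or_nonempty with h | h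
    · exact ⟨R / 2, by linarith, by linarith, by simp [h]⟩
    · obtain ⟨x, hx, hm⟩ := hKc.exists_isMaxOn h continuous_norm.continuousOn
      have h1 : ‖x‖ < R := by simpa using hKR hx
      refine ⟨(‖x‖ + R) / 2, by positivity, by linarith, fun y hy => ?_⟩
      have h2 : ‖y‖ ≤ ‖x‖ := hm hy
      simp only [Metric.mem_ball, dist_zero_right]
      linarith
  let χ : ContDiffBump (0 : Fin n → ℝ) := ⟨r, (r + R) / 2, hr, by linarith⟩
  refine ⟨χ, ⟨χ.contDiff, ?_⟩, χ.hasCompactSupport, fun x hx => ?_⟩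
  · rw [χ.tsupport_eq]
    exact Metric.closedBall_subset_ball (by simp only [χ]; linarith)
  · filter_upwards [Metric.isOpen_ball.mem_nhds (hK' hx)] with y hy
    exact χ.one_of_mem_closedBall (Metric.ball_subset_closedBall hy)

theorem rep_det {κ : Type} [Fintype κ] [DecidableEq κ] (M : Matrix κ κ (O n)) :
    ∀ᶠ a in 𝓝 0, rep M.det a = (Matrix.of fun i j => rep (M i j) a).det := by
  let N : Matrix κ κ ((Fin n → ℝ) → ℝ) := Matrix.of fun i j => rep (M i j)
  have hs : ∀ φ : O n, (Osub n).subtype φ = ((rep φ : (Fin n → ℝ) → ℝ) : Germ (𝓝 (0 : Fin n → ℝ)) ℝ) := fun φ => φ.2.choose_spec.2.symm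
  have h1 : (Osub n).subtype M.det = ((N.det : (Fin n → ℝ) → ℝ) : Germ (𝓝 (0 : Fin n → ℝ)) ℝ) := by
    rw [RingHom.map_det]
    have := (RingHom.map_det (Germ.coeRingHom (R := ℝ) (𝓝 (0 : Fin n → ℝ))) N).symm
    refine Eq.trans ?_ this
    congr 1
    ext i j
    simp only [RingHom.mapMatrix_apply, Matrix.map_apply]
    exact hs _
  rw [hs] at h1
  have h2 : ∀ᶠ a in 𝓝 0, rep M.det a = N.det a := Germ.coe_eq.1 h1
  filter_upwards [h2] with a ha
  rw [ha]
  exact RingHom.map_det (Pi.evalRingHom (fun _ => ℝ) a) N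

end good
end QDC

namespace QDC
open Filter Topology
open scoped ContDiff
set_option linter.all false

section goodprime
variable {n : ℕ}

theorem prime_core {ι κ : Type} [Fintype ι] [Fintype κ] [DecidableEq κ] {R : ℝ} (hR : 0 < R)
    (dl dl' th : (Fin n → ℝ) → ℝ) (ph : ι → (Fin n → ℝ) → ℝ) (hh : κ → (Fin n → ℝ) → ℝ) (e : κ → (Fin n → ℝ))
    (E : κ → ι → (Fin n → ℝ) → ℝ) (B : ι → κ → (Fin n → ℝ) → ℝ)
    (sdl : ∀ x ∈ Metric.ball (0 : Fin n → ℝ) R, Sm x dl) (sdl' : ∀ x ∈ Metric.ball (0 : Fin n → ℝ) R, Sm x dl')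
    (sph : ∀ x ∈ Metric.ball (0 : Fin n → ℝ) R, ∀ j, Sm x (ph j))
    (shh : ∀ x ∈ Metric.ball (0 : Fin n → ℝ) R, ∀ i, Sm x (hh i))
    (sE : ∀ x ∈ Metric.ball (0 : Fin n → ℝ) R, ∀ i j, Sm x (E i j))
    (e1 : ∀ x ∈ Metric.ball (0 : Fin n → ℝ) R, dl x = th x * dl' x)
    (e2 : ∀ x ∈ Metric.ball (0 : Fin n → ℝ) R, th x = (Matrix.of fun i j => fderiv ℝ (hh i) x (e j)).det)
    (e3 : ∀ x ∈ Metric.ball (0 : Fin n → ℝ) R, ∀ i, hh i x = ∑ j, E i j x * ph j x)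
    (e4 : ∀ x ∈ Metric.ball (0 : Fin n → ℝ) R, ∀ j, dl x * ph j x = ∑ i, B j i x * hh i x)
    (Pr : ((Fin n → ℝ) → ℝ) → Prop) (hSB : ∀ f, Pr f → SB R f)
    (hPv : ∀ f, Pr f → ∀ y ∈ Metric.ball (0 : Fin n → ℝ) R, (∀ j, ph j y = 0) → f y = 0)
    (step : ∀ f, Pr f → ∃ f' : (Fin n → ℝ) → ℝ, ∃ u : ι → (Fin n → ℝ) → ℝ, Pr f' ∧ (∀ j, SB R (u j)) ∧
      ∀ x, f x = dl x * f' x + ∑ j, u j x * ph j x)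
    (f : (Fin n → ℝ) → ℝ) (hf : Pr f) :
    ∃ g : ι → (Fin n → ℝ) → ℝ, (∀ j, SB R (g j)) ∧ ∀ x, f x = ∑ j, g j x * ph j x := by
  choose nx U hnx hU hstep using step
  let s : ℕ → {f // Pr f} := fun m => Nat.rec ⟨f, hf⟩ (fun _ p => ⟨nx p.1 p.2, hnx p.1 p.2⟩) m
  let fs : ℕ → (Fin n → ℝ) → ℝ := fun m => (s m).1
  let u : ℕ → ι → (Fin n → ℝ) → ℝ := fun m => U (s m).1 (s m).2
  have hfs : ∀ m, Pr (fs m) := fun m => (s m).2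
  have hu : ∀ m j, SB R (u m j) := fun m => hU _ _
  have hfu : ∀ m x, fs m x = dl x * fs (m + 1) x + ∑ j, u m j x * ph j x := fun m x => hstep (s m).1 (s m).2 x
  have hf0 : fs 0 = f := rfl
  obtain ⟨χ, hχ, hχc, hχ1⟩ := exists_bump (isClosed_tsupport f) (hSB f hf).2 hR
  obtain ⟨χ2, hχ2, hχ2c, hχ21⟩ := exists_bump (isClosed_tsupport χ) hχ.2 hR
  set K := tsupport χ with hK
  have hχ0 : ∀ x ∉ K, χ x = 0 := fun x hx => image_eq_zero_of_notMem_tsupport hx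
  have hKb : K ⊆ Metric.ball 0 R := hχ.2
  have hBo : ∀ j, ∃ Γ : ℕ → (Fin n → ℝ) × ℝ → ℝ, (∀ m, ContDiff ℝ ∞ (Γ m)) ∧ (∀ m, ∀ x ∉ K, ∀ t, Γ m (x, t) = 0) ∧
      ∀ m x t, Γ m (x, t) = χ x * u m j x + t * Γ (m + 1) (x, t) := fun j =>
    borel_param K hχc (fun m x => χ x * u m j x) (fun m => hχ.1.mul (hu m j).1) (fun m x hx => by rw [hχ0 x hx, zero_mul])
  choose Γ hΓs hΓ0 hΓ using hBo
  have hGs : ∀ j m, SB R (fun x => Γ j m (x, dl x)) := fun j m =>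
    SB.of K (isClosed_tsupport χ) hKb (fun x hx => hΓ0 j m x hx _) fun x hx =>
      ContDiffAt.comp x (hΓs j m).contDiffAt (contDiffAt_id.prodMk (sdl x hx))
  let F : ℕ → (Fin n → ℝ) → ℝ := fun m x => χ x * fs m x - ∑ j, Γ j m (x, dl x) * ph j x
  have hF0 : ∀ m, ∀ x ∉ K, F m x = 0 := fun m x hx => by
    simp only [F, hχ0 x hx, hΓ0 _ m x hx, zero_mul, Finset.sum_const_zero, sub_zero]
  have hFsm : ∀ m, ∀ x ∈ Metric.ball (0 : Fin n → ℝ) R, Sm x (F m) := fun m x hx =>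
    ContDiffAt.sub (ContDiffAt.mul (hχ.sm x) ((hSB _ (hfs m)).sm x))
      (ContDiffAt.sum fun j _ => ContDiffAt.mul ((hGs j m).sm x) (sph x hx j))
  have hFrec : ∀ m x, F m x = dl x * F (m + 1) x := by
    intro m x
    simp only [F]
    rw [hfu m x]
    have : ∑ j, Γ j m (x, dl x) * ph j x = χ x * ∑ j, u m j x * ph j x + dl x * ∑ j, Γ j (m + 1) (x, dl x) * ph j x := by
      rw [Finset.mul_sum, Finset.mul_sum, ← Finset.sum_add_distrib]
      refine Finset.sum_congr rfl fun j _ => ?_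
      rw [hΓ j m]; ring
    rw [this]; ring
  have hFp : ∀ m x, F 0 x = dl x ^ m * F m x := by
    intro m x
    induction m with
    | zero => simp
    | succ m ih => rw [ih, hFrec m x]; ring
  let F' : ℕ → (Fin n → ℝ) → ℝ := fun m x => F m x * dl' x ^ m
  have hF'0 : ∀ m, ∀ x ∉ K, F' m x = 0 := fun m x hx => by simp only [F', hF0 m x hx, zero_mul]
  have hF'SB : ∀ m, SB R (F' m) := fun m => SB.of K (isClosed_tsupport χ) hKb (hF'0 m) fun x hx =>
    ContDiffAt.mul (hFsm m x hx) ((sdl' x hx).pow m)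
  let H : κ → (Fin n → ℝ) → ℝ := fun i x => χ2 x * hh i x
  have hH : ∀ i, SB R (H i) := fun i => hχ2.mul_rep fun x hx => shh x hx i
  have hθK : ∀ x ∈ K, (Matrix.of fun i j => fderiv ℝ (H i) x (e j)).det = th x := by
    intro x hx
    rw [e2 x (hKb hx)]
    congr 2
    ext i j
    have : H i =ᶠ[𝓝 x] hh i := by
      filter_upwards [hχ21 x hx] with y hy
      simp only [H, hy, one_mul]
    rw [this.fderiv_eq]
  have hvan : ∀ y, (∀ i, H i y = 0) → F' 0 y = 0 := by
    intro y hy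
    by_cases hyK : y ∈ K
    · have hyb := hKb hyK
      have hy' : ∀ i, hh i y = 0 := fun i => by
        have := hy i
        simp only [H, (hχ21 y hyK).self_of_nhds, one_mul] at this
        exact this
      simp only [F', pow_zero, mul_one]
      by_cases hd : dl y = 0
      · rw [hFrec 0 y, hd, zero_mul]
      · have hph : ∀ j, ph j y = 0 := fun j => by
          have := e4 y hyb j
          simp only [hy', mul_zero, Finset.sum_const_zero] at this
          exact (mul_eq_zero.1 this).resolve_left hd
        simp only [F, hf0, hPv f hf y hyb hph, hph, mul_zero, Finset.sum_const_zero, sub_zero]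
    · exact hF'0 0 y hyK
  obtain ⟨w, hw, hwF⟩ := hl_main H (fun i => (hH i).1) e (fun x => (Matrix.of fun i j => fderiv ℝ (H i) x (e j)).det)
    (fun x => rfl) F' (fun m => (hF'SB m).1)
    (fun m => HasCompactSupport.intro hχc (hF'0 m)) (fun m x => by
      by_cases hx : x ∈ K
      · rw [hθK x hx]
        simp only [F', pow_zero, mul_one]
        rw [hFp m x, e1 x (hKb hx)]; ring
      · rw [hF'0 0 x hx, hF'0 m x hx, mul_zero]) hvan
  refine ⟨fun j x => Γ j 0 (x, dl x) + ∑ i, (χ2 x * w i x) * E i j x, fun j => (hGs j 0).add (SB.sum _ _ fun i _ =>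
    (hχ2.mul_rep fun x _ => (hw i).contDiffAt).mul_rep fun x hx => sE x hx i j), fun x => ?_⟩
  have hfF : f x = F' 0 x + ∑ j, Γ j 0 (x, dl x) * ph j x := by
    have h1 : χ x * f x = f x := by
      by_cases hx : x ∈ tsupport f
      · rw [(hχ1 x hx).self_of_nhds, one_mul]
      · rw [image_eq_zero_of_notMem_tsupport hx, mul_zero]
    simp only [F', F, pow_zero, mul_one, hf0, h1]; ring
  have h2 : F' 0 x = ∑ j, (∑ i, (χ2 x * w i x) * E i j x) * ph j x := by
    by_cases hx : x ∈ Metric.ball (0 : Fin n → ℝ) R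
    · rw [hwF x]
      simp only [H, e3 x hx, Finset.sum_mul, Finset.mul_sum]
      rw [Finset.sum_comm]
      exact Finset.sum_congr rfl fun j _ => Finset.sum_congr rfl fun i _ => by ring
    · rw [hF'0 0 x fun h => hx (hKb h)]
      have : χ2 x = 0 := image_eq_zero_of_notMem_tsupport fun h => hx (hχ2.2 h)
      simp [this]
  rw [hfF, h2, ← Finset.sum_add_distrib]
  exact Finset.sum_congr rfl fun j _ => by ring

theorem good_prime {ι : Type} [Fintype ι] (φ : ι → O n) (hp : (Ideal.span (Set.range φ)).IsPrime)
    (hind : ∀ δ, δ ∉ Ideal.span (Set.range φ) → Good (fun o : Option ι => o.elim δ φ)) : Good φ := by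
  obtain ⟨κ, _, _, h, e, δ', hh, hdet, hspan⟩ := prime_structure _ hp
  set th : O n := (Matrix.of fun i j => DD (e j) (h i)).det with hth
  have hE := fun i => Ideal.mem_span_range_iff_exists_fun.1 (hh i)
  choose E hE using hE
  have hB := fun j => Ideal.mem_span_range_iff_exists_fun.1 (hspan (φ j) (Ideal.subset_span ⟨j, rfl⟩))
  choose B hB using hB
  have hcf := colon_flat φ φ (th * δ') (fun x hx => (hp.mem_or_mem hx).resolve_left hdet)
  have e2 : ∀ᶠ x in 𝓝 (0 : Fin n → ℝ), rep th x = (Matrix.of fun i j => fderiv ℝ (rep (h i)) x (e j)).det := by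
    have h1 : ∀ᶠ x in 𝓝 (0 : Fin n → ℝ), ∀ i j, rep (DD (e j) (h i)) x = fderiv ℝ (rep (h i)) x (e j) :=
      eventually_all.2 fun i => eventually_all.2 fun j => rep_DD _ _
    filter_upwards [h1, rep_det (Matrix.of fun i j => DD (e j) (h i))] with x h1 h2
    rw [hth, h2]
    congr 2
    ext i j
    exact h1 i j
  have e3 : ∀ᶠ x in 𝓝 (0 : Fin n → ℝ), ∀ i, rep (h i) x = ∑ j, rep (E i j) x * rep (φ j) x :=
    eventually_all.2 fun i => by
      have := rep_dot (E i) φ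
      rw [hE i] at this; exact this
  have e4 : ∀ᶠ x in 𝓝 (0 : Fin n → ℝ), ∀ j, rep (th * δ') x * rep (φ j) x = ∑ i, rep (B j i) x * rep (h i) x :=
    eventually_all.2 fun j => by
      have h1 := rep_dot (B j) h
      rw [hB j] at h1
      filter_upwards [h1, rep_mul (th * δ') (φ j)] with x h1 h2
      rw [← h1, h2]; rfl
  filter_upwards [self_mem_nhdsWithin, hind _ hdet, ev_ball hcf, ev_ball e2, ev_ball e3, ev_ball e4, ev_ball (rep_mul th δ'),
    ev_ball (rep_smooth (th * δ')), ev_ball (rep_smooth δ'), ev_ball (eventually_all.2 fun j => rep_smooth (φ j)),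
    ev_ball (eventually_all.2 fun i => rep_smooth (h i)),
    ev_ball (eventually_all.2 fun i => eventually_all.2 fun j => rep_smooth (E i j))] with
    R hR hg hcf e2 e3 e4 e1 sδ sδ' sφ sh sE f hf hfor
  refine prime_core hR (rep (th * δ')) (rep δ') (rep th) (fun j => rep (φ j)) (fun i => rep (h i)) e
    (fun i j => rep (E i j)) (fun j i => rep (B j i)) sδ sδ' sφ sh sE e1 e2 e3 e4
    (fun f => SB R f ∧ ∀ a ∈ Metric.ball (0 : Fin n → ℝ) R, taylorAt f a ∈ FI a φ) (fun f h => h.1) ?_ ?_ f ⟨hf, hfor⟩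
  · rintro f ⟨hf, hfor⟩ y hy hz
    obtain ⟨c, hc⟩ := (mem_FI _ _ _).1 (hfor y hy)
    rw [← constantCoeff_taylorAt (f := f) (a := y), ← hc, map_sum]
    refine Finset.sum_eq_zero fun j _ => ?_
    rw [map_mul, constantCoeff_taylorAt, hz j, mul_zero]
  · rintro f ⟨hf, hfor⟩
    obtain ⟨u, hu, huf⟩ := hg f hf (fun a ha => by
      obtain ⟨c, hc⟩ := (mem_FI _ _ _).1 (hfor a ha)
      refine (mem_FI _ _ _).2 ⟨fun o => o.elim 0 c, ?_⟩
      rw [Fintype.sum_option]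
      simpa using hc)
    refine ⟨u none, fun j => u (some j), ⟨hu none, fun a ha => hcf a ha _ ?_⟩, fun j => hu _, fun x => ?_⟩
    · have := taylor_comb a f u (fun o : Option ι => rep (o.elim (th * δ') φ)) (fun o => (hu o).sm a)
        (fun o => by cases o with
          | none => exact sδ a ha
          | some j => exact sφ a ha j) (Eventually.of_forall huf)
      rw [Fintype.sum_option] at this
      simp only [Option.elim] at this
      rw [show taylorAt (u none) a * TT a (th * δ') = taylorAt f a - ∑ i, taylorAt (u (some i)) a * taylorAt (rep (φ i)) a by
        rw [this]; ring]
      exact Ideal.sub_mem _ (hfor a ha) ((mem_FI _ _ _).2 ⟨_, rfl⟩)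
    · rw [huf x, Fintype.sum_option]
      simp only [Option.elim]
      rw [mul_comm]

theorem good_all {ι : Type} [Fintype ι] (φ : ι → O n) : Good φ :=
  ideal_induction (fun ι _ φ => Good φ) (fun ι _ φ h => good_top φ h)
    (fun ι _ φ a r ψ h g1 g2 => good_nonprime φ a ψ h g1 g2) (fun ι _ φ hp h => good_prime φ hp h) ι φ

end goodprime
end QDC

namespace QDC
open Filter Topology
open scoped ContDiff
set_option linter.all false

section modules
variable {n : ℕ}

def GoodM {ι : Type} [Fintype ι] {p : ℕ} (Φ : ι → Fin p → O n) : Prop := ∀ᶠ R in 𝓝[>] (0 : ℝ),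
  ∀ f : Fin p → (Fin n → ℝ) → ℝ, (∀ c, SB R (f c)) →
    (∀ a ∈ Metric.ball (0 : Fin n → ℝ) R, ∃ G : ι → MvPowerSeries (Fin n) ℝ, ∀ c, taylorAt (f c) a = ∑ j, G j * TT a (Φ j c)) →
    ∃ g : ι → (Fin n → ℝ) → ℝ, (∀ j, SB R (g j)) ∧ ∀ x c, f c x = ∑ j, g j x * rep (Φ j c) x

theorem goodM_all (p : ℕ) : ∀ {ι : Type} [Fintype ι] (Φ : ι → Fin p → O n), GoodM Φ := by
  induction p with
  | zero =>
    intro ι _ Φ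
    exact Eventually.of_forall fun R f hf _ => ⟨fun _ _ => 0, fun j => SB.zero, fun x c => c.elim0⟩
  | succ p ih =>
    intro ι _ Φ
    obtain ⟨κ, _, C, hC, hrel⟩ := relGood_all (fun j => Φ j 0)
    let Ψ : κ → Fin p → O n := fun k c => ∑ j, C k j * Φ j c.succ
    have t1 : ∀ᶠ a in 𝓝 (0 : Fin n → ℝ), ∀ k c, TT a (Ψ k c) = ∑ j, TT a (C k j) * TT a (Φ j c.succ) :=
      eventually_all.2 fun k => eventually_all.2 fun c => TT_dot _ _
    have r1 : ∀ᶠ a in 𝓝 (0 : Fin n → ℝ), ∀ k c, rep (Ψ k c) a = ∑ j, rep (C k j) a * rep (Φ j c.succ) a :=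
      eventually_all.2 fun k => eventually_all.2 fun c => rep_dot _ _
    have r0 : ∀ᶠ a in 𝓝 (0 : Fin n → ℝ), ∀ k, ∑ j, rep (C k j) a * rep (Φ j 0) a = 0 :=
      eventually_all.2 fun k => by
        have := rep_dot (C k) (fun j => Φ j 0)
        rw [hC k] at this
        filter_upwards [this, rep_zero] with a h1 h2
        rw [← h1, h2]
    filter_upwards [good_all (fun j => Φ j 0), ih Ψ, ev_ball hrel, ev_ball t1, ev_ball r1, ev_ball r0,
      ev_ball (eventually_all.2 fun j => eventually_all.2 fun c => rep_smooth (Φ j c)),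
      ev_ball (eventually_all.2 fun k => eventually_all.2 fun j => rep_smooth (C k j))] with
      R g0 ih hrel t1 r1 r0 sΦ sC f hf hfor
    obtain ⟨g, hg, hgf⟩ := g0 (f 0) (hf 0) (fun a ha => by
      obtain ⟨G, hG⟩ := hfor a ha
      exact (mem_FI _ _ _).2 ⟨G, (hG 0).symm⟩)
    have hgS : ∀ c, SB R (fun x => ∑ j, g j x * rep (Φ j c) x) := fun c =>
      SB.sum _ _ fun j _ => (hg j).mul_rep fun x hx => sΦ x hx j c
    obtain ⟨y, hy, hyf⟩ := ih (fun c x => f c.succ x + - ∑ j, g j x * rep (Φ j c.succ) x)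
      (fun c => (hf _).add (hgS _).neg) (fun a ha => by
        obtain ⟨G, hG⟩ := hfor a ha
        have tg : ∀ c, taylorAt (fun x => ∑ j, g j x * rep (Φ j c) x) a = ∑ j, taylorAt (g j) a * TT a (Φ j c) := fun c =>
          taylor_comb a _ g (fun j => rep (Φ j c)) (fun j => (hg j).sm a) (fun j => sΦ a ha j c) (Eventually.of_forall fun _ => rfl)
        have h0 : taylorAt (f 0) a = ∑ j, taylorAt (g j) a * TT a (Φ j 0) := by
          rw [← tg 0]; exact congrArg (fun h => taylorAt h a) (funext hgf)
        obtain ⟨v, hv⟩ := hrel a ha (fun j => G j - taylorAt (g j) a) (by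
          simp only [sub_mul, Finset.sum_sub_distrib]
          rw [← hG 0, h0, sub_self])
        refine ⟨v, fun c => ?_⟩
        have h1 : taylorAt (fun x => f c.succ x + - ∑ j, g j x * rep (Φ j c.succ) x) a =
            ∑ j, (G j - taylorAt (g j) a) * TT a (Φ j c.succ) := by
          have h2 := taylorAt_sub ((hf c.succ).sm a) ((hgS c.succ).sm a)
          rw [tg, hG c.succ] at h2
          simp only [sub_mul, Finset.sum_sub_distrib]
          rw [← h2]
          exact congrArg (fun h => taylorAt h a) (funext fun x => by simp [sub_eq_add_neg])
        rw [h1]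
        simp only [hv, t1 a ha, Finset.sum_mul, Finset.mul_sum]
        rw [Finset.sum_comm]
        exact Finset.sum_congr rfl fun j _ => Finset.sum_congr rfl fun i _ => by ring)
    refine ⟨fun j x => g j x + ∑ k, y k x * rep (C k j) x, fun j => (hg j).add (SB.sum _ _ fun k _ => (hy k).mul_rep fun x hx => sC x hx k j), fun x c => ?_⟩
    by_cases hx : x ∈ Metric.ball (0 : Fin n → ℝ) R
    · have h3 : ∑ j, (g j x + ∑ k, y k x * rep (C k j) x) * rep (Φ j c) x =
          ∑ j, g j x * rep (Φ j c) x + ∑ k, y k x * ∑ j, rep (C k j) x * rep (Φ j c) x := by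
        simp only [add_mul, Finset.sum_add_distrib, Finset.sum_mul, Finset.mul_sum]
        congr 1
        rw [Finset.sum_comm]
        exact Finset.sum_congr rfl fun j _ => Finset.sum_congr rfl fun i _ => by ring
      rw [h3]
      refine Fin.cases ?_ (fun c => ?_) c
      · simp only [r0 x hx, mul_zero, Finset.sum_const_zero, add_zero]
        exact hgf x
      · have := hyf x c
        simp only [r1 x hx] at this
        rw [← this]; ring
    · have z : ∀ {g : (Fin n → ℝ) → ℝ}, SB R g → g x = 0 := fun hg => image_eq_zero_of_notMem_tsupport fun h => hx (hg.2 h)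
      rw [z (hf c)]
      simp only [z (hg _), z (hy _), zero_mul, Finset.sum_const_zero, add_zero]

theorem local_division {p q : ℕ} (U : Set (Fin n → ℝ)) (hU : IsOpen U)
    (Φ : Fin q → (Fin n → ℝ) → (Fin p → ℝ)) (hΦ : ∀ j : Fin q, AnalyticOnNhd ℝ (Φ j) U)
    (f : (Fin n → ℝ) → (Fin p → ℝ)) (hf : ContDiffOn ℝ ∞ f U)
    (hfor : ∀ a ∈ U, ∃ G : Fin q → MvPowerSeries (Fin n) ℝ, ∀ c : Fin p,
        taylorAt (fun x => f x c) a = ∑ j, G j * taylorAt (fun x => Φ j x c) a) (b : Fin n → ℝ) (hb : b ∈ U) :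
    ∃ W ∈ 𝓝 b, ∃ g : Fin q → (Fin n → ℝ) → ℝ, (∀ j, ContDiff ℝ ∞ (g j)) ∧
      ∀ x ∈ W, ∀ c, f x c = ∑ j, g j x * Φ j x c := by
  have hcan : ∀ j c, AnalyticAt ℝ (fun x => Φ j (x + b) c) 0 := by
    intro j c
    have h1 : AnalyticAt ℝ (fun x => Φ j x c) b :=
      ((ContinuousLinearMap.proj (R := ℝ) (φ := fun _ : Fin p => ℝ) c).analyticAt _).comp (hΦ j b hb)
    have h2 : AnalyticAt ℝ (fun x : Fin n → ℝ => x + b) 0 := analyticAt_id.add analyticAt_const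
    exact AnalyticAt.comp_of_eq (g := fun x => Φ j x c) h1 h2 (by simp)
  let φ : Fin q → Fin p → O n := fun j c => O.mk _ (hcan j c)
  have e1 : ∀ᶠ a in 𝓝 (0 : Fin n → ℝ), ∀ j c, rep (φ j c) =ᶠ[𝓝 a] fun x => Φ j (x + b) c :=
    eventually_all.2 fun j => eventually_all.2 fun c => (rep_mk _ (hcan j c)).eventuallyEq_nhds
  have e2 : ∀ᶠ a in 𝓝 (0 : Fin n → ℝ), a + b ∈ U := by
    have : Tendsto (fun a : Fin n → ℝ => a + b) (𝓝 0) (𝓝 b) := by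
      have h : Continuous fun a : Fin n → ℝ => a + b := by fun_prop
      simpa using h.tendsto 0
    exact this (hU.mem_nhds hb)
  obtain ⟨R, hR, hg, e1, e2⟩ := ((eventually_mem_nhdsWithin (a := (0 : ℝ)) (s := Set.Ioi 0)).and ((goodM_all p φ).and ((ev_ball e1).and (ev_ball e2)))).exists
  have hR : 0 < R := hR
  obtain ⟨χ, hχ, -, hχ1⟩ := exists_bump (n := n) (R := R) (K := Metric.closedBall 0 (R / 2)) Metric.isClosed_closedBall
    (Metric.closedBall_subset_ball (by linarith)) hR
  have hfs : ∀ c, ∀ x ∈ Metric.ball (0 : Fin n → ℝ) R, Sm x (fun x => f (x + b) c) := by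
    intro c x hx
    have h1 : ContDiffAt ℝ ∞ f (x + b) := hf.contDiffAt (hU.mem_nhds (e2 x hx))
    have h2 : ContDiffAt ℝ ∞ (fun y => f y c) (x + b) := contDiffAt_pi.1 h1 c
    exact ContDiffAt.comp x h2 (contDiffAt_id.add contDiffAt_const)
  obtain ⟨g, hgs, hgf⟩ := hg (fun c x => χ x * f (x + b) c) (fun c => hχ.mul_rep (hfs c)) (fun a ha => by
    obtain ⟨G, hG⟩ := hfor (a + b) (e2 a ha)
    refine ⟨fun j => taylorAt χ a * G j, fun c => ?_⟩
    have h1 : taylorAt (fun x => χ x * f (x + b) c) a = taylorAt χ a * taylorAt (fun x => f (x + b) c) a :=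
      taylorAt_mul (hχ.sm a) (hfs c a ha)
    rw [h1, taylorAt_translate (fun x => f x c) a b, hG c, Finset.mul_sum]
    refine Finset.sum_congr rfl fun j _ => ?_
    rw [← taylorAt_translate (fun x => Φ j x c) a b, mul_assoc]
    simp only [TT]
    rw [taylorAt_congr (e1 a ha j c)])
  refine ⟨Metric.ball b (R / 2), Metric.ball_mem_nhds b (by linarith), fun j x => g j (x - b), fun j => (hgs j).1.comp (contDiff_id.sub contDiff_const), fun x hx c => ?_⟩
  have h0 : x - b ∈ Metric.closedBall (0 : Fin n → ℝ) (R / 2) := by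
    simp only [Metric.mem_closedBall, dist_zero_right]
    rw [Metric.mem_ball, dist_eq_norm] at hx
    exact hx.le
  have h0' : x - b ∈ Metric.ball (0 : Fin n → ℝ) R := Metric.closedBall_subset_ball (by linarith) h0
  have := hgf (x - b) c
  simp only [(hχ1 _ h0).self_of_nhds, one_mul, sub_add_cancel] at this
  rw [this]
  refine Finset.sum_congr rfl fun j _ => ?_
  rw [(e1 _ h0' j c).self_of_nhds]
  simp only [sub_add_cancel]

open scoped Manifold in
theorem glue {p q : ℕ} (U : Set (Fin n → ℝ)) (hU : IsOpen U)
    (Φ : Fin q → (Fin n → ℝ) → (Fin p → ℝ)) (f : (Fin n → ℝ) → (Fin p → ℝ))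
    (h : ∀ b ∈ U, ∃ W ∈ 𝓝 b, ∃ g : Fin q → (Fin n → ℝ) → ℝ, (∀ j, ContDiff ℝ ∞ (g j)) ∧
      ∀ x ∈ W, ∀ c, f x c = ∑ j, g j x * Φ j x c) :
    ∃ g : Fin q → (Fin n → ℝ) → ℝ, (∀ j, ContDiffOn ℝ ∞ (g j) U) ∧
        ∀ x ∈ U, ∀ c : Fin p, f x c = ∑ j, g j x * Φ j x c := by
  classical
  let M : TopologicalSpace.Opens (Fin n → ℝ) := ⟨U, hU⟩
  haveI : LocallyCompactSpace M := hU.locallyCompactSpace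
  haveI : SecondCountableTopology M := TopologicalSpace.Subtype.secondCountableTopology _
  haveI : SigmaCompactSpace M := sigmaCompactSpace_of_locallyCompact_secondCountable
  obtain ⟨G, hG⟩ := exists_contMDiffMap_forall_mem_convex_of_local (I := 𝓘(ℝ, Fin n → ℝ)) (M := M) (F := Fin q → ℝ) (n := (⊤ : ℕ∞))
    (t := fun x : M => {y | ∀ c, f x c = ∑ j, y j * Φ j x c})
    (fun x y hy z hz a b ha hb hab c => by
      have hy := hy c
      have hz := hz c
      simp only [Pi.add_apply, Pi.smul_apply, smul_eq_mul, add_mul, Finset.sum_add_distrib, mul_assoc, ← Finset.mul_sum]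
      rw [← hy, ← hz, ← add_mul, hab, one_mul])
    (fun x => by
      obtain ⟨W, hW, g, hg, hgf⟩ := h x.1 x.2
      refine ⟨Subtype.val ⁻¹' W, continuous_subtype_val.continuousAt.preimage_mem_nhds hW, fun y j => g j y.1, ?_, fun y hy => hgf _ hy⟩
      have : ContDiff ℝ ∞ (fun y : Fin n → ℝ => fun j => g j y) := contDiff_pi.2 hg
      exact (this.contMDiff.comp contMDiff_subtype_val).contMDiffOn)
  let G' : (Fin n → ℝ) → Fin q → ℝ := fun x => if hx : x ∈ U then G ⟨x, hx⟩ else 0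
  have hG' : ContDiffOn ℝ ∞ G' U := by
    intro x hx
    have h1 : ContMDiffAt 𝓘(ℝ, Fin n → ℝ) 𝓘(ℝ, Fin q → ℝ) ∞ (fun y : M => G' y) ⟨x, hx⟩ := by
      have : (fun y : M => G' y) = G := by
        ext y : 1
        exact dif_pos y.2
      rw [this]
      exact G.contMDiff _
    exact (contMDiffAt_iff_contDiffAt.1 (contMDiffAt_subtype_iff.1 h1)).contDiffWithinAt
  refine ⟨fun j x => G' x j, fun j => contDiffOn_pi.1 hG' j, fun x hx c => ?_⟩
  have := hG ⟨x, hx⟩ c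
  rw [this]
  simp only [G', dif_pos hx]

end modules

theorem malgrange_division_analytic'
    {n p q : ℕ} (hp : 0 < p) (hq : 0 < q)
    (U : Set (Fin n → ℝ)) (hU : IsOpen U)
    (Φ : Fin q → (Fin n → ℝ) → (Fin p → ℝ))
    (hΦ : ∀ j : Fin q, AnalyticOnNhd ℝ (Φ j) U)
    (f : (Fin n → ℝ) → (Fin p → ℝ)) (hf : ContDiffOn ℝ (⊤ : ℕ∞) f U) :
    (∃ g : Fin q → (Fin n → ℝ) → ℝ,
        (∀ j, ContDiffOn ℝ (⊤ : ℕ∞) (g j) U) ∧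
        ∀ x ∈ U, ∀ c : Fin p, f x c = ∑ j, g j x * Φ j x c) ↔
    (∀ a ∈ U, ∃ G : Fin q → MvPowerSeries (Fin n) ℝ, ∀ c : Fin p,
        taylorAt (fun x => f x c) a = ∑ j, G j * taylorAt (fun x => Φ j x c) a) := by
  constructor
  · rintro ⟨g, hg, hgf⟩ a ha
    refine ⟨fun j => taylorAt (g j) a, fun c => ?_⟩
    refine taylor_comb a _ g (fun j x => Φ j x c) (fun j => (hg j).contDiffAt (hU.mem_nhds ha)) (fun j => ?_) ?_
    · exact contDiffAt_pi.1 ((hΦ j a ha).contDiffAt (n := ∞)) c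
    · filter_upwards [hU.mem_nhds ha] with x hx using hgf x hx c
  · intro h
    exact glue U hU Φ f (local_division U hU Φ hΦ f hf h)
end QDC

namespace QDC

/-- **Malgrange's division theorem.** Division of a `C^∞` function by finitely many
real-analytic maps is possible if and only if it is formally possible at every point. -/
theorem malgrange_division_analytic
    {n p q : ℕ} (hp : 0 < p) (hq : 0 < q)
    (U : Set (Fin n → ℝ)) (hU : IsOpen U)
    (Φ : Fin q → (Fin n → ℝ) → (Fin p → ℝ))
    (hΦ : ∀ j : Fin q, AnalyticOnNhd ℝ (Φ j) U)
    (f : (Fin n → ℝ) → (Fin p → ℝ)) (hf : ContDiffOn ℝ (⊤ : ℕ∞) f U) :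
    (∃ g : Fin q → (Fin n → ℝ) → ℝ,
        (∀ j, ContDiffOn ℝ (⊤ : ℕ∞) (g j) U) ∧
        ∀ x ∈ U, ∀ c : Fin p, f x c = ∑ j, g j x * Φ j x c) ↔
    (∀ a ∈ U, ∃ G : Fin q → MvPowerSeries (Fin n) ℝ, ∀ c : Fin p,
        taylorAt (fun x => f x c) a = ∑ j, G j * taylorAt (fun x => Φ j x c) a) := by
  exact malgrange_division_analytic' hp hq U hU Φ hΦ f hf

end QDC
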